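/- There exists a function assigning to every calligraph H a triple [H] = (a_H, b_H, c_H) ∈ ℤ³, with [L] = (1,1,0), [R] = (1,0,1), and [C] = (2,0,0), such that for every finite simple graph G satisfying the Laman conditions, every calligraphic split (G₁, G₂) of G, and every generic edge-length assignment λ : E(G) → ℝ_{>0}, the set of congruence classes of spherical realizations of G inducing λ is finite and has cardinality 2(a_{G₁}·a_{G₂} − b_{G₁}·b_{G₂} − c_{G₁}·c_{G₂}). -/

import Mathlib

/-- A finite simple graph: vertices are a finite set of naturals, edges are
two-element subsets of the vertex set. -/
structure GeoGraph where
  V : Finset ℕ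
  E : Finset (Finset ℕ)
  edge_sub : ∀ e ∈ E, e ⊆ V
  edge_two : ∀ e ∈ E, e.card = 2

def IsSubgraph (G' G : GeoGraph) : Prop :=
  G'.V ⊆ G.V ∧ G'.E ⊆ G.E

/-- The Laman conditions: `|E| = 2|V| - 3` and every subgraph with at least two
vertices satisfies `|E'| ≤ 2|V'| - 3`. -/
def Laman (G : GeoGraph) : Prop :=
  2 ≤ G.V.card ∧ G.E.card = 2 * G.V.card - 3 ∧
    ∀ G' : GeoGraph, IsSubgraph G' G → 2 ≤ G'.V.card → G'.E.card ≤ 2 * G'.V.card - 3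

/-- A generic edge-length assignment: positive real edge lengths that are
algebraically independent over ℚ. -/
def Generic (G : GeoGraph) (lam : Finset ℕ → ℝ) : Prop :=
  (∀ e ∈ G.E, 0 < lam e) ∧
    AlgebraicIndependent ℚ (fun e : G.E => lam e.1)

/-- A spherical realization: every vertex goes to the complex sphere. -/
def SphereRealization (G : GeoGraph) (ρ : ℕ → Fin 3 → ℂ) : Prop :=
  ∀ v ∈ G.V, ∑ i, ρ v i ^ 2 = 1

/-- A realization induces the edge lengths `lam`. -/
def SphereInduces (G : GeoGraph) (ρ : ℕ → Fin 3 → ℂ) (lam : Finset ℕ → ℝ) : Prop :=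
  ∀ u v : ℕ, ({u, v} : Finset ℕ) ∈ G.E →
    ∑ i, (ρ u i - ρ v i) ^ 2 = (lam {u, v} : ℂ)

/-- Congruence of spherical realizations via `SO₃(ℂ)`. -/
def SphereCongruent (G : GeoGraph) (ρ ρ' : ℕ → Fin 3 → ℂ) : Prop :=
  ∃ A : Matrix (Fin 3) (Fin 3) ℂ, A * A.transpose = 1 ∧ A.det = 1 ∧
    ∀ v ∈ G.V, ρ' v = A.mulVec (ρ v)

/-- Congruence classes of spherical realizations of `G` inducing `lam`. -/
def SphereClasses (G : GeoGraph) (lam : Finset ℕ → ℝ) : Type :=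
  Quot fun ρ ρ' : {ρ : ℕ → Fin 3 → ℂ // SphereRealization G ρ ∧ SphereInduces G ρ lam} =>
    SphereCongruent G ρ.1 ρ'.1

def PlaneInduces (G : GeoGraph) (ρ : ℕ → Fin 2 → ℂ) (lam : Finset ℕ → ℝ) : Prop :=
  ∀ u v : ℕ, ({u, v} : Finset ℕ) ∈ G.E →
    ∑ i, (ρ u i - ρ v i) ^ 2 = (lam {u, v} : ℂ)

/-- Congruence of plane realizations via `SO₂(ℂ)` and a translation. -/
def PlaneCongruent (G : GeoGraph) (ρ ρ' : ℕ → Fin 2 → ℂ) : Prop :=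
  ∃ A : Matrix (Fin 2) (Fin 2) ℂ, ∃ b : Fin 2 → ℂ, A * A.transpose = 1 ∧ A.det = 1 ∧
    ∀ v ∈ G.V, ρ' v = A.mulVec (ρ v) + b

/-- Congruence classes of plane realizations of `G` inducing `lam`. -/
def PlaneClasses (G : GeoGraph) (lam : Finset ℕ → ℝ) : Type :=
  Quot fun ρ ρ' : {ρ : ℕ → Fin 2 → ℂ // PlaneInduces G ρ lam} =>
    PlaneCongruent G ρ.1 ρ'.1

/-- A calligraph: `{0,1,2} ⊆ V`, `{1,2} ∈ E`, `|E| = 2|V| - 4`, and adding the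
edge `{0,1}` or the edge `{0,2}` yields a graph satisfying the Laman conditions. -/
def Calligraph (H : GeoGraph) : Prop :=
  ({0, 1, 2} : Finset ℕ) ⊆ H.V ∧ ({1, 2} : Finset ℕ) ∈ H.E ∧
    H.E.card = 2 * H.V.card - 4 ∧
    ((∃ H' : GeoGraph, H'.V = H.V ∧ H'.E = insert {0, 1} H.E ∧ Laman H') ∨
     (∃ H' : GeoGraph, H'.V = H.V ∧ H'.E = insert {0, 2} H.E ∧ Laman H'))

/-- A split of `G` into two subgraphs sharing exactly the vertices `0,1,2` and
the edge `{1,2}`. -/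
def IsSplit (G G₁ G₂ : GeoGraph) : Prop :=
  G.V = G₁.V ∪ G₂.V ∧ G.E = G₁.E ∪ G₂.E ∧
    G₁.V ∩ G₂.V = ({0, 1, 2} : Finset ℕ) ∧
    G₁.E ∩ G₂.E = ({{1, 2}} : Finset (Finset ℕ))

/-- A calligraphic split: a split into two calligraphs. -/
def CalligraphicSplit (G G₁ G₂ : GeoGraph) : Prop :=
  IsSplit G G₁ G₂ ∧ Calligraph G₁ ∧ Calligraph G₂

section

open Polynomial

section Acl

variable {F : Type*} [Field F] [CharZero F]

/-- The elements of `F` that are algebraic over the subfield generated by `S`. -/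
noncomputable def acl (S : Set F) : Subfield F where
  carrier := (AlgebraicIndependent.matroid ℚ F).closure S
  mul_mem' {a b} ha hb := by
    rw [AlgebraicIndependent.matroid_closure_eq] at *; exact mul_mem ha hb
  one_mem' := by rw [AlgebraicIndependent.matroid_closure_eq]; exact one_mem _
  add_mem' {a b} ha hb := by
    rw [AlgebraicIndependent.matroid_closure_eq] at *; exact add_mem ha hb
  zero_mem' := by rw [AlgebraicIndependent.matroid_closure_eq]; exact zero_mem _
  neg_mem' {a} ha := by
    rw [AlgebraicIndependent.matroid_closure_eq] at *; exact neg_mem ha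
  inv_mem' a ha := by
    rw [AlgebraicIndependent.matroid_closure_eq] at *
    exact IsAlgebraic.inv ha

theorem coe_acl (S : Set F) : (acl S : Set F) = (AlgebraicIndependent.matroid ℚ F).closure S := rfl

theorem mem_acl_iff {S : Set F} {x : F} : x ∈ acl S ↔ IsAlgebraic (Algebra.adjoin ℚ S) x := by
  rw [← SetLike.mem_coe, coe_acl, AlgebraicIndependent.matroid_closure_eq]; rfl

theorem subset_acl (S : Set F) : S ⊆ acl S :=
  (AlgebraicIndependent.matroid ℚ F).subset_closure S (Set.subset_univ _)

theorem acl_mono {S T : Set F} (h : S ⊆ T) : acl S ≤ acl T :=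
  (AlgebraicIndependent.matroid ℚ F).closure_subset_closure h

theorem acl_le {S T : Set F} (h : S ⊆ acl T) : acl S ≤ acl T :=
  (AlgebraicIndependent.matroid ℚ F).closure_subset_closure_of_subset_closure h

theorem adjoin_le_acl (S : Set F) : ((IntermediateField.adjoin ℚ S : IntermediateField ℚ F) : Set F) ⊆ acl S := by
  have : IntermediateField.adjoin ℚ S ≤ (acl S).toIntermediateField (fun x => by simp) := by
    rw [IntermediateField.adjoin_le_iff]; exact subset_acl S
  exact this

/-- A root of a nonzero polynomial with coefficients in `acl S` lies in `acl S`. -/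
theorem mem_acl_of_root {S : Set F} {x : F} {p : F[X]} (hp : p ≠ 0)
    (hc : ∀ n, p.coeff n ∈ acl S) (hx : p.eval x = 0) : x ∈ acl S := by
  have h1 := (AlgebraicIndependent.matroid_isFlat_iff (R := ℚ) (A := F)).1
    ((AlgebraicIndependent.matroid ℚ F).isFlat_closure S)
  obtain ⟨T, hT, hT'⟩ := h1
  have hc' : ∀ n, p.coeff n ∈ T.toSubring := fun n => by
    have : p.coeff n ∈ (T : Set F) := by rw [hT]; exact hc n
    exact this
  suffices hx' : x ∈ (T : Set F) by rwa [hT] at hx'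
  have hT'' : ∀ a : F, IsAlgebraic T a → a ∈ (T : Set F) := by rw [hT]; exact hT'
  apply hT''
  have hsub : (↑p.coeffs : Set F) ⊆ T.toSubring := by
    intro y hy
    obtain ⟨n, _, rfl⟩ := Polynomial.mem_coeffs_iff.1 hy
    exact hc' n
  refine ⟨p.toSubring T.toSubring hsub, ?_, ?_⟩
  · intro h0
    apply hp
    have := Polynomial.map_toSubring p T.toSubring hsub
    rw [h0] at this
    simpa using this.symm
  · have := Polynomial.map_toSubring p T.toSubring hsub
    rw [← this, Polynomial.eval_map] at hx
    exact hx

theorem mem_acl_of_sq {S : Set F} {x : F} (h : x ^ 2 ∈ acl S) : x ∈ acl S := by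
  refine mem_acl_of_root (p := X ^ 2 - C (x ^ 2)) ?_ ?_ (by simp)
  · exact X_pow_sub_C_ne_zero (by norm_num) _
  · intro n
    rw [coeff_sub, coeff_X_pow, coeff_C]
    split_ifs <;> first | exact sub_mem (one_mem _) h | exact sub_mem (zero_mem _) h | exact sub_mem (one_mem _) (zero_mem _) | exact sub_mem (zero_mem _) (zero_mem _)

theorem map_mem_acl {F' : Type*} [Field F'] [CharZero F'] (σ : F →+* F') {S : Set F} {x : F}
    (h : x ∈ acl S) : σ x ∈ acl (σ '' S) := by
  rw [mem_acl_iff] at h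
  obtain ⟨p, hp, hx⟩ := h
  refine mem_acl_of_root (p := (p.map (algebraMap _ F)).map σ) ?_ ?_ ?_
  · rw [Polynomial.map_ne_zero_iff σ.injective,
      Polynomial.map_ne_zero_iff (FaithfulSMul.algebraMap_injective _ _)]
    exact hp
  · intro n
    rw [coeff_map, coeff_map]
    have h1 : (Algebra.adjoin ℚ S) ≤ ((acl (σ '' S)).toIntermediateField (K := ℚ) (fun x => by simp)).toSubalgebra.comap σ.toRatAlgHom := by
      rw [Algebra.adjoin_le_iff]
      intro y hy
      exact subset_acl _ ⟨y, hy, rfl⟩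
    exact h1 (p.coeff n).2
  · rw [eval_map, eval₂_hom, eval_map]
    rw [aeval_def] at hx
    rw [hx, map_zero]

theorem AlgebraicIndependent.map_ringHom {F' : Type*} [Field F'] [CharZero F'] (σ : F →+* F') {ι : Type*}
    {f : ι → F} (h : AlgebraicIndependent ℚ f) : AlgebraicIndependent ℚ (fun i => σ (f i)) :=
  h.map' (f := σ.toRatAlgHom) σ.injective

/-- A family spanning at least as many independent elements as its size is independent. -/
theorem algebraicIndependent_of_card_le {ι κ : Type*} [Fintype ι] [Fintype κ] {f : ι → F}
    {g : κ → F} (hf : AlgebraicIndependent ℚ f) (h : ∀ i, f i ∈ acl (Set.range g))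
    (hc : Fintype.card κ ≤ Fintype.card ι) :
    AlgebraicIndependent ℚ g ∧ ∀ k, g k ∈ acl (Set.range f) := by
  set M := AlgebraicIndependent.matroid ℚ F
  have hI : M.Indep (Set.range f) := hf.to_subtype_range
  have hfc : (Set.range f).encard = Fintype.card ι := by
    rw [← Set.image_univ, hf.injective.encard_image]; simp
  have hr : Set.range f ⊆ M.closure (Set.range g) := by rintro _ ⟨i, rfl⟩; exact h i
  have h1 : (Fintype.card ι : ℕ∞) ≤ M.eRk (Set.range g) := by
    rw [← hfc, ← hI.eRk_eq_encard, ← M.eRk_closure_eq (Set.range g)]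
    exact M.eRk_mono hr
  have h2 : (Set.range g).encard ≤ Fintype.card κ := by
    rw [← Set.image_univ]
    refine (Set.encard_image_le _ _).trans (by simp)
  have h3 := M.eRk_le_encard (Set.range g)
  have hc' : (Fintype.card κ : ℕ∞) ≤ Fintype.card ι := by exact_mod_cast hc
  have heq : M.eRk (Set.range g) = (Set.range g).encard := le_antisymm h3 (h2.trans (hc'.trans h1))
  have hinj : Function.Injective g := by
    have h5 : (Fintype.card κ : ℕ∞) ≤ (Set.range g).encard := hc'.trans (h1.trans h3)
    rw [← Set.image_univ] at h5
    have : (Set.univ : Set κ).encard = Fintype.card κ := by simp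
    rw [← this] at h5
    exact Set.injOn_univ.1 (Set.Finite.injOn_of_encard_image_eq (Set.toFinite _) (le_antisymm (Set.encard_image_le _ _) h5))
  have hgI : M.Indep (Set.range g) := by
    rw [Matroid.indep_iff_eRk_eq_encard_of_finite (Set.finite_range g)]
    exact heq
  refine ⟨(algebraicIndependent_subtype_range hinj).1 hgI, ?_⟩
  have hcl : M.closure (Set.range f) = M.closure (Set.range g) := by
    rw [← M.closure_closure (Set.range g)]
    refine (M.isRkFinite_of_finite (Set.finite_range f)).closure_eq_closure_of_subset_of_eRk_ge_eRk
      hr ?_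
    rw [M.eRk_closure_eq, hI.eRk_eq_encard, hfc]
    exact h3.trans (h2.trans hc')
  intro k
  change g k ∈ M.closure _
  rw [hcl]
  exact M.subset_closure _ (Set.subset_univ _) ⟨k, rfl⟩

end Acl

section Acl2
variable {F : Type*} [Field F] [CharZero F]

theorem AlgebraicIndependent.option_of_notMem_acl {ι : Type*} {f : ι → F}
    (hf : AlgebraicIndependent ℚ f) {a : F} (ha : a ∉ acl (Set.range f)) :
    AlgebraicIndependent ℚ (fun o : Option ι => o.elim a f) := by
  rw [hf.option_iff_transcendental]
  rwa [mem_acl_iff] at ha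

theorem AlgebraicIndependent.notMem_acl_of_option {ι : Type*} {f : ι → F} {a : F}
    (h : AlgebraicIndependent ℚ (fun o : Option ι => o.elim a f)) : a ∉ acl (Set.range f) := by
  rw [mem_acl_iff]
  exact (AlgebraicIndependent.option_iff.1 h).2

theorem mem_acl_inter {α : Type*} {μ : α → F} {s t : Set α} (h : AlgebraicIndepOn ℚ μ (s ∪ t))
    {x : F} (hs : x ∈ acl (μ '' s)) (ht : x ∈ acl (μ '' t)) : x ∈ acl (μ '' (s ∩ t)) := by
  have h1 : (AlgebraicIndependent.matroid ℚ F).Indep (μ '' s ∪ μ '' t) := by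
    rw [← Set.image_union]
    have := h.to_subtype_range
    rwa [← Set.image_eq_range] at this
  have hinj : Set.InjOn μ (s ∪ t) := by
    intro a ha b hb hab
    have := h.injective (a₁ := ⟨a, ha⟩) (a₂ := ⟨b, hb⟩) hab
    exact congrArg Subtype.val this
  have h2 := h1.closure_inter_eq_inter_closure
  rw [← hinj.image_inter Set.subset_union_left Set.subset_union_right] at h2
  have : x ∈ (AlgebraicIndependent.matroid ℚ F).closure (μ '' s) ∩ (AlgebraicIndependent.matroid ℚ F).closure (μ '' t) := ⟨hs, ht⟩
  rw [← h2] at this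
  exact this

theorem acl_image_ringEquiv {F' : Type*} [Field F'] [CharZero F'] (σ : F ≃+* F') (S : Set F) (x : F) :
    σ x ∈ acl (σ '' S) ↔ x ∈ acl S := by
  refine ⟨fun h => ?_, fun h => map_mem_acl σ.toRingHom h⟩
  have := map_mem_acl σ.symm.toRingHom h
  simpa [Set.image_image] using this

end Acl2

theorem exists_ringEquiv_of_isTranscendenceBasis {ι : Type*} {v w : ι → ℂ}
    (hv : IsTranscendenceBasis ℚ v) (hw : IsTranscendenceBasis ℚ w) :
    ∃ σ : ℂ ≃+* ℂ, ∀ i, σ (v i) = w i := by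
  let _ := IsAlgClosed.isAlgClosure_of_transcendence_basis v hv
  let _ := IsAlgClosed.isAlgClosure_of_transcendence_basis w hw
  let e : Algebra.adjoin ℚ (Set.range v) ≃+* Algebra.adjoin ℚ (Set.range w) :=
    hv.1.aevalEquiv.symm.toRingEquiv.trans hw.1.aevalEquiv.toRingEquiv
  refine ⟨IsAlgClosure.equivOfEquiv ℂ ℂ e, fun i => ?_⟩
  have h1 := IsAlgClosure.equivOfEquiv_algebraMap ℂ ℂ e
    ⟨v i, Algebra.subset_adjoin ⟨i, rfl⟩⟩
  have h2 : hv.1.aevalEquiv (MvPolynomial.X i) = ⟨v i, Algebra.subset_adjoin ⟨i, rfl⟩⟩ := by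
    ext; simp
  have h3 : e ⟨v i, Algebra.subset_adjoin ⟨i, rfl⟩⟩ = hw.1.aevalEquiv (MvPolynomial.X i) := by
    rw [← h2]; simp [e]
  rw [h3] at h1
  have h4 : algebraMap (Algebra.adjoin ℚ (Set.range w)) ℂ (hw.1.aevalEquiv (MvPolynomial.X i)) = w i := by
    change ((hw.1.aevalEquiv (MvPolynomial.X i) : Algebra.adjoin ℚ (Set.range w)) : ℂ) = _
    simp
  rw [h4] at h1
  exact h1

open Cardinal in
/-- A finite independent family of complex numbers extends to a transcendence basis indexed by
`ι ⊕ ℝ`. -/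
theorem exists_isTranscendenceBasis_sum {ι : Type} [Finite ι] {f : ι → ℂ}
    (hf : AlgebraicIndependent ℚ f) :
    ∃ v : ι ⊕ ℝ → ℂ, IsTranscendenceBasis ℚ v ∧ ∀ i, v (Sum.inl i) = f i := by
  obtain ⟨s, hs, hb⟩ := exists_isTranscendenceBasis_superset (R := ℚ) (s := Set.range f)
    hf.to_subtype_range
  have hc := IsAlgClosed.cardinal_eq_cardinal_transcendence_basis_of_aleph0_lt' (R := ℚ) _ hb
    (by simp) (by rw [Cardinal.mk_complex]; exact Cardinal.aleph0_lt_continuum)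
  have hfin : #(Set.range f) < ℵ₀ := Cardinal.lt_aleph0_of_finite _
  have hd : #(s \ Set.range f : Set ℂ) = #ℝ := by
    have h1 := Cardinal.mk_sdiff_add_mk hs
    rw [← hc, Cardinal.mk_complex] at h1
    have h2 : ℵ₀ ≤ #(s \ Set.range f : Set ℂ) := by
      by_contra h
      have := Cardinal.add_lt_aleph0 (not_le.1 h) hfin
      rw [h1] at this
      exact absurd this (not_lt.2 Cardinal.aleph0_le_continuum)
    rw [Cardinal.add_eq_left h2 (hfin.le.trans h2)] at h1
    rw [h1, Cardinal.mk_real]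
  obtain ⟨e⟩ := Cardinal.eq.1 hd
  let e1 : ι ≃ Set.range f := Equiv.ofInjective f hf.injective
  classical
  let E : ι ⊕ ℝ ≃ s := (Equiv.sumCongr e1 e.symm).trans (Equiv.Set.sumDiffSubset hs)
  refine ⟨fun x => (E x : ℂ), ?_, fun i => ?_⟩
  · exact (isTranscendenceBasis_equiv E).2 hb
  · simp [E, e1]

theorem exists_ringEquiv_of_algebraicIndependent {ι : Type} [Finite ι] {f g : ι → ℂ}
    (hf : AlgebraicIndependent ℚ f) (hg : AlgebraicIndependent ℚ g) :
    ∃ σ : ℂ ≃+* ℂ, ∀ i, σ (f i) = g i := by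
  obtain ⟨v, hv, hvf⟩ := exists_isTranscendenceBasis_sum hf
  obtain ⟨w, hw, hwg⟩ := exists_isTranscendenceBasis_sum hg
  obtain ⟨σ, hσ⟩ := exists_ringEquiv_of_isTranscendenceBasis hv hw
  exact ⟨σ, fun i => by rw [← hvf, hσ, hwg]⟩

/-- There are arbitrarily large finite independent families of complex numbers. -/
theorem exists_algebraicIndependent_complex (ι : Type) [Finite ι] :
    ∃ f : ι → ℂ, AlgebraicIndependent ℚ f := by
  obtain ⟨v, hv, -⟩ := exists_isTranscendenceBasis_sum (ι := Empty) (f := Empty.elim)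
    (algebraicIndependent_empty_type_iff.2 (algebraMap ℚ ℂ).injective)
  obtain ⟨e⟩ : Nonempty (ι ↪ ℕ) := by
    obtain ⟨n, ⟨e⟩⟩ := Finite.exists_equiv_fin ι
    exact ⟨e.toEmbedding.trans Fin.valEmbedding⟩
  exact ⟨fun i => v (Sum.inr (e i : ℝ)), hv.1.comp (fun i => Sum.inr (e i : ℝ))
    (fun a b h => e.injective (by simpa using h))⟩

namespace ValuationSubring

variable {F : Type*} [Field F] (𝒪 : ValuationSubring F)

/-- The residue map, extended by zero outside the valuation ring. -/
noncomputable def rs (x : F) : IsLocalRing.ResidueField 𝒪 :=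
  open Classical in if h : x ∈ 𝒪 then IsLocalRing.residue 𝒪 ⟨x, h⟩ else 0

variable {𝒪}

theorem rs_of_mem {x : F} (h : x ∈ 𝒪) : 𝒪.rs x = IsLocalRing.residue 𝒪 ⟨x, h⟩ := by
  simp [rs, h]

theorem rs_add {x y : F} (hx : x ∈ 𝒪) (hy : y ∈ 𝒪) : 𝒪.rs (x + y) = 𝒪.rs x + 𝒪.rs y := by
  rw [rs_of_mem hx, rs_of_mem hy, rs_of_mem (AddMemClass.add_mem hx hy), ← map_add]; rfl

theorem rs_sub {x y : F} (hx : x ∈ 𝒪) (hy : y ∈ 𝒪) : 𝒪.rs (x - y) = 𝒪.rs x - 𝒪.rs y := by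
  rw [rs_of_mem hx, rs_of_mem hy, rs_of_mem (_root_.sub_mem hx hy), ← map_sub]; rfl

theorem rs_mul {x y : F} (hx : x ∈ 𝒪) (hy : y ∈ 𝒪) : 𝒪.rs (x * y) = 𝒪.rs x * 𝒪.rs y := by
  rw [rs_of_mem hx, rs_of_mem hy, rs_of_mem (MulMemClass.mul_mem hx hy), ← map_mul]; rfl

theorem rs_neg {x : F} (hx : x ∈ 𝒪) : 𝒪.rs (-x) = - 𝒪.rs x := by
  rw [rs_of_mem hx, rs_of_mem (NegMemClass.neg_mem hx), ← map_neg]; rfl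

@[simp] theorem rs_zero : 𝒪.rs 0 = 0 := by
  rw [rs_of_mem (ZeroMemClass.zero_mem _)]; exact map_zero (IsLocalRing.residue 𝒪)

@[simp] theorem rs_one : 𝒪.rs 1 = 1 := by
  rw [rs_of_mem (OneMemClass.one_mem _)]; exact map_one (IsLocalRing.residue 𝒪)

theorem rs_two : 𝒪.rs 2 = 2 := by
  rw [← one_add_one_eq_two, rs_add (OneMemClass.one_mem _) (OneMemClass.one_mem _), rs_one, one_add_one_eq_two]

theorem inv_mem_of_rs_ne_zero {x : F} (h : 𝒪.rs x ≠ 0) : x⁻¹ ∈ 𝒪 := by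
  by_cases hx : x ∈ 𝒪
  · rw [rs_of_mem hx] at h
    have h1 : IsUnit (⟨x, hx⟩ : 𝒪) := by
      rwa [IsLocalRing.residue_ne_zero_iff_isUnit] at h
    obtain ⟨y, hy⟩ := h1.exists_right_inv
    have h2 : x * (y : F) = 1 := congrArg Subtype.val hy
    rw [inv_eq_of_mul_eq_one_right h2]
    exact y.2
  · simp [rs, hx] at h

theorem mem_of_rs_ne_zero {x : F} (h : 𝒪.rs x ≠ 0) : x ∈ 𝒪 := by
  by_contra hx; simp [rs, hx] at h

theorem ne_zero_of_rs_ne_zero {x : F} (h : 𝒪.rs x ≠ 0) : x ≠ 0 := by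
  rintro rfl; simp at h

theorem rs_inv {x : F} (h : 𝒪.rs x ≠ 0) : 𝒪.rs x⁻¹ = (𝒪.rs x)⁻¹ := by
  have h1 := rs_mul (mem_of_rs_ne_zero h) (inv_mem_of_rs_ne_zero h)
  rw [mul_inv_cancel₀ (ne_zero_of_rs_ne_zero h), rs_one] at h1
  exact eq_inv_of_mul_eq_one_right h1.symm

theorem rs_div {x y : F} (hx : x ∈ 𝒪) (h : 𝒪.rs y ≠ 0) : 𝒪.rs (x / y) = 𝒪.rs x / 𝒪.rs y := by
  rw [div_eq_mul_inv, rs_mul hx (inv_mem_of_rs_ne_zero h), rs_inv h, div_eq_mul_inv]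

theorem div_mem_of_rs {x y : F} (hx : x ∈ 𝒪) (h : 𝒪.rs y ≠ 0) : x / y ∈ 𝒪 := by
  rw [div_eq_mul_inv]; exact MulMemClass.mul_mem hx (inv_mem_of_rs_ne_zero h)

theorem inv_mem_of_notMem {x : F} (h : x ∉ 𝒪) : x⁻¹ ∈ 𝒪 :=
  (𝒪.mem_or_inv_mem x).resolve_left h

theorem ne_zero_of_notMem {x : F} (h : x ∉ 𝒪) : x ≠ 0 := by
  rintro rfl; exact h (ZeroMemClass.zero_mem _)

theorem rs_inv_of_notMem {x : F} (h : x ∉ 𝒪) : 𝒪.rs x⁻¹ = 0 := by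
  by_contra h1
  have := inv_mem_of_rs_ne_zero h1
  rw [inv_inv] at this
  exact h this

theorem inv_notMem {x : F} (h : 𝒪.rs x = 0) (hx : x ∈ 𝒪) (h0 : x ≠ 0) : x⁻¹ ∉ 𝒪 := by
  intro h1
  have := rs_mul hx h1
  rw [mul_inv_cancel₀ h0, h] at this
  simp at this

theorem div_notMem {x y : F} (hx : 𝒪.rs x ≠ 0) (hy : 𝒪.rs y = 0) (hy' : y ∈ 𝒪) (h0 : y ≠ 0) :
    x / y ∉ 𝒪 := by
  intro h
  have h1 := MulMemClass.mul_mem h (inv_mem_of_rs_ne_zero hx)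
  have h2 : x / y * x⁻¹ = y⁻¹ := by
    field_simp [ne_zero_of_rs_ne_zero hx]
  rw [h2] at h1
  exact inv_notMem hy hy' h0 h1

/-- `w` is either infinite or has residue in `K`. -/
def ResIn (𝒪 : ValuationSubring F) (K : Subfield (IsLocalRing.ResidueField 𝒪)) (w : F) : Prop :=
  w ∈ 𝒪 → 𝒪.rs w ∈ K

/-- `w` is a unit with residue in `K`. -/
def UnitIn (𝒪 : ValuationSubring F) (K : Subfield (IsLocalRing.ResidueField 𝒪)) (w : F) : Prop :=
  𝒪.rs w ≠ 0 ∧ 𝒪.rs w ∈ K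

variable {K : Subfield (IsLocalRing.ResidueField 𝒪)} {w u x y : F}

theorem ResIn.mono {K' : Subfield (IsLocalRing.ResidueField 𝒪)} (hw : 𝒪.ResIn K w) (h : K ≤ K') :
    𝒪.ResIn K' w := fun h1 => h (hw h1)

theorem ResIn.rs_mem (hw : 𝒪.ResIn K w) : 𝒪.rs w ∈ K := by
  by_cases h : w ∈ 𝒪
  · exact hw h
  · simp [rs, h, ZeroMemClass.zero_mem]

theorem ResIn.of_rs_mem (h : 𝒪.rs w ∈ K) : 𝒪.ResIn K w := fun _ => h

theorem resIn_zero : 𝒪.ResIn K (0 : F) := fun _ => by rw [rs_zero]; exact ZeroMemClass.zero_mem _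

theorem resIn_one : 𝒪.ResIn K (1 : F) := fun _ => by rw [rs_one]; exact OneMemClass.one_mem _

theorem resIn_of_notMem (h : w ∉ 𝒪) : 𝒪.ResIn K w := fun h' => absurd h' h

theorem ResIn.inv (h : 𝒪.ResIn K w) : 𝒪.ResIn K w⁻¹ := by
  by_cases h0 : 𝒪.rs w = 0
  · by_cases hw : w ∈ 𝒪
    · by_cases hz : w = 0
      · rw [hz, inv_zero]; exact resIn_zero
      · exact resIn_of_notMem (inv_notMem h0 hw hz)
    · intro _; rw [rs_inv_of_notMem hw]; exact ZeroMemClass.zero_mem _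
  · intro _; rw [rs_inv h0]; exact InvMemClass.inv_mem h.rs_mem

theorem ResIn.div_comm {x y : F} (h : 𝒪.ResIn K (x / y)) : 𝒪.ResIn K (y / x) := by
  have := h.inv; rwa [inv_div] at this

theorem ResIn.neg (h : 𝒪.ResIn K w) : 𝒪.ResIn K (-w) := by
  intro h1
  have h2 : w ∈ 𝒪 := by simpa using NegMemClass.neg_mem h1
  rw [rs_neg h2]; exact NegMemClass.neg_mem (h h2)

theorem ResIn.add {c : F} (h : 𝒪.ResIn K w) (hc : c ∈ 𝒪) (hcK : 𝒪.rs c ∈ K) :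
    𝒪.ResIn K (w + c) := by
  intro h1
  have h2 : w ∈ 𝒪 := by simpa using _root_.sub_mem h1 hc
  rw [rs_add h2 hc]; exact AddMemClass.add_mem (h h2) hcK

theorem ResIn.one_sub (h : 𝒪.ResIn K w) : 𝒪.ResIn K (1 - w) := by
  have := h.neg.add (OneMemClass.one_mem 𝒪) (by rw [rs_one]; exact OneMemClass.one_mem _)
  rwa [neg_add_eq_sub] at this

theorem UnitIn.mem (h : 𝒪.UnitIn K u) : u ∈ 𝒪 := mem_of_rs_ne_zero h.1

theorem UnitIn.ne_zero (h : 𝒪.UnitIn K u) : u ≠ 0 := ne_zero_of_rs_ne_zero h.1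

theorem UnitIn.inv (h : 𝒪.UnitIn K u) : 𝒪.UnitIn K u⁻¹ := by
  refine ⟨?_, ?_⟩ <;> rw [rs_inv h.1]
  · exact inv_ne_zero h.1
  · exact InvMemClass.inv_mem h.2

theorem UnitIn.mul {u' : F} (h : 𝒪.UnitIn K u) (h' : 𝒪.UnitIn K u') : 𝒪.UnitIn K (u * u') := by
  refine ⟨?_, ?_⟩ <;> rw [rs_mul h.mem h'.mem]
  · exact mul_ne_zero h.1 h'.1
  · exact MulMemClass.mul_mem h.2 h'.2

theorem UnitIn.div {u' : F} (h : 𝒪.UnitIn K u) (h' : 𝒪.UnitIn K u') : 𝒪.UnitIn K (u / u') := by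
  rw [div_eq_mul_inv]; exact h.mul h'.inv

theorem ResIn.mul_unitIn (h : 𝒪.ResIn K w) (hu : 𝒪.UnitIn K u) : 𝒪.ResIn K (w * u) := by
  intro h1
  have h2 : w ∈ 𝒪 := by
    have := MulMemClass.mul_mem h1 hu.inv.mem
    rwa [mul_inv_cancel_right₀ hu.ne_zero] at this
  rw [rs_mul h2 hu.mem]; exact MulMemClass.mul_mem (h h2) hu.2

theorem unitIn_one_sub (hw : w ∈ 𝒪) (h0 : 𝒪.rs w = 0) : 𝒪.UnitIn K (1 - w) := by
  have : 𝒪.rs (1 - w) = 1 := by rw [rs_sub (OneMemClass.one_mem _) hw, h0, rs_one, sub_zero]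
  refine ⟨?_, ?_⟩ <;> rw [this]
  · exact one_ne_zero
  · exact OneMemClass.one_mem _

theorem unitIn_one_sub_inv (hw : w ∉ 𝒪) : 𝒪.UnitIn K (1 - w⁻¹) :=
  unitIn_one_sub (inv_mem_of_notMem hw) (rs_inv_of_notMem hw)

/-- All finite ratios of differences of points of `P` based at a point of `P` have residue in `K`. -/
def RatSet (𝒪 : ValuationSubring F) (K : Subfield (IsLocalRing.ResidueField 𝒪)) (P : Set F) : Prop :=
  ∀ a ∈ P, ∀ b ∈ P, ∀ d ∈ P, 𝒪.ResIn K ((a - b) / (a - d))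

theorem RatSet.mono {K' : Subfield (IsLocalRing.ResidueField 𝒪)} {P : Set F}
    (hP : 𝒪.RatSet K P) (h : K ≤ K') : 𝒪.RatSet K' P :=
  fun a ha b hb d hd => (hP a ha b hb d hd).mono h

theorem RatSet.insert_of_closest {P : Set F} (hP : 𝒪.RatSet K P) {p q : F} (hpP : p ∉ P)
    (hq : q ∈ P) (hclose : ∀ a ∈ P, (p - q) / (p - a) ∈ 𝒪)
    (hw : ∀ a ∈ P, a ≠ q → 𝒪.ResIn K ((p - q) / (a - q))) : 𝒪.RatSet K (insert p P) := by
  have hne : ∀ a ∈ P, p - a ≠ 0 := fun a ha h => hpP (by rwa [sub_eq_zero.1 h])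
  have hpq := hne q hq
  have hw' : ∀ a ∈ P, 𝒪.ResIn K ((p - q) / (a - q)) := fun a ha => by
    by_cases h : a = q
    · rw [h, sub_self, div_zero]; exact resIn_zero
    · exact hw a ha h
  -- each difference `p - a` is a unit multiple of `a - q` or of `p - q`
  have key : ∀ a ∈ P, (a ≠ q ∧ ∃ u, 𝒪.UnitIn K u ∧ p - a = (a - q) * u) ∨
      (((a - q) / (p - q) ∈ 𝒪 ∧ 𝒪.rs ((a - q) / (p - q)) = 0) ∧
        ∃ u, 𝒪.UnitIn K u ∧ p - a = (p - q) * u) := by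
    intro a ha
    by_cases haq : a = q
    · right
      subst haq
      refine ⟨by simp [ZeroMemClass.zero_mem], 1, ?_, by simp⟩
      exact ⟨by simp, by rw [rs_one]; exact OneMemClass.one_mem _⟩
    have haq' : a - q ≠ 0 := sub_ne_zero.2 haq
    set w := (p - q) / (a - q) with hwdef
    by_cases hwO : w ∈ 𝒪
    · left
      refine ⟨haq, w - 1, ?_, by rw [hwdef]; field_simp; ring⟩
      have h1 : 𝒪.rs (w - 1) = 𝒪.rs w - 1 := by rw [rs_sub hwO (OneMemClass.one_mem _), rs_one]
      refine ⟨fun h0 => ?_, ?_⟩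
      · have h2 := hclose a ha
        have h3 : w = ((p - q) / (p - a)) * (w - 1) := by
          rw [hwdef]; field_simp [hne a ha]; ring
        have h4 : 𝒪.rs w = 0 := by
          rw [h3, rs_mul h2 (_root_.sub_mem hwO (OneMemClass.one_mem _)), h0, mul_zero]
        rw [h1, h4] at h0
        simp at h0
      · rw [h1]; exact _root_.sub_mem (hw a ha haq hwO) (OneMemClass.one_mem _)
    · right
      have h1 : (a - q) / (p - q) = w⁻¹ := by rw [hwdef, inv_div]
      refine ⟨by rw [h1]; exact ⟨inv_mem_of_notMem hwO, rs_inv_of_notMem hwO⟩, 1 - w⁻¹,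
        unitIn_one_sub_inv hwO, ?_⟩
      rw [← h1]; field_simp; ring
  have hpa : ∀ a ∈ P, ∀ d ∈ P, 𝒪.ResIn K ((p - a) / (a - d)) := by
    intro a ha d hd
    by_cases had : a = d
    · rw [had, sub_self, div_zero]; exact resIn_zero
    have had' : a - d ≠ 0 := sub_ne_zero.2 had
    rcases key a ha with ⟨haq, u, hu, h⟩ | ⟨⟨h1, h2⟩, u, hu, h⟩
    · rw [h, mul_div_right_comm]
      exact (hP a ha q hq d hd).mul_unitIn hu
    · rw [h, mul_div_right_comm]
      refine ResIn.mul_unitIn ?_ hu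
      by_cases hdq : d = q
      · rw [hdq]; exact hw' a ha
      have hdq' : d - q ≠ 0 := sub_ne_zero.2 hdq
      by_cases hd1 : (p - q) / (d - q) ∈ 𝒪
      · have h3 : (p - q) / (a - d) = - ((p - q) / (d - q) *
            (1 - (p - q) / (d - q) * ((a - q) / (p - q)))⁻¹) := by
          have : 1 - (p - q) / (d - q) * ((a - q) / (p - q)) = (d - a) / (d - q) := by
            field_simp; ring
          rw [this, ← neg_sub a d]
          field_simp
        rw [h3]
        refine ((hw' d hd).mul_unitIn (unitIn_one_sub (MulMemClass.mul_mem hd1 h1) ?_).inv).neg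
        rw [rs_mul hd1 h1, h2, mul_zero]
      · have h3 : (p - q) / (a - d) = ((a - q) / (p - q) - ((p - q) / (d - q))⁻¹)⁻¹ := by
          have : (a - q) / (p - q) - ((p - q) / (d - q))⁻¹ = (a - d) / (p - q) := by
            field_simp; ring
          rw [this, inv_div]
        rw [h3]
        apply ResIn.inv
        intro _
        rw [rs_sub h1 (inv_mem_of_notMem hd1), h2, rs_inv_of_notMem hd1, sub_zero]
        exact ZeroMemClass.zero_mem _
  have hpp : ∀ b ∈ P, ∀ d ∈ P, 𝒪.ResIn K ((p - b) / (p - d)) := by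
    intro b hb d hd
    rcases key b hb with ⟨hbq, u, hu, h⟩ | ⟨_, u, hu, h⟩ <;>
    rcases key d hd with ⟨hdq, u', hu', h'⟩ | ⟨_, u', hu', h'⟩ <;>
    rw [h, h', mul_div_mul_comm] <;> refine ResIn.mul_unitIn ?_ (hu.div hu')
    · have := hP q hq b hb d hd
      rwa [← neg_sub b q, ← neg_sub d q, neg_div_neg_eq] at this
    · exact (hw' b hb).div_comm
    · exact hw' d hd
    · rw [div_self hpq]; exact resIn_one
  intro a ha b hb d hd
  rcases ha with rfl | ha <;> rcases hb with rfl | hb <;> rcases hd with rfl | hd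
  · simp only [sub_self, div_zero]; exact resIn_zero
  · simp only [sub_self, zero_div]; exact resIn_zero
  · simp only [sub_self, div_zero]; exact resIn_zero
  · exact hpp b hb d hd
  · rw [div_self]
    · exact resIn_one
    · exact fun h => hne a ha (by rw [← neg_sub, h, neg_zero])
  · have := (hpa a ha d hd).neg
    rwa [← neg_div, neg_sub] at this
  · have := (hpa a ha b hb).neg.inv
    rwa [← neg_div, neg_sub, inv_div] at this
  · exact hP a ha b hb d hd

theorem exists_closest {P : Set F} (hP : P.Finite) (hne : P.Nonempty) (p : F) :
    ∃ q ∈ P, ∀ a ∈ P, (p - q) / (p - a) ∈ 𝒪 := by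
  obtain ⟨q, hq, hmin⟩ := Set.exists_min_image P (fun a => 𝒪.valuation (p - a)) hP hne
  refine ⟨q, hq, fun a ha => ?_⟩
  rw [← 𝒪.valuation_le_one_iff, map_div₀]
  exact div_le_one_of_le₀ (hmin a ha) (zero_le)

theorem RatSet.exists_insert {P : Set F} (hP : 𝒪.RatSet K P) (hfin : P.Finite) (hne : P.Nonempty)
    (p : F) : ∃ r, ∀ K' : Subfield (IsLocalRing.ResidueField 𝒪), K ≤ K' → r ∈ K' →
      𝒪.RatSet K' (insert p P) := by
  by_cases hp : p ∈ P
  · exact ⟨0, fun K' hK _ => by rw [Set.insert_eq_of_mem hp]; exact hP.mono hK⟩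
  obtain ⟨q, hq, hclose⟩ := exists_closest (𝒪 := 𝒪) hfin hne p
  by_cases h : ∀ a ∈ P, a ≠ q → 𝒪.ResIn K ((p - q) / (a - q))
  · exact ⟨0, fun K' hK _ => (hP.insert_of_closest hp hq hclose h).mono hK⟩
  push Not at h
  obtain ⟨a, ha, haq, hw⟩ := h
  simp only [ResIn, not_forall] at hw
  obtain ⟨hw, hwK⟩ := hw
  have h0 : 𝒪.rs ((p - q) / (a - q)) ≠ 0 := fun h => hwK (by rw [h]; exact ZeroMemClass.zero_mem _)
  refine ⟨𝒪.rs ((p - q) / (a - q)), fun K' hK hr => (hP.mono hK).insert_of_closest hp hq hclose ?_⟩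
  intro a' ha' ha'q
  have h1 : (p - q) / (a' - q) = (q - a) / (q - a') * ((p - q) / (a - q)) := by
    have := sub_ne_zero.2 haq
    have := sub_ne_zero.2 ha'q
    rw [← neg_sub a q, ← neg_sub a' q, neg_div_neg_eq]
    field_simp
  rw [h1]
  exact ((hP q hq a ha a' ha').mono hK).mul_unitIn ⟨h0, hr⟩

theorem RatSet.exists_union {P : Set F} (hP : 𝒪.RatSet K P) (hfin : P.Finite) (hne : P.Nonempty)
    (T : Finset F) : ∃ R : Finset (IsLocalRing.ResidueField 𝒪), R.card ≤ T.card ∧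
      ∀ K' : Subfield (IsLocalRing.ResidueField 𝒪), K ≤ K' → (↑R : Set (IsLocalRing.ResidueField 𝒪)) ⊆ (K' : Set (IsLocalRing.ResidueField 𝒪)) →
      𝒪.RatSet K' (P ∪ T) := by
  classical
  induction T using Finset.induction_on with
  | empty => exact ⟨∅, by simp, fun K' hK _ => by simpa using hP.mono hK⟩
  | insert p T hpT ih =>
    obtain ⟨R, hR, h⟩ := ih
    have h1 := h (Subfield.closure ((K : Set _) ∪ R)) (fun x hx => Subfield.subset_closure (Or.inl hx))
      (fun x hx => Subfield.subset_closure (Or.inr hx))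
    obtain ⟨r, hr⟩ := h1.exists_insert (hfin.union T.finite_toSet) (hne.mono Set.subset_union_left) p
    refine ⟨insert r R, ?_, fun K' hK hRK => ?_⟩
    · rw [Finset.card_insert_of_notMem hpT]
      exact (Finset.card_insert_le _ _).trans (by omega)
    · rw [Finset.coe_insert, Set.union_insert]
      rw [Finset.coe_insert, Set.insert_subset_iff] at hRK
      refine hr K' ?_ hRK.1
      rw [Subfield.closure_le]
      exact Set.union_subset hK hRK.2

theorem RatSet.cross_ratio {P : Set F} (hP : 𝒪.RatSet K P) {a b c d : F} (ha : a ∈ P) (hb : b ∈ P)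
    (hc : c ∈ P) (hd : d ∈ P) (hab : a ≠ b) (hcd : c ≠ d) :
    𝒪.ResIn K ((a - c) * (b - d) / ((a - b) * (c - d))) := by
  have hab' := sub_ne_zero.2 hab
  have hcd' := sub_ne_zero.2 hcd
  have hba' := sub_ne_zero.2 hab.symm
  have hdc' := sub_ne_zero.2 hcd.symm
  have e1 : (a - c) * (b - d) / ((a - b) * (c - d)) = (a - c) / (a - b) * ((d - b) / (d - c)) := by
    rw [← neg_sub d c, ← neg_sub d b]; field_simp
  have e2 : (a - c) * (b - d) / ((a - b) * (c - d)) = (c - a) / (c - d) * ((b - d) / (b - a)) := by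
    rw [← neg_sub b a, ← neg_sub c a]; field_simp
  have r1 := hP a ha c hc b hb
  have r2 := hP d hd b hb c hc
  have r3 := hP c hc a ha d hd
  have r4 := hP b hb d hd a ha
  intro hχ
  set χ := (a - c) * (b - d) / ((a - b) * (c - d)) with hχdef
  by_cases h0 : 𝒪.rs χ = 0
  · rw [h0]; exact ZeroMemClass.zero_mem _
  have hχ0 := ne_zero_of_rs_ne_zero h0
  by_cases m1 : (a - c) / (a - b) ∈ 𝒪
  · by_cases m2 : (d - b) / (d - c) ∈ 𝒪
    · rw [e1, rs_mul m1 m2]; exact MulMemClass.mul_mem (r1 m1) (r2 m2)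
    · have hb' : d - b ≠ 0 := fun h => m2 (by rw [h, zero_div]; exact ZeroMemClass.zero_mem _)
      have h3 : (a - c) / (a - b) = χ * ((d - b) / (d - c))⁻¹ := by
        rw [e1, mul_assoc, mul_inv_cancel₀ (ne_zero_of_notMem m2), mul_one]
      have h4 : 𝒪.rs ((a - c) / (a - b)) = 0 := by
        rw [h3, rs_mul hχ (inv_mem_of_notMem m2), rs_inv_of_notMem m2, mul_zero]
      have hu : 𝒪.UnitIn K ((b - d) / (b - a)) := by
        have hu1 := unitIn_one_sub (K := K) m1 h4
        have hu2 := unitIn_one_sub_inv (K := K) m2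
        have hcb : c - b ≠ 0 := by
          intro h
          apply hu1.ne_zero
          rw [sub_eq_zero.1 h, div_self hab', sub_self]
        have : (b - d) / (b - a) = (1 - (a - c) / (a - b)) / (1 - ((d - b) / (d - c))⁻¹) := by
          rw [inv_div, one_sub_div hb', one_sub_div hab', sub_sub_sub_cancel_left,
            sub_sub_sub_cancel_left, ← neg_sub d b, ← neg_sub a b, neg_div_neg_eq]
          field_simp
        rw [this]; exact hu1.div hu2
      have h5 : (c - a) / (c - d) = χ * ((b - d) / (b - a))⁻¹ := by
        rw [e2, mul_assoc, mul_inv_cancel₀ hu.ne_zero, mul_one]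
      have m3 : (c - a) / (c - d) ∈ 𝒪 := by rw [h5]; exact MulMemClass.mul_mem hχ hu.inv.mem
      rw [e2, rs_mul m3 hu.mem]; exact MulMemClass.mul_mem (r3 m3) hu.2
  · have hc' : a - c ≠ 0 := fun h => m1 (by rw [h, zero_div]; exact ZeroMemClass.zero_mem _)
    have h3 : (d - b) / (d - c) = χ * ((a - c) / (a - b))⁻¹ := by
      rw [e1, mul_comm _ ((d - b) / (d - c)), mul_assoc, mul_inv_cancel₀ (ne_zero_of_notMem m1), mul_one]
    have m2 : (d - b) / (d - c) ∈ 𝒪 := by rw [h3]; exact MulMemClass.mul_mem hχ (inv_mem_of_notMem m1)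
    have h4 : 𝒪.rs ((d - b) / (d - c)) = 0 := by
      rw [h3, rs_mul hχ (inv_mem_of_notMem m1), rs_inv_of_notMem m1, mul_zero]
    have hu : 𝒪.UnitIn K ((c - a) / (c - d)) := by
      have hu1 := unitIn_one_sub (K := K) m2 h4
      have hu2 := unitIn_one_sub_inv (K := K) m1
      have hcb : b - c ≠ 0 := by
        intro h
        apply hu1.ne_zero
        rw [sub_eq_zero.1 h, div_self hdc', sub_self]
      have : (c - a) / (c - d) = (1 - (d - b) / (d - c)) / (1 - ((a - c) / (a - b))⁻¹) := by
        rw [inv_div, one_sub_div hc', one_sub_div hdc', sub_sub_sub_cancel_left,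
          sub_sub_sub_cancel_left, ← neg_sub a c, ← neg_sub d c, neg_div_neg_eq]
        field_simp
      rw [this]; exact hu1.div hu2
    have h5 : (b - d) / (b - a) = χ * ((c - a) / (c - d))⁻¹ := by
      rw [e2, mul_comm ((c - a) / (c - d)), mul_assoc, mul_inv_cancel₀ hu.ne_zero, mul_one]
    have m3 : (b - d) / (b - a) ∈ 𝒪 := by rw [h5]; exact MulMemClass.mul_mem hχ hu.inv.mem
    rw [e2, rs_mul hu.mem m3]; exact MulMemClass.mul_mem hu.2 (r4 m3)

end ValuationSubring

namespace ValuationSubring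

variable {F : Type*} [Field F] {𝒪 : ValuationSubring F}
  {K : Subfield (IsLocalRing.ResidueField 𝒪)}

theorem ResIn.sub {c w : F} (h : 𝒪.ResIn K w) (hc : c ∈ 𝒪) (hcK : 𝒪.rs c ∈ K) :
    𝒪.ResIn K (w - c) := by
  rw [sub_eq_add_neg]
  exact h.add (NegMemClass.neg_mem hc) (by rw [rs_neg hc]; exact NegMemClass.neg_mem hcK)

theorem ResIn.div_unitIn {w u : F} (h : 𝒪.ResIn K w) (hu : 𝒪.UnitIn K u) : 𝒪.ResIn K (w / u) := by
  rw [div_eq_mul_inv]; exact h.mul_unitIn hu.inv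

theorem unitIn_sub {a b : F} (ha : a ∈ 𝒪) (hb : b ∈ 𝒪) (haK : 𝒪.rs a ∈ K) (hbK : 𝒪.rs b ∈ K)
    (h : 𝒪.rs a ≠ 𝒪.rs b) : 𝒪.UnitIn K (a - b) := by
  refine ⟨?_, ?_⟩ <;> rw [rs_sub ha hb]
  · exact sub_ne_zero.2 h
  · exact sub_mem haK hbK

theorem ratSet_of_injOn {P : Set F} (hP : ∀ a ∈ P, a ∈ 𝒪 ∧ 𝒪.rs a ∈ K)
    (hinj : Set.InjOn 𝒪.rs P) : 𝒪.RatSet K P := by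
  intro a ha b hb d hd
  by_cases had : a = d
  · rw [had, sub_self, div_zero]; exact resIn_zero
  · refine ResIn.div_unitIn ((ResIn.of_rs_mem (hP a ha).2).sub (hP b hb).1 (hP b hb).2)
      (unitIn_sub (hP a ha).1 (hP d hd).1 (hP a ha).2 (hP d hd).2 fun h => had (hinj ha hd h))

/-- `K` contains all roots of nonzero quadratic polynomials over `K`. -/
def QuadClosed {L : Type*} [Field L] (K : Subfield L) : Prop :=
  ∀ A B C x : L, A ∈ K → B ∈ K → C ∈ K → (A ≠ 0 ∨ B ≠ 0 ∨ C ≠ 0) →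
    A * x ^ 2 + B * x + C = 0 → x ∈ K

section FivePoints

variable {c x y : F} (hK : QuadClosed K) (hc : c ∈ 𝒪) (hcK : 𝒪.rs c ∈ K) (hc0 : 𝒪.rs c ≠ 0)
  (hc1 : 𝒪.rs c ≠ 1) (hxy : x ≠ y)
  (hσ : 𝒪.ResIn K (y / (y - x))) (hτ : 𝒪.ResIn K ((x - c) * (y - 1) / (y - x)))
  (hστ : y / (y - x) ∉ 𝒪 → (x - c) * (y - 1) / (y - x) ∉ 𝒪 →
    𝒪.ResIn K (y / (y - x) / ((x - c) * (y - 1) / (y - x))))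

include hK hc hcK hc0 hxy hσ hτ hστ in
theorem resIn_first_of_pencil : 𝒪.ResIn K x := by
  intro hx
  by_contra hξ
  have hyx : y - x ≠ 0 := sub_ne_zero.2 hxy.symm
  have hxc : x - c ∈ 𝒪 := sub_mem hx hc
  by_cases hy : y ∈ 𝒪
  · have hy1 : y - 1 ∈ 𝒪 := sub_mem hy (OneMemClass.one_mem _)
    by_cases h : 𝒪.rs y = 𝒪.rs x
    · have hd : y - x ∈ 𝒪 := sub_mem hy hx
      have hd0 : 𝒪.rs (y - x) = 0 := by rw [rs_sub hy hx, h, sub_self]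
      have hξ0 : 𝒪.rs x ≠ 0 := fun h0 => hξ (by rw [h0]; exact ZeroMemClass.zero_mem _)
      have e1 : 𝒪.rs (x - c) = 𝒪.rs x - 𝒪.rs c := rs_sub hx hc
      have e2 : 𝒪.rs (y - 1) = 𝒪.rs x - 1 := by rw [rs_sub hy (OneMemClass.one_mem _), h, rs_one]
      have n1 : 𝒪.rs x - 𝒪.rs c ≠ 0 := fun h0 => hξ (by rw [sub_eq_zero.1 h0]; exact hcK)
      have n2 : 𝒪.rs x - 1 ≠ 0 := fun h0 => hξ (by rw [sub_eq_zero.1 h0]; exact OneMemClass.one_mem _)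
      have e3 : 𝒪.rs ((x - c) * (y - 1)) = (𝒪.rs x - 𝒪.rs c) * (𝒪.rs x - 1) := by
        rw [rs_mul hxc hy1, e1, e2]
      have n3 : 𝒪.rs ((x - c) * (y - 1)) ≠ 0 := by rw [e3]; exact mul_ne_zero n1 n2
      have h1 := hστ (div_notMem (by rw [h]; exact hξ0) hd0 hd hyx) (div_notMem n3 hd0 hd hyx)
      rw [div_div_div_cancel_right₀ hyx] at h1
      have h2 := h1.rs_mem
      rw [rs_div hy n3, e3, h] at h2
      set ξ := 𝒪.rs x
      set ρ := ξ / ((ξ - 𝒪.rs c) * (ξ - 1)) with hρ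
      refine hξ (hK ρ (-(ρ * (1 + 𝒪.rs c) + 1)) (ρ * 𝒪.rs c) ξ h2 ?_ (MulMemClass.mul_mem h2 hcK) ?_ ?_)
      · exact NegMemClass.neg_mem (AddMemClass.add_mem (MulMemClass.mul_mem h2
          (AddMemClass.add_mem (OneMemClass.one_mem _) hcK)) (OneMemClass.one_mem _))
      · by_cases h0 : ρ = 0
        · right; left; rw [h0]; simp
        · exact Or.inl h0
      · rw [hρ]; field_simp; ring
    · have n : 𝒪.rs (y - x) ≠ 0 := by rw [rs_sub hy hx]; exact sub_ne_zero.2 h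
      have h1 := hσ.rs_mem
      rw [rs_div hy n, rs_sub hy hx] at h1
      have h2 := hτ.rs_mem
      rw [rs_div (MulMemClass.mul_mem hxc hy1) n, rs_sub hy hx, rs_mul hxc hy1, rs_sub hx hc,
        rs_sub hy (OneMemClass.one_mem _), rs_one] at h2
      have n' := sub_ne_zero.2 h
      have hξ0 : 𝒪.rs x ≠ 0 := fun h0 => hξ (by rw [h0]; exact ZeroMemClass.zero_mem _)
      set ξ := 𝒪.rs x
      set η := 𝒪.rs y
      set ρ := η / (η - ξ) with hρ
      set t := (ξ - 𝒪.rs c) * (η - 1) / (η - ξ) with ht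
      have hρ1 : ρ - 1 = ξ / (η - ξ) := by rw [hρ]; field_simp; ring
      have hr : ρ / (ρ - 1) = η / ξ := by rw [hρ1, hρ]; field_simp
      have hrK : η / ξ ∈ K := by rw [← hr]; exact div_mem h1 (sub_mem h1 (OneMemClass.one_mem _))
      set r := η / ξ
      have hη : η = r * ξ := by simp only [r]; field_simp
      have ht' : t * (r * ξ - ξ) = (ξ - 𝒪.rs c) * (r * ξ - 1) := by
        rw [← hη, ht]; field_simp
      refine hξ (hK r (-(1 + 𝒪.rs c * r + t * (r - 1))) (𝒪.rs c) ξ hrK ?_ hcK (Or.inr (Or.inr hc0)) ?_)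
      · exact NegMemClass.neg_mem (AddMemClass.add_mem (AddMemClass.add_mem (OneMemClass.one_mem _)
          (MulMemClass.mul_mem hcK hrK)) (MulMemClass.mul_mem h2 (sub_mem hrK (OneMemClass.one_mem _))))
      · linear_combination -ht'
  · have hy0 := ne_zero_of_notMem hy
    have i := inv_mem_of_notMem hy
    have i0 := rs_inv_of_notMem hy
    have m1 : x * y⁻¹ ∈ 𝒪 := MulMemClass.mul_mem hx i
    have n : 𝒪.rs (1 - x * y⁻¹) = 1 := by
      rw [rs_sub (OneMemClass.one_mem _) m1, rs_mul hx i, i0, rs_one]; simp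
    have m2 : 1 - y⁻¹ ∈ 𝒪 := sub_mem (OneMemClass.one_mem _) i
    have e : (x - c) * (y - 1) / (y - x) = (x - c) * (1 - y⁻¹) / (1 - x * y⁻¹) := by
      field_simp
    have h2 := hτ.rs_mem
    rw [e, rs_div (MulMemClass.mul_mem hxc m2) (by rw [n]; exact one_ne_zero), n, rs_mul hxc m2,
      rs_sub (OneMemClass.one_mem _) i, i0, rs_sub hx hc, rs_one] at h2
    apply hξ
    have := AddMemClass.add_mem h2 hcK
    simpa using this

include hK hc hcK hc0 hxy hσ hτ hστ in
theorem resIn_second_of_pencil : 𝒪.ResIn K y := by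
  have hxR := resIn_first_of_pencil hK hc hcK hc0 hxy hσ hτ hστ
  intro hy
  by_contra hη
  have hy1 : y - 1 ∈ 𝒪 := sub_mem hy (OneMemClass.one_mem _)
  by_cases hx : x ∈ 𝒪
  · have hxc : x - c ∈ 𝒪 := sub_mem hx hc
    have hξ := hxR hx
    have h : 𝒪.rs y - 𝒪.rs x ≠ 0 := fun h0 => hη (by rw [sub_eq_zero.1 h0]; exact hξ)
    have n : 𝒪.rs (y - x) ≠ 0 := by rwa [rs_sub hy hx]
    have h1 := hσ.rs_mem
    rw [rs_div hy n, rs_sub hy hx] at h1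
    have h2 := hτ.rs_mem
    rw [rs_div (MulMemClass.mul_mem hxc hy1) n, rs_sub hy hx, rs_mul hxc hy1, rs_sub hx hc,
      rs_sub hy (OneMemClass.one_mem _), rs_one] at h2
    have hη0 : 𝒪.rs y ≠ 0 := fun h0 => hη (by rw [h0]; exact ZeroMemClass.zero_mem _)
    set ξ := 𝒪.rs x
    set η := 𝒪.rs y
    set ρ := η / (η - ξ) with hρ
    set t := (ξ - 𝒪.rs c) * (η - 1) / (η - ξ) with ht
    by_cases hρ1 : ρ - 1 = 0
    · have hξ0 : ξ = 0 := by
        have : ρ - 1 = ξ / (η - ξ) := by rw [hρ]; field_simp; ring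
        rw [this, div_eq_zero_iff] at hρ1
        exact hρ1.resolve_right h
      have ht' : t * η = - 𝒪.rs c * (η - 1) := by rw [ht, hξ0]; field_simp; ring
      refine hη (hK 0 (t + 𝒪.rs c) (-𝒪.rs c) η (ZeroMemClass.zero_mem _) (AddMemClass.add_mem h2 hcK)
        (NegMemClass.neg_mem hcK) (Or.inr (Or.inr (neg_ne_zero.2 hc0))) ?_)
      linear_combination ht'
    · refine hη (hK 0 (ρ - 1) (-(ρ * ξ)) η (ZeroMemClass.zero_mem _) (sub_mem h1 (OneMemClass.one_mem _))
        (NegMemClass.neg_mem (MulMemClass.mul_mem h1 hξ)) (Or.inr (Or.inl hρ1)) ?_)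
      rw [hρ]; field_simp; ring
  · have hx0 := ne_zero_of_notMem hx
    have i := inv_mem_of_notMem hx
    have i0 := rs_inv_of_notMem hx
    have m1 : y * x⁻¹ ∈ 𝒪 := MulMemClass.mul_mem hy i
    have m3 : c * x⁻¹ ∈ 𝒪 := MulMemClass.mul_mem hc i
    have n : 𝒪.rs (y * x⁻¹ - 1) = -1 := by
      rw [rs_sub m1 (OneMemClass.one_mem _), rs_mul hy i, i0, rs_one]; simp
    have m2 : 1 - c * x⁻¹ ∈ 𝒪 := sub_mem (OneMemClass.one_mem _) m3
    have e : (x - c) * (y - 1) / (y - x) = (1 - c * x⁻¹) * (y - 1) / (y * x⁻¹ - 1) := by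
      field_simp
    have h2 := hτ.rs_mem
    rw [e, rs_div (MulMemClass.mul_mem m2 hy1) (by rw [n]; simp), n, rs_mul m2 hy1,
      rs_sub (OneMemClass.one_mem _) m3, rs_mul hc i, i0, rs_sub hy (OneMemClass.one_mem _), rs_one] at h2
    apply hη
    have := sub_mem (OneMemClass.one_mem K) h2
    convert this using 1
    simp only [mul_zero, sub_zero, one_mul, div_neg, div_one]
    ring

include hK hc hcK hc0 hc1 hxy hσ hτ hστ in
theorem resIn_ratio_of_pencil {q : F} (hq : q ∈ ({0, 1, c} : Set F)) :
    𝒪.ResIn K ((y - q) / (y - x)) := by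
  have hxR := resIn_first_of_pencil hK hc hcK hc0 hxy hσ hτ hστ
  have hyR := resIn_second_of_pencil hK hc hcK hc0 hxy hσ hτ hστ
  have hyx : y - x ≠ 0 := sub_ne_zero.2 hxy.symm
  have hqO : q ∈ 𝒪 ∧ 𝒪.rs q ∈ K := by
    rcases hq with rfl | rfl | rfl
    · exact ⟨ZeroMemClass.zero_mem _, by rw [rs_zero]; exact ZeroMemClass.zero_mem _⟩
    · exact ⟨OneMemClass.one_mem _, by rw [rs_one]; exact OneMemClass.one_mem _⟩
    · exact ⟨hc, hcK⟩
  by_cases hx : x ∈ 𝒪 <;> by_cases hy : y ∈ 𝒪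
  · have hξ := hxR hx
    have hη := hyR hy
    by_cases h : 𝒪.rs y = 𝒪.rs x
    · have hd : y - x ∈ 𝒪 := sub_mem hy hx
      have hd0 : 𝒪.rs (y - x) = 0 := by rw [rs_sub hy hx, h, sub_self]
      by_cases hz : 𝒪.rs y = 𝒪.rs q
      · rcases hq with rfl | rfl | rfl
        · simpa using hσ
        · have hu : 𝒪.UnitIn K (x - c) := unitIn_sub hx hc hξ hcK (by
            rw [← h, hz, rs_one]; exact hc1.symm)
          have := hτ.div_unitIn hu
          rw [mul_div_assoc, mul_div_cancel_left₀ _ hu.ne_zero] at this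
          exact this
        · have hu : 𝒪.UnitIn K (x - 1) := unitIn_sub hx (OneMemClass.one_mem _) hξ
            (by rw [rs_one]; exact OneMemClass.one_mem _) (by rw [← h, hz, rs_one]; exact hc1)
          have h1 := (hτ.sub (sub_mem (OneMemClass.one_mem _) hc) (by
            rw [rs_sub (OneMemClass.one_mem _) hc, rs_one]
            exact sub_mem (OneMemClass.one_mem _) hcK)).div_unitIn hu
          have e : ((x - q) * (y - 1) / (y - x) - (1 - q)) / (x - 1) = (y - q) / (y - x) := by
            have := hu.ne_zero
            field_simp; ring
          rwa [e] at h1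
      · refine resIn_of_notMem (div_notMem ?_ hd0 hd hyx)
        rw [rs_sub hy hqO.1]; exact sub_ne_zero.2 hz
    · exact (hyR.sub hqO.1 hqO.2).div_unitIn (unitIn_sub hy hx hη hξ h)
  · have hy0 := ne_zero_of_notMem hy
    have i := inv_mem_of_notMem hy
    have i0 := rs_inv_of_notMem hy
    have e : (y - q) / (y - x) = (1 - q * y⁻¹) / (1 - x * y⁻¹) := by field_simp
    rw [e]
    exact (ResIn.of_rs_mem (unitIn_one_sub (MulMemClass.mul_mem hqO.1 i)
      (by rw [rs_mul hqO.1 i, i0, mul_zero])).2).div_unitIn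
      (unitIn_one_sub (MulMemClass.mul_mem hx i) (by rw [rs_mul hx i, i0, mul_zero]))
  · have hx0 := ne_zero_of_notMem hx
    have i := inv_mem_of_notMem hx
    have i0 := rs_inv_of_notMem hx
    have e : (y - q) / (y - x) = -((y - q) * x⁻¹ / (1 - y * x⁻¹)) := by
      rw [← neg_sub x y, div_neg]; field_simp
    rw [e]
    refine (ResIn.div_unitIn (ResIn.of_rs_mem ?_) (unitIn_one_sub (MulMemClass.mul_mem hy i)
      (by rw [rs_mul hy i, i0, mul_zero]))).neg
    rw [rs_mul (sub_mem hy hqO.1) i, i0, mul_zero]; exact ZeroMemClass.zero_mem _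
  · have hy0 := ne_zero_of_notMem hy
    have i := inv_mem_of_notMem hy
    have i0 := rs_inv_of_notMem hy
    have e : (y - q) / (y - x) = y / (y - x) * (1 - q * y⁻¹) := by field_simp
    rw [e]
    exact hσ.mul_unitIn (unitIn_one_sub (MulMemClass.mul_mem hqO.1 i)
      (by rw [rs_mul hqO.1 i, i0, mul_zero]))

include hK hc hcK hc0 hc1 hxy hσ hτ hστ in
theorem ratSet_five_points : 𝒪.RatSet K (insert y (insert x {0, 1, c})) := by
  have hxR := resIn_first_of_pencil hK hc hcK hc0 hxy hσ hτ hστ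
  have hyR := resIn_second_of_pencil hK hc hcK hc0 hxy hσ hτ hστ
  have hθ := fun q hq => resIn_ratio_of_pencil hK hc hcK hc0 hc1 hxy hσ hτ hστ (q := q) hq
  have hyx : y - x ≠ 0 := sub_ne_zero.2 hxy.symm
  have hP : ∀ q ∈ ({0, 1, c} : Set F), q ∈ 𝒪 ∧ 𝒪.rs q ∈ K := by
    rintro q (rfl | rfl | rfl)
    · exact ⟨ZeroMemClass.zero_mem _, by rw [rs_zero]; exact ZeroMemClass.zero_mem _⟩
    · exact ⟨OneMemClass.one_mem _, by rw [rs_one]; exact OneMemClass.one_mem _⟩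
    · exact ⟨hc, hcK⟩
  have hinj : Set.InjOn 𝒪.rs ({0, 1, c} : Set F) := by
    rintro a (rfl | rfl | rfl) b (rfl | rfl | rfl) h <;> simp_all
  have h3 : 𝒪.RatSet K {0, 1, c} := ratSet_of_injOn hP hinj
  have hbase : ∀ p, 𝒪.ResIn K p → ∀ q ∈ ({0, 1, c} : Set F), ∀ a ∈ ({0, 1, c} : Set F), a ≠ q →
      𝒪.ResIn K ((p - q) / (a - q)) := fun p hp q hq a ha haq =>
    (hp.sub (hP q hq).1 (hP q hq).2).div_unitIn (unitIn_sub (hP a ha).1 (hP q hq).1 (hP a ha).2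
      (hP q hq).2 fun h => haq (hinj ha hq h))
  have h4 : 𝒪.RatSet K (insert x {0, 1, c}) := by
    by_cases hx : x ∈ ({0, 1, c} : Set F)
    · rwa [Set.insert_eq_of_mem hx]
    obtain ⟨q, hq, hclose⟩ := exists_closest (𝒪 := 𝒪) (P := {0, 1, c}) (by simp) (by simp) x
    exact h3.insert_of_closest hx hq hclose (hbase x hxR q hq)
  by_cases hy : y ∈ insert x ({0, 1, c} : Set F)
  · rwa [Set.insert_eq_of_mem hy]
  obtain ⟨q, hq, hclose⟩ := exists_closest (𝒪 := 𝒪) (P := insert x {0, 1, c}) (by simp) (by simp) y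
  refine h4.insert_of_closest hy hq hclose ?_
  rintro a (rfl | ha) haq <;> rcases hq with rfl | hq
  · exact absurd rfl haq
  · have := (hθ q hq).inv.one_sub.inv
    have hyq : y - q ≠ 0 := fun h => hy (by rw [sub_eq_zero.1 h]; exact Or.inr hq)
    rwa [inv_div, one_sub_div hyq, sub_sub_sub_cancel_left, inv_div] at this
  · have := (hθ a ha).one_sub.inv
    rwa [one_sub_div hyx, sub_sub_sub_cancel_left, inv_div] at this
  · exact hbase y hyR q hq a ha haq

end FivePoints

end ValuationSubring

section Card

variable {F : Type*} [Field F] [CharZero F]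

theorem AlgebraicIndependent.card_le_of_mem_acl {ι : Type*} [Fintype ι] {f : ι → F}
    (hf : AlgebraicIndependent ℚ f) {S : Finset F} (h : ∀ i, f i ∈ acl (S : Set F)) :
    Fintype.card ι ≤ S.card := by
  set M := AlgebraicIndependent.matroid ℚ F
  have hI : M.Indep (Set.range f) := hf.to_subtype_range
  have hfc : (Set.range f).encard = Fintype.card ι := by
    rw [← Set.image_univ, hf.injective.encard_image]; simp
  have hr : Set.range f ⊆ M.closure S := by rintro _ ⟨i, rfl⟩; exact h i
  have h1 : (Fintype.card ι : ℕ∞) ≤ M.eRk (S : Set F) := by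
    rw [← hfc, ← hI.eRk_eq_encard, ← M.eRk_closure_eq (S : Set F)]
    exact M.eRk_mono hr
  have h2 := h1.trans (M.eRk_le_encard _)
  rw [Set.encard_coe_eq_coe_finsetCard] at h2
  exact_mod_cast h2

end Card

theorem quadClosed_acl {F : Type*} [Field F] [CharZero F] (S : Set F) :
    ValuationSubring.QuadClosed (acl S) := by
  intro a b c x ha hb hc h hx
  refine mem_acl_of_root (p := C a * X ^ 2 + C b * X + C c) ?_ ?_ (by simpa using hx)
  · intro h0
    have h2 := congrArg (fun p => p.coeff 2) h0
    have h1 := congrArg (fun p => p.coeff 1) h0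
    have h0 := congrArg (fun p => p.coeff 0) h0
    simp [coeff_X, coeff_C] at h0 h1 h2
    simp_all
  · intro n
    have h0 : (0 : F) ∈ acl S := zero_mem _
    simp only [coeff_add, coeff_C_mul, coeff_X_pow, coeff_X, coeff_C]
    refine add_mem (add_mem (mul_mem ha ?_) (mul_mem hb ?_)) ?_
    all_goals split_ifs <;> first | exact one_mem _ | assumption

section Gram

variable {F : Type*} [Field F]

/-- The inner product on the sphere, scaled by `1 - w²`, in Gram coordinates with respect to two
unit vectors with inner product `w`. -/
def gramForm (w : F) (p q : Fin 3 → F) : F :=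
  p 0 * q 0 + p 1 * q 1 - w * (p 0 * q 1 + p 1 * q 0) + p 2 * q 2

/-- Realizations in Gram coordinates with respect to the images of the vertices `1` and `2`, where
`μ` prescribes the cosines of the edge lengths. -/
def GramRealization (H : GeoGraph) (μ : Finset ℕ → F) : Set (ℕ → Fin 3 → F) :=
  {q | (∀ v ∉ H.V, q v = 0) ∧ q 1 = ![1, μ {1, 2}, 0] ∧ q 2 = ![μ {1, 2}, 1, 0] ∧
    (∀ v ∈ H.V, gramForm (μ {1, 2}) (q v) (q v) = 1 - μ {1, 2} ^ 2) ∧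
    ∀ u v : ℕ, ({u, v} : Finset ℕ) ∈ H.E →
      gramForm (μ {1, 2}) (q u) (q v) = (1 - μ {1, 2} ^ 2) * μ {u, v}}

/-- First isotropic coordinate of a point on the sphere. -/
def isoX (i w : F) (p : Fin 3 → F) : F := -((1 + p 0) * (1 + w)) / (p 1 - w * p 0 - i * p 2)

/-- Second isotropic coordinate of a point on the sphere. -/
def isoY (i w : F) (p : Fin 3 → F) : F := ((1 - p 0) * (1 + w)) / (p 1 - w * p 0 - i * p 2)

theorem gramForm_self_factor {i w : F} (hi : i ^ 2 = -1) {p : Fin 3 → F}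
    (hp : gramForm w p p = 1 - w ^ 2) :
    (p 1 - w * p 0 - i * p 2) * (p 1 - w * p 0 + i * p 2) = (1 - w ^ 2) * (1 - p 0 ^ 2) := by
  simp only [gramForm] at hp
  linear_combination hp - p 2 ^ 2 * hi

theorem iso_denom_ne_zero {i w : F} (hi : i ^ 2 = -1) (hw : w ^ 2 ≠ 1) {p : Fin 3 → F}
    (hp : gramForm w p p = 1 - w ^ 2) (h : p 0 ^ 2 ≠ 1) : p 1 - w * p 0 - i * p 2 ≠ 0 := by
  intro h0
  have := gramForm_self_factor hi hp
  rw [h0, zero_mul, eq_comm, mul_eq_zero, sub_eq_zero, sub_eq_zero] at this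
  rcases this with h1 | h1
  · exact hw h1.symm
  · exact h h1.symm

theorem isoY_sub_isoX {i w : F} {p : Fin 3 → F} : isoY i w p - isoX i w p =
    2 * (1 + w) / (p 1 - w * p 0 - i * p 2) := by
  simp only [isoX, isoY]; rw [← sub_div]; congr 1; ring

variable [CharZero F]

theorem isoX_ne_isoY {i w : F} (hi : i ^ 2 = -1) (hw : w ^ 2 ≠ 1) {p : Fin 3 → F}
    (hp : gramForm w p p = 1 - w ^ 2) (h : p 0 ^ 2 ≠ 1) : isoX i w p ≠ isoY i w p := by
  have h1 := iso_denom_ne_zero hi hw hp h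
  intro h2
  have h3 := isoY_sub_isoX (i := i) (w := w) (p := p)
  rw [h2, sub_self, eq_comm, div_eq_zero_iff] at h3
  have h4 : 1 + w ≠ 0 := fun h0 => hw (by linear_combination (w - 1) * h0)
  simp [h1, h4] at h3

theorem isoY_div {i w : F} (hi : i ^ 2 = -1) (hw : w ^ 2 ≠ 1) {p : Fin 3 → F}
    (hp : gramForm w p p = 1 - w ^ 2) (h : p 0 ^ 2 ≠ 1) :
    isoY i w p / (isoY i w p - isoX i w p) = (1 - p 0) / 2 := by
  have h1 := iso_denom_ne_zero hi hw hp h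
  have h4 : 1 + w ≠ 0 := fun h0 => hw (by linear_combination (w - 1) * h0)
  rw [isoY_sub_isoX, isoY]
  generalize p 1 - w * p 0 - i * p 2 = W at h1
  field_simp

theorem gramForm_eq_cross {i w : F} (hi : i ^ 2 = -1) (hw : w ^ 2 ≠ 1) {p q : Fin 3 → F}
    (hp : gramForm w p p = 1 - w ^ 2) (h : p 0 ^ 2 ≠ 1)
    (hq : gramForm w q q = 1 - w ^ 2) (h' : q 0 ^ 2 ≠ 1) :
    gramForm w p q = (1 - w ^ 2) * (1 - 2 * ((isoX i w p - isoX i w q) * (isoY i w p - isoY i w q) /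
      ((isoX i w p - isoY i w p) * (isoX i w q - isoY i w q)))) := by
  have h1 := iso_denom_ne_zero hi hw hp h
  have h2 := iso_denom_ne_zero hi hw hq h'
  have h4 : 1 + w ≠ 0 := fun h0 => hw (by linear_combination (w - 1) * h0)
  have e1 := gramForm_self_factor hi hp
  have e2 := gramForm_self_factor hi hq
  rw [← neg_sub (isoY i w p) (isoX i w p), ← neg_sub (isoY i w q) (isoX i w q), neg_mul_neg,
    isoY_sub_isoX, isoY_sub_isoX]
  simp only [isoX, isoY, gramForm]
  obtain ⟨W, hW⟩ : ∃ W, W = p 1 - w * p 0 - i * p 2 := ⟨_, rfl⟩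
  obtain ⟨V, hV⟩ : ∃ V, V = q 1 - w * q 0 - i * q 2 := ⟨_, rfl⟩
  rw [← hW] at h1 e1 ⊢
  rw [← hV] at h2 e2 ⊢
  have e3 : p 0 * q 0 + p 1 * q 1 - w * (p 0 * q 1 + p 1 * q 0) + p 2 * q 2 =
    (1 - w ^ 2) * (p 0 * q 0) + ((p 1 - w * p 0 + i * p 2) * V + (q 1 - w * q 0 + i * q 2) * W) / 2 := by
    rw [hW, hV]; linear_combination (p 2 * q 2) * hi
  rw [e3]
  generalize p 1 - w * p 0 + i * p 2 = W' at *
  generalize q 1 - w * q 0 + i * q 2 = V' at *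
  field_simp
  linear_combination V ^ 2 * e1 + W ^ 2 * e2

end Gram

section

variable {F : Type*} [Field F]

theorem AlgebraicIndependent.sq_ne_one [CharZero F] {ι : Type*} {f : ι → F} (hf : AlgebraicIndependent ℚ f)
    (i : ι) : f i ^ 2 ≠ 1 := by
  intro h
  refine (hf.transcendental i) ⟨X ^ 2 - 1, ?_, by simp [h]⟩
  exact (monic_X_pow_sub_C (1 : ℚ) two_ne_zero).ne_zero

/-- The pair `(a, b)` specializes to a point of the projective plane defined over `K`, in the
weak sense that all finite coordinates, and the direction at infinity, have residue in `K`. -/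
def Degenerate (𝒪 : ValuationSubring F) (K : Subfield (IsLocalRing.ResidueField 𝒪)) (a b : F) :
    Prop :=
  𝒪.ResIn K a ∧ 𝒪.ResIn K b ∧ (a ∉ 𝒪 → b ∉ 𝒪 → 𝒪.ResIn K (a / b))

/-- The combinatorial data of a calligraph that matter for the dimension counts. -/
structure GeoGraph.Tight (H : GeoGraph) : Prop where
  sub : ({0, 1, 2} : Finset ℕ) ⊆ H.V
  mem : ({1, 2} : Finset ℕ) ∈ H.E
  card : H.E.card = 2 * H.V.card - 4

theorem GeoGraph.exists_of_mem_edges {H : GeoGraph} {e : Finset ℕ} (he : e ∈ H.E) :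
    ∃ u v, u ≠ v ∧ e = {u, v} ∧ u ∈ H.V ∧ v ∈ H.V := by
  obtain ⟨u, v, huv, rfl⟩ := Finset.card_eq_two.1 (H.edge_two e he)
  have := H.edge_sub _ he
  exact ⟨u, v, huv, rfl, this (by simp), this (by simp)⟩

open ValuationSubring in
theorem not_degenerate_of_independent_residues [CharZero F] {H : GeoGraph} (hH : H.Tight)
    (𝒪 : ValuationSubring F)
    [CharZero (IsLocalRing.ResidueField 𝒪)] {i : F} (hi : i ^ 2 = -1) {μ : Finset ℕ → F}
    (hμ : ∀ e ∈ H.E, μ e ∈ 𝒪) (hind : AlgebraicIndependent ℚ (fun e : H.E => 𝒪.rs (μ e)))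
    {q : ℕ → Fin 3 → F} (hq : q ∈ GramRealization H μ)
    (ha : ∀ v ∈ H.V, v ≠ 1 → q v 0 ^ 2 ≠ 1) :
    ¬ Degenerate 𝒪 (acl {𝒪.rs (μ {1, 2})}) (q 0 0) (q 0 1) := by
  classical
  rintro ⟨b1, b2, b3⟩
  obtain ⟨-, hq1, hq2, hqV, hqE⟩ := hq
  have hH1 := hH.mem
  have hV0 : 0 ∈ H.V := hH.sub (by simp)
  have hV2 : 2 ∈ H.V := hH.sub (by simp)
  set w := μ {1, 2} with hw
  set K := acl {𝒪.rs w}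
  have hwO : w ∈ 𝒪 := hμ _ hH.mem
  have hwK : 𝒪.rs w ∈ K := subset_acl _ rfl
  have hw1 : 𝒪.rs w ^ 2 ≠ 1 := hind.sq_ne_one ⟨_, hH.mem⟩
  have hw1' : w ^ 2 ≠ 1 := by
    intro h
    apply hw1
    rw [sq, ← rs_mul hwO hwO, ← sq, h, rs_one]
  have hp1 : 1 + 𝒪.rs w ≠ 0 := fun h0 => hw1 (by linear_combination (𝒪.rs w - 1) * h0)
  have hm1 : 1 - 𝒪.rs w ≠ 0 := fun h0 => hw1 (by linear_combination (-𝒪.rs w - 1) * h0)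
  have o1 : (1 : F) ∈ 𝒪 := OneMemClass.one_mem _
  have oK : (1 : IsLocalRing.ResidueField 𝒪) ∈ K := OneMemClass.one_mem _
  have ep : 𝒪.rs (1 + w) = 1 + 𝒪.rs w := by rw [rs_add o1 hwO, rs_one]
  have em : 𝒪.rs (1 - w) = 1 - 𝒪.rs w := by rw [rs_sub o1 hwO, rs_one]
  have up : 𝒪.UnitIn K (1 + w) := by
    refine ⟨?_, ?_⟩ <;> rw [ep]
    · exact hp1
    · exact add_mem oK hwK
  have um : 𝒪.UnitIn K (1 - w) := by
    refine ⟨?_, ?_⟩ <;> rw [em]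
    · exact hm1
    · exact sub_mem oK hwK
  have u2 : 𝒪.UnitIn K 2 := by
    refine ⟨?_, ?_⟩ <;> rw [rs_two]
    · exact two_ne_zero
    · exact ofNat_mem K 2
  have uneg : ∀ u, 𝒪.UnitIn K u → 𝒪.UnitIn K (-u) := by
    intro u hu
    refine ⟨?_, ?_⟩ <;> rw [rs_neg hu.mem]
    · exact neg_ne_zero.2 hu.1
    · exact neg_mem hu.2
  set c : F := -((1 + w) / (1 - w)) with hc
  have uc : 𝒪.UnitIn K c := uneg _ (up.div um)
  have ec : c - 1 = -(2 / (1 - w)) := by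
    have := um.ne_zero
    rw [hc]; field_simp; ring
  have uc1 : 𝒪.UnitIn K (c - 1) := by rw [ec]; exact uneg _ (u2.div um)
  have hc1 : 𝒪.rs c ≠ 1 := by
    intro h
    apply uc1.1
    rw [rs_sub uc.mem o1, h, rs_one, sub_self]
  have hX2 : isoX i w (q 2) = c := by
    have h1 : (1 - w ^ 2) ≠ 0 := fun h => hw1' (by linear_combination -h)
    have := um.ne_zero
    simp only [isoX, hq2, hc, Matrix.cons_val_zero, Matrix.cons_val_one, Matrix.cons_val]
    rw [show (1 - w * w - i * 0) = (1 - w) * (1 + w) by ring]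
    have := up.ne_zero
    field_simp
  have hY2 : isoY i w (q 2) = 1 := by
    have h1 : (1 - w * w) ≠ 0 := fun h => hw1' (by linear_combination -h)
    simp only [isoY, hq2, Matrix.cons_val_zero, Matrix.cons_val_one, Matrix.cons_val]
    rw [show (1 - w * w - i * 0) = 1 - w * w by ring, div_eq_one_iff_eq h1]
    ring
  have hself := fun v (hv : v ∈ H.V) => hqV v hv
  set x := isoX i w (q 0) with hx
  set y := isoY i w (q 0) with hy
  have hxy : x ≠ y := isoX_ne_isoY hi hw1' (hself 0 hV0) (ha 0 hV0 (by decide))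
  have hyx : y - x ≠ 0 := sub_ne_zero.2 hxy.symm
  have hxy' : x - y ≠ 0 := sub_ne_zero.2 hxy
  have hσ : y / (y - x) = (1 - q 0 0) / 2 := isoY_div hi hw1' (hself 0 hV0) (ha 0 hV0 (by decide))
  have hτ : (x - c) * (y - 1) / (y - x) = (q 0 1 - 1) * (c - 1) / 2 := by
    have h := gramForm_eq_cross hi hw1' (hself 0 hV0) (ha 0 hV0 (by decide)) (hself 2 hV2)
      (ha 2 hV2 (by decide))
    have h1 : gramForm w (q 0) (q 2) = (1 - w ^ 2) * q 0 1 := by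
      simp only [gramForm, hq2, Matrix.cons_val_zero, Matrix.cons_val_one, Matrix.cons_val]; ring
    have h2 : (1 - w ^ 2) ≠ 0 := fun h => hw1' (by linear_combination -h)
    rw [h1, hX2, hY2] at h
    have h3 := mul_left_cancel₀ h2 h
    have h4 := uc1.ne_zero
    rw [h3, ← hx, ← hy]
    field_simp
    ring
  have hP := ratSet_five_points (K := K) (c := c) (x := x) (y := y) (quadClosed_acl _) uc.mem uc.2 uc.1
    hc1 hxy (by rw [hσ]; exact b1.one_sub.div_unitIn u2)
    (by rw [hτ]; exact ((b2.sub o1 (by rwa [rs_one])).mul_unitIn uc1).div_unitIn u2) (by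
      rw [hσ, hτ]
      intro h1 h2
      have h1' : q 0 0 ∉ 𝒪 := fun h => h1 (div_mem_of_rs (sub_mem o1 h) u2.1)
      have h2' : q 0 1 ∉ 𝒪 := fun h => h2 (div_mem_of_rs (MulMemClass.mul_mem (sub_mem h o1) uc1.mem) u2.1)
      have n1 := ne_zero_of_notMem h1'
      have n2 := ne_zero_of_notMem h2'
      have n3 := (unitIn_one_sub_inv (K := K) h2').ne_zero
      have n4 := uc1.ne_zero
      have e : (1 - q 0 0) / 2 / ((q 0 1 - 1) * (c - 1) / 2) =
          -(q 0 0 / q 0 1 * ((1 - (q 0 0)⁻¹) / (1 - (q 0 1)⁻¹)) / (c - 1)) := by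
        have : q 0 1 - 1 ≠ 0 := by
          intro h; apply n3; rw [sub_eq_zero.1 h]; simp
        field_simp
        ring
      rw [e]
      exact (((b3 h1' h2').mul_unitIn ((unitIn_one_sub_inv h1').div
        (unitIn_one_sub_inv h2'))).div_unitIn uc1).neg)
  set V' := H.V \ {0, 1, 2} with hV'
  have hV'c : V'.card = H.V.card - 3 := by
    rw [hV', Finset.card_sdiff_of_subset hH.sub]; rfl
  have hVc : 3 ≤ H.V.card := by simpa using Finset.card_le_card hH.sub
  obtain ⟨R, hRc, hR⟩ := hP.exists_union (by simp) (by simp)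
    (V'.image (fun v => isoX i w (q v)) ∪ V'.image (fun v => isoY i w (q v)))
  have hTc := Finset.card_union_le (V'.image (fun v => isoX i w (q v))) (V'.image (fun v => isoY i w (q v)))
  have hTx := Finset.card_image_le (s := V') (f := fun v => isoX i w (q v))
  have hTy := Finset.card_image_le (s := V') (f := fun v => isoY i w (q v))
  set K' := acl (↑(insert (𝒪.rs w) R) : Set (IsLocalRing.ResidueField 𝒪)) with hK'
  have hKK' : K ≤ K' := acl_mono (by simp)
  have hPT := hR K' hKK' ((Finset.coe_subset.2 (Finset.subset_insert _ _)).trans (subset_acl _))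
  set P := insert y (insert x ({0, 1, c} : Set F)) ∪
    ↑(V'.image (fun v => isoX i w (q v)) ∪ V'.image (fun v => isoY i w (q v))) with hPdef
  have hXP : ∀ v ∈ H.V, v ≠ 1 → isoX i w (q v) ∈ P ∧ isoY i w (q v) ∈ P := by
    intro v hv hv1
    by_cases h0 : v = 0
    · subst h0; exact ⟨by simp [hPdef, hx], by simp [hPdef, hy]⟩
    by_cases h2 : v = 2
    · subst h2; rw [hX2, hY2]; exact ⟨by simp [hPdef], by simp [hPdef]⟩
    have : v ∈ V' := by simp [hV', hv, h0, h2, hv1]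
    refine ⟨Or.inr ?_, Or.inr ?_⟩
    · exact Finset.mem_coe.2 (Finset.mem_union_left _ (Finset.mem_image_of_mem _ this))
    · exact Finset.mem_coe.2 (Finset.mem_union_right _ (Finset.mem_image_of_mem _ this))
  have h0P : (0 : F) ∈ P := by simp [hPdef]
  have h2' : (1 - w ^ 2) ≠ 0 := fun h => hw1' (by linear_combination -h)
  have u2' : 𝒪.UnitIn K' 2 := ⟨u2.1, hKK' u2.2⟩
  have oK' : 𝒪.rs 1 ∈ K' := by rw [rs_one]; exact OneMemClass.one_mem _
  -- edges at the vertex `1`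
  have hedge1 : ∀ v, v ≠ 1 → v ∈ H.V → ({1, v} : Finset ℕ) ∈ H.E → 𝒪.ResIn K' (μ {1, v}) := by
    intro v hv1 hv he
    have h := hqE 1 v he
    have h1 : gramForm w (q 1) (q v) = (1 - w ^ 2) * q v 0 := by
      simp only [gramForm, hq1, Matrix.cons_val_zero, Matrix.cons_val_one, Matrix.cons_val]; ring
    rw [h1] at h
    rw [← mul_left_cancel₀ h2' h]
    have hr := hPT _ (hXP v hv hv1).2 0 h0P _ (hXP v hv hv1).1
    rw [sub_zero, isoY_div hi hw1' (hself v hv) (ha v hv hv1)] at hr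
    have := (hr.mul_unitIn u2').one_sub
    rwa [div_mul_cancel₀ _ two_ne_zero, sub_sub_cancel] at this
  have hedge : ∀ e ∈ H.E, 𝒪.rs (μ e) ∈ K' := by
    intro e he
    obtain ⟨u, v, huv, rfl, hu, hv⟩ := GeoGraph.exists_of_mem_edges he
    by_cases hu1 : u = 1
    · subst hu1; exact (hedge1 v huv.symm hv he).rs_mem
    by_cases hv1 : v = 1
    · subst hv1; rw [Finset.pair_comm] at he ⊢; exact (hedge1 u huv hu he).rs_mem
    have h := hqE u v he
    rw [gramForm_eq_cross hi hw1' (hself u hu) (ha u hu hu1) (hself v hv) (ha v hv hv1)] at h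
    rw [← mul_left_cancel₀ h2' h]
    have hr := hPT.cross_ratio (hXP u hu hu1).1 (hXP u hu hu1).2 (hXP v hv hv1).1 (hXP v hv hv1).2
      (isoX_ne_isoY hi hw1' (hself u hu) (ha u hu hu1)) (isoX_ne_isoY hi hw1' (hself v hv) (ha v hv hv1))
    have := (hr.mul_unitIn u2').one_sub
    rw [mul_comm _ (2 : F)] at this
    exact this.rs_mem
  have hfin := hind.card_le_of_mem_acl (S := insert (𝒪.rs w) R) fun e => hedge e e.2
  have h5 := Finset.card_insert_le (𝒪.rs w) R
  have h6 := hH.card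
  simp only [Fintype.card_coe] at hfin
  omega

end

theorem range_edges {α : Type*} (H : GeoGraph) (μ : Finset ℕ → α) :
    Set.range (fun e : H.E => μ e) = μ '' (H.E : Set (Finset ℕ)) := by
  ext x; simp

theorem mem_range_of_mem_acl {k F : Type*} [Field k] [IsAlgClosed k] [CharZero k] [Field F] [CharZero F]
    (σ : k →+* F) {S : Set k} {x : F} (hx : x ∈ acl (σ '' S)) : x ∈ Set.range σ := by
  rw [mem_acl_iff] at hx
  obtain ⟨p, hp, hpx⟩ := hx
  have h3 : (Algebra.adjoin ℚ (σ '' S) : Set F) ⊆ Set.range σ := by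
    have : Algebra.adjoin ℚ (σ '' S) ≤ σ.toRatAlgHom.range := by
      rw [Algebra.adjoin_le_iff]
      rintro _ ⟨y, -, rfl⟩
      exact ⟨y, rfl⟩
    exact this
  obtain ⟨p', hp'⟩ := (mem_lifts (f := σ) (p.map (algebraMap _ F))).1 ((lifts_iff_coeff_lifts _).2
    fun n => by rw [coeff_map]; exact h3 (p.coeff n).2)
  have hne : p'.map σ ≠ 0 := by
    rw [hp', Polynomial.map_ne_zero_iff (FaithfulSMul.algebraMap_injective _ _)]; exact hp
  have hroot : x ∈ (p'.map σ).roots := by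
    rw [mem_roots hne, hp', IsRoot.def, eval_map]; exact hpx
  rw [(IsAlgClosed.splits p').roots_map, Multiset.mem_map] at hroot
  obtain ⟨y, -, rfl⟩ := hroot
  exact ⟨y, rfl⟩

section

variable {F : Type*} [Field F] [CharZero F] {H : GeoGraph} {μ : Finset ℕ → F} {q : ℕ → Fin 3 → F}

/-- The set of all coordinates of a tuple of points. -/
def coords (q : ℕ → Fin 3 → F) : Set F := Set.range fun p : ℕ × Fin 3 => q p.1 p.2

/-- The index type of the Gram coordinates. -/
abbrev GramIndex (H : GeoGraph) : Type := Option ({v // v ∈ (H.V \ {1, 2} : Finset ℕ)} × Fin 2)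

/-- The coordinates of a realization that determine all others up to sign. -/
def gramFamily (H : GeoGraph) (w : F) (q : ℕ → Fin 3 → F) :
    GramIndex H → F :=
  fun o => o.elim w fun p => q p.1 p.2.castSucc

theorem card_gramFamily (hH : H.Tight) :
    Fintype.card (GramIndex H) = H.E.card + 1 := by
  have h1 : ({1, 2} : Finset ℕ) ⊆ H.V := fun x hx => hH.sub (by simp at hx ⊢; tauto)
  have h2 : 3 ≤ H.V.card := by simpa using Finset.card_le_card hH.sub
  rw [Fintype.card_option, Fintype.card_prod, Fintype.card_coe, Finset.card_sdiff_of_subset h1,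
    Fintype.card_fin, hH.card, Finset.card_pair (by decide)]
  omega

theorem coords_subset_acl (hq : q ∈ GramRealization H μ) :
    coords q ⊆ acl (Set.range (gramFamily H (μ {1, 2}) q)) := by
  obtain ⟨hq0, hq1, hq2, hqV, -⟩ := hq
  set K := acl (Set.range (gramFamily H (μ {1, 2}) q))
  have hw : μ {1, 2} ∈ K := subset_acl _ ⟨none, rfl⟩
  rintro _ ⟨⟨v, j⟩, rfl⟩
  show q v j ∈ K
  by_cases h1 : v = 1
  · subst h1; rw [hq1]
    fin_cases j
    exacts [one_mem _, hw, zero_mem _]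
  by_cases h2 : v = 2
  · subst h2; rw [hq2]
    fin_cases j
    exacts [hw, one_mem _, zero_mem _]
  by_cases hv : v ∈ H.V
  · have hm : v ∈ H.V \ {1, 2} := by simp [hv, h1, h2]
    have h0 : q v 0 ∈ K := subset_acl _ ⟨some (⟨v, hm⟩, 0), rfl⟩
    have h1 : q v 1 ∈ K := subset_acl _ ⟨some (⟨v, hm⟩, 1), rfl⟩
    fin_cases j
    · exact h0
    · exact h1
    · apply mem_acl_of_sq
      have := hqV v hv
      have e : q v 2 ^ 2 = 1 - μ {1, 2} ^ 2 - q v 0 ^ 2 - q v 1 ^ 2 + 2 * (μ {1, 2} * q v 0 * q v 1) := by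
        simp only [gramForm] at this
        linear_combination this
      show q v 2 ^ 2 ∈ K
      rw [e]
      exact add_mem (sub_mem (sub_mem (sub_mem (one_mem _) (pow_mem hw 2)) (pow_mem h0 2))
        (pow_mem h1 2)) (mul_mem (ofNat_mem K 2) (mul_mem (mul_mem hw h0) h1))
  · rw [hq0 v hv]; exact zero_mem _

theorem length_mem_acl_coords (hw : μ {1, 2} ^ 2 ≠ 1) (hq : q ∈ GramRealization H μ)
    {e : Finset ℕ} (he : e ∈ H.E) : μ e ∈ acl (coords q) := by
  obtain ⟨u, v, -, rfl, -, -⟩ := GeoGraph.exists_of_mem_edges he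
  have h := hq.2.2.2.2 u v he
  have hc : ∀ v j, q v j ∈ acl (coords q) := fun v j => subset_acl _ ⟨(v, j), rfl⟩
  have hw' : μ {1, 2} ∈ acl (coords q) := by
    have := hc 1 1; rw [hq.2.1] at this; exact this
  have h2 : (1 - μ {1, 2} ^ 2) ≠ 0 := fun h => hw (by linear_combination -h)
  have h' : μ {u, v} = gramForm (μ {1, 2}) (q u) (q v) / (1 - μ {1, 2} ^ 2) :=
    (eq_div_iff h2).2 (by rw [h, mul_comm])
  rw [h', gramForm]
  exact div_mem (add_mem (sub_mem (add_mem (mul_mem (hc _ _) (hc _ _)) (mul_mem (hc _ _) (hc _ _)))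
    (mul_mem hw' (add_mem (mul_mem (hc _ _) (hc _ _)) (mul_mem (hc _ _) (hc _ _)))))
    (mul_mem (hc _ _) (hc _ _))) (sub_mem (one_mem _) (pow_mem hw' 2))

/-- The realizations with prescribed value of the linear coordinate `a₀ + b₀`. -/
def GramFiber (H : GeoGraph) (μ : Finset ℕ → F) (l : F) : Set (ℕ → Fin 3 → F) :=
  {q | q ∈ GramRealization H μ ∧ q 0 0 + q 0 1 = l}

/-- Independence of the edge data. -/
abbrev GeoGraph.IndepOn (H : GeoGraph) (μ : Finset ℕ → F) : Prop :=
  AlgebraicIndependent ℚ (fun e : H.E => μ e)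

theorem GeoGraph.IndepOn.sq_ne_one (hμ : H.IndepOn μ) (hH : H.Tight) : μ {1, 2} ^ 2 ≠ 1 :=
  AlgebraicIndependent.sq_ne_one hμ ⟨_, hH.mem⟩

theorem GeoGraph.IndepOn.option (hμ : H.IndepOn μ) {l : F} (hl : l ∉ acl (μ '' H.E)) :
    AlgebraicIndependent ℚ (fun o : Option H.E => o.elim l fun e => μ e) := by
  rw [← range_edges] at hl
  exact AlgebraicIndependent.option_of_notMem_acl hμ hl

omit [Field F] [CharZero F] in
theorem range_option_edges (H : GeoGraph) (μ : Finset ℕ → F) (l : F) :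
    Set.range (fun o : Option H.E => o.elim l fun e => μ e) = insert l (μ '' H.E) := by
  ext x; simp [Option.exists, eq_comm]

/-- A realization whose coordinates generate `l` besides the edge data has independent Gram
coordinates. -/
theorem gramFamily_independent (hH : H.Tight) (hμ : H.IndepOn μ) {l : F} (hl : l ∉ acl (μ '' H.E))
    (hq : q ∈ GramRealization H μ) (hlq : l ∈ acl (coords q)) :
    AlgebraicIndependent ℚ (gramFamily H (μ {1, 2}) q) ∧ coords q ⊆ acl (insert l (μ '' H.E)) := by
  have h1 := acl_le (coords_subset_acl hq)
  obtain ⟨h2, h3⟩ := algebraicIndependent_of_card_le (hμ.option hl) (g := gramFamily H (μ {1, 2}) q)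
    (by
      rintro (_ | e)
      · exact h1 hlq
      · exact h1 (length_mem_acl_coords (hμ.sq_ne_one hH) hq e.2))
    (by rw [card_gramFamily hH]; simp)
  refine ⟨h2, ?_⟩
  rw [range_option_edges] at h3
  refine (coords_subset_acl hq).trans (acl_le ?_)
  rintro _ ⟨k, rfl⟩
  exact h3 k

theorem GramFiber.mem_acl_coords {l : F} (hq : q ∈ GramFiber H μ l) : l ∈ acl (coords q) := by
  rw [← hq.2]
  exact add_mem (subset_acl _ ⟨(0, 0), rfl⟩) (subset_acl _ ⟨(0, 1), rfl⟩)

theorem GramFiber.independent (hH : H.Tight) (hμ : H.IndepOn μ) {l : F} (hl : l ∉ acl (μ '' H.E))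
    (hq : q ∈ GramFiber H μ l) : AlgebraicIndependent ℚ (gramFamily H (μ {1, 2}) q) :=
  (gramFamily_independent hH hμ hl hq.1 (mem_acl_coords hq)).1

theorem GramFiber.coord_mem_acl (hH : H.Tight) (hμ : H.IndepOn μ) {l : F} (hl : l ∉ acl (μ '' H.E))
    (hq : q ∈ GramFiber H μ l) (v : ℕ) (j : Fin 3) : q v j ∈ acl (insert l (μ '' H.E)) :=
  (gramFamily_independent hH hμ hl hq.1 (mem_acl_coords hq)).2 ⟨(v, j), rfl⟩

theorem GramFiber.sq_ne_one (hH : H.Tight) (hμ : H.IndepOn μ) {l : F} (hl : l ∉ acl (μ '' H.E))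
    (hq : q ∈ GramFiber H μ l) {v : ℕ} (hv : v ∈ H.V) (hv1 : v ≠ 1) : q v 0 ^ 2 ≠ 1 := by
  by_cases h2 : v = 2
  · subst h2; rw [hq.1.2.2.1]; exact hμ.sq_ne_one hH
  · exact (GramFiber.independent hH hμ hl hq).sq_ne_one (some (⟨v, by simp [hv, hv1, h2]⟩, 0))

theorem GramFiber.third_ne_zero (hH : H.Tight) (hμ : H.IndepOn μ) {l : F} (hl : l ∉ acl (μ '' H.E))
    (hq : q ∈ GramFiber H μ l) : q 0 2 ≠ 0 := by
  intro h0
  have h1 := GramFiber.independent hH hμ hl hq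
  have hV : 0 ∈ H.V := hH.sub (by simp)
  have hm : 0 ∈ (H.V \ {1, 2} : Finset ℕ) := by simp [hV]
  have h2 : AlgebraicIndependent ℚ ![μ {1, 2}, q 0 0, q 0 1] := by
    have := h1.comp ![none, some (⟨0, hm⟩, 0), some (⟨0, hm⟩, 1)] (by
      intro i j; fin_cases i <;> fin_cases j <;> simp)
    convert this using 1
    funext i; fin_cases i <;> rfl
  classical
  have h3 := h2.card_le_of_mem_acl (S := {μ {1, 2}, q 0 0}) (by
    have hw : μ {1, 2} ∈ acl (↑({μ {1, 2}, q 0 0} : Finset F) : Set F) := subset_acl _ (by simp)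
    have ha : q 0 0 ∈ acl (↑({μ {1, 2}, q 0 0} : Finset F) : Set F) := subset_acl _ (by simp)
    intro i
    fin_cases i
    · exact hw
    · exact ha
    · refine quadClosed_acl _ 1 (-(2 * (μ {1, 2} * q 0 0))) (q 0 0 ^ 2 - (1 - μ {1, 2} ^ 2)) _
        (one_mem _) (neg_mem (mul_mem (ofNat_mem _ 2) (mul_mem hw ha)))
        (sub_mem (pow_mem ha 2) (sub_mem (one_mem _) (pow_mem hw 2))) (Or.inl one_ne_zero) ?_
      have := hq.1.2.2.2.1 0 hV
      simp only [gramForm, h0] at this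
      change 1 * q 0 1 ^ 2 + -(2 * (μ {1, 2} * q 0 0)) * q 0 1 + (q 0 0 ^ 2 - (1 - μ {1, 2} ^ 2)) = 0
      linear_combination this)
  have := Finset.card_le_two (a := μ {1, 2}) (b := q 0 0)
  simp at h3
  omega

end

theorem gramRealization_map {F F' : Type*} [Field F] [Field F'] (σ : F →+* F') {H : GeoGraph}
    {μ : Finset ℕ → F} {q : ℕ → Fin 3 → F} (hq : q ∈ GramRealization H μ) :
    (fun v j => σ (q v j)) ∈ GramRealization H (fun e => σ (μ e)) := by
  obtain ⟨h0, h1, h2, h3, h4⟩ := hq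
  have key : ∀ u v, gramForm (σ (μ {1, 2})) (fun j => σ (q u j)) (fun j => σ (q v j)) =
      σ (gramForm (μ {1, 2}) (q u) (q v)) := by
    intro u v; simp [gramForm]
  refine ⟨fun v hv => ?_, ?_, ?_, fun v hv => ?_, fun u v he => ?_⟩
  · funext j; simp [h0 v hv]
  · funext j; show σ (q 1 j) = _; rw [h1]; fin_cases j <;> simp
  · funext j; show σ (q 2 j) = _; rw [h2]; fin_cases j <;> simp
  · rw [key, h3 v hv]; simp
  · rw [key, h4 u v he]; simp

theorem gramFiber_map {F F' : Type*} [Field F] [Field F'] (σ : F →+* F') {H : GeoGraph}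
    {μ : Finset ℕ → F} {l : F} {q : ℕ → Fin 3 → F} (hq : q ∈ GramFiber H μ l) :
    (fun v j => σ (q v j)) ∈ GramFiber H (fun e => σ (μ e)) (σ l) :=
  ⟨gramRealization_map σ hq.1, by rw [← hq.2, map_add]⟩

open Filter in
theorem gramFiber_finite {H : GeoGraph} (hH : H.Tight) {μ : Finset ℕ → ℂ} (hμ : H.IndepOn μ) {l : ℂ}
    (hl : l ∉ acl (μ '' H.E)) : (GramFiber H μ l).Finite := by
  by_contra hinf
  obtain ⟨f, hfinj, hf⟩ : ∃ f : ℕ → ℕ → Fin 3 → ℂ, Function.Injective f ∧ ∀ n, f n ∈ GramFiber H μ l := by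
    have h := Set.Infinite.natEmbedding _ hinf
    exact ⟨fun n => h n, fun a b hab => h.injective (Subtype.ext hab), fun n => (h n).2⟩
  let G := Germ (hyperfilter ℕ : Filter ℕ) ℂ
  let cst : ℂ →+* G := (Germ.coeRingHom (hyperfilter ℕ : Filter ℕ)).comp (Pi.constRingHom ℕ ℂ)
  have : CharZero G := charZero_of_injective_ringHom cst.injective
  let Q : ℕ → Fin 3 → G := fun v j => ((fun n => f n v j : ℕ → ℂ) : G)
  have hQ : Q ∈ GramFiber H (fun e => cst (μ e)) (cst l) := by
    refine ⟨⟨fun v hv => ?_, ?_, ?_, fun v hv => ?_, fun u v he => ?_⟩, ?_⟩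
    · funext j
      exact Germ.coe_eq.2 (Eventually.of_forall fun n => by
        have := (hf n).1.1 v hv
        simp [this])
    · funext j
      fin_cases j <;>
      exact Germ.coe_eq.2 (Eventually.of_forall fun n => by
        have := (hf n).1.2.1
        simp [this])
    · funext j
      fin_cases j <;>
      exact Germ.coe_eq.2 (Eventually.of_forall fun n => by
        have := (hf n).1.2.2.1
        simp [this])
    · exact Germ.coe_eq.2 (Eventually.of_forall fun n => (hf n).1.2.2.2.1 v hv)
    · exact Germ.coe_eq.2 (Eventually.of_forall fun n => (hf n).1.2.2.2.2 u v he)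
    · exact Germ.coe_eq.2 (Eventually.of_forall fun n => (hf n).2)
  have hμ' : H.IndepOn (fun e => cst (μ e)) := hμ.map_ringHom cst
  have himg : (fun e => cst (μ e)) '' (H.E : Set (Finset ℕ)) = cst '' (μ '' H.E) := by
    rw [Set.image_image]
  have hl' : cst l ∉ acl ((fun e => cst (μ e)) '' (H.E : Set (Finset ℕ))) := by
    rw [← range_edges]
    have := (hμ.option hl).map_ringHom cst
    refine AlgebraicIndependent.notMem_acl_of_option (f := fun e : H.E => cst (μ e)) ?_
    convert this using 1
    funext o; cases o <;> rfl
  have hc : ∀ v j, ∃ c, cst c = Q v j := by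
    intro v j
    have h1 := GramFiber.coord_mem_acl hH hμ' hl' hQ v j
    rw [himg, ← Set.image_insert_eq] at h1
    exact mem_range_of_mem_acl cst h1
  choose c hc using hc
  have h2 : ∀ᶠ n in (hyperfilter ℕ : Filter ℕ), ∀ v ∈ H.V, ∀ j, f n v j = c v j := by
    rw [Filter.eventually_all_finset]
    intro v _
    rw [Filter.eventually_all]
    intro j
    exact (Germ.coe_eq.1 (hc v j)).mono fun n h => h.symm
  have h3 : {n | ∀ v ∈ H.V, ∀ j, f n v j = c v j}.Subsingleton := by
    intro n hn m hm
    apply hfinj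
    funext v j
    by_cases hv : v ∈ H.V
    · rw [hn v hv j, hm v hv j]
    · rw [(hf n).1.1 v hv, (hf m).1.1 v hv]
  exact h3.finite.notMem_hyperfilter h2

/-- Taylor expansion along a vector field with prescribed values on independent elements. -/
theorem exists_taylor {ι : Type*} {f : ι → ℂ} (hf : AlgebraicIndependent ℚ f) (c : ι → ℂ) :
    ∃ θ : ℂ →+* PowerSeries ℂ, (∀ x, PowerSeries.constantCoeff (θ x) = x) ∧
      ∀ i, θ (f i) = PowerSeries.C (f i) + PowerSeries.C (c i) * PowerSeries.X := by
  let R := MvPolynomial ι ℚ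
  let _ : Algebra R ℂ := (MvPolynomial.aeval (R := ℚ) f).toRingHom.toAlgebra
  let _ : Algebra R (PowerSeries ℂ) := (MvPolynomial.aeval (R := ℚ) fun i =>
    PowerSeries.C (f i) + PowerSeries.C (c i) * PowerSeries.X).toRingHom.toAlgebra
  have hinj : Function.Injective (algebraMap R ℂ) := hf
  have : FaithfulSMul R ℂ := (faithfulSMul_iff_algebraMap_injective R ℂ).2 hinj
  let _ : Algebra (FractionRing R) ℂ := FractionRing.liftAlgebra R ℂ
  have : IsScalarTower R (FractionRing R) ℂ := FractionRing.isScalarTower_liftAlgebra R ℂ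
  have h1 : Algebra.FormallySmooth R (FractionRing R) :=
    Algebra.FormallySmooth.of_isLocalization (nonZeroDivisors R)
  have : CharZero (FractionRing R) := inferInstance
  have h2 : Algebra.FormallySmooth (FractionRing R) ℂ := by
    obtain ⟨ι', b, hb⟩ := exists_isTranscendenceBasis' (FractionRing R) ℂ
    have := hb.isAlgebraic_field
    exact Algebra.FormallySmooth.of_algebraicIndependent_of_isSeparable hb.1
  have h3 : Algebra.FormallySmooth R ℂ := Algebra.FormallySmooth.comp R (FractionRing R) ℂ
  let I : Ideal (PowerSeries ℂ) := Ideal.span {PowerSeries.X}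
  have hmem : ∀ s : PowerSeries ℂ, s ∈ I ↔ PowerSeries.constantCoeff s = 0 := fun s => by
    rw [Ideal.mem_span_singleton, PowerSeries.X_dvd_iff]
  let g : ℂ →+* PowerSeries ℂ ⧸ I := (Ideal.Quotient.mk I).comp PowerSeries.C
  have hg : g.comp (algebraMap R ℂ) = algebraMap R (PowerSeries ℂ ⧸ I) := by
    refine MvPolynomial.ringHom_ext' ?_ ?_
    · exact Subsingleton.elim _ _
    · intro i
      show g (MvPolynomial.aeval f (MvPolynomial.X i)) = Ideal.Quotient.mk I
        (MvPolynomial.aeval _ (MvPolynomial.X i))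
      rw [MvPolynomial.aeval_X, MvPolynomial.aeval_X]
      show Ideal.Quotient.mk I _ = _
      rw [Ideal.Quotient.eq, hmem]
      simp
  let g' : ℂ →ₐ[R] PowerSeries ℂ ⧸ I := ⟨g, fun r => DFunLike.congr_fun hg r⟩
  obtain ⟨θ, hθ⟩ := Algebra.FormallySmooth.exists_mkₐ_comp_eq_of_isAdicComplete g'
  refine ⟨θ, fun x => ?_, fun i => ?_⟩
  · have h : Ideal.Quotient.mk I (θ x) = Ideal.Quotient.mk I (PowerSeries.C x) := DFunLike.congr_fun hθ x
    rw [Ideal.Quotient.eq, hmem] at h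
    simpa [sub_eq_zero] using h
  · have h := θ.commutes (MvPolynomial.X i)
    have e1 : algebraMap R ℂ (MvPolynomial.X i) = f i := MvPolynomial.aeval_X _ _
    have e2 : algebraMap R (PowerSeries ℂ) (MvPolynomial.X i) =
      PowerSeries.C (f i) + PowerSeries.C (c i) * PowerSeries.X := MvPolynomial.aeval_X _ _
    rw [e1, e2] at h
    exact h

theorem isAlgebraic_of_mem_acl {F : Type*} [Field F] [CharZero F] {K : Subfield F} {S : Set F}
    (hS : S ⊆ K) {x : F} (hx : x ∈ acl S) : IsAlgebraic K x := by
  rw [mem_acl_iff] at hx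
  have h1 : Algebra.adjoin ℚ S ≤ (K.toIntermediateField fun x => by simp : IntermediateField ℚ F).toSubalgebra :=
    Algebra.adjoin_le hS
  let i : Algebra.adjoin ℚ S →+* K :=
    ⟨⟨⟨fun y => ⟨y.1, h1 y.2⟩, rfl⟩, fun _ _ => rfl⟩, rfl, fun _ _ => rfl⟩
  obtain ⟨p, hp, hpx⟩ := hx
  have hi : Function.Injective i := fun a b h => Subtype.ext (congrArg (fun y : K => (y : F)) h)
  refine ⟨p.map i, (Polynomial.map_ne_zero_iff hi).2 hp, ?_⟩
  rw [aeval_def, eval₂_map]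
  exact hpx

section

open PowerSeries (constantCoeff)

/-- The field of elements on which two ring homomorphisms agree modulo an ideal. -/
def eqSubfieldMod {F A : Type*} [Field F] [CommRing A] (θ φ : F →+* A) (J : Ideal A) :
    Subfield F where
  carrier := {x | θ x - φ x ∈ J}
  mul_mem' {a b} ha hb := by
    have : θ (a * b) - φ (a * b) = (θ a - φ a) * θ b + φ a * (θ b - φ b) := by
      simp only [map_mul]; ring
    show _ ∈ J
    rw [this]
    exact add_mem (J.mul_mem_right _ ha) (J.mul_mem_left _ hb)
  one_mem' := by simp
  add_mem' {a b} ha hb := by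
    have : θ (a + b) - φ (a + b) = (θ a - φ a) + (θ b - φ b) := by
      simp only [map_add]; ring
    show _ ∈ J
    rw [this]
    exact add_mem ha hb
  zero_mem' := by simp
  neg_mem' {a} ha := by
    have : θ (-a) - φ (-a) = -(θ a - φ a) := by
      simp only [map_neg]; ring
    show _ ∈ J
    rw [this]
    exact neg_mem ha
  inv_mem' a ha := by
    by_cases h0 : a = 0
    · simp [h0]
    have h1 : θ a * θ a⁻¹ = 1 := by rw [← map_mul, mul_inv_cancel₀ h0, map_one]
    have h2 : φ a * φ a⁻¹ = 1 := by rw [← map_mul, mul_inv_cancel₀ h0, map_one]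
    have : θ a⁻¹ - φ a⁻¹ = -(θ a⁻¹ * φ a⁻¹) * (θ a - φ a) := by
      linear_combination φ a⁻¹ * h1 - θ a⁻¹ * h2
    show _ ∈ J
    rw [this]
    exact J.mul_mem_left _ ha

theorem acl_le_eqSubfieldMod {θ φ : ℂ →+* PowerSeries ℂ} (hθ : ∀ x, constantCoeff (θ x) = x)
    (hφ : ∀ x, constantCoeff (φ x) = x) {J : Ideal (PowerSeries ℂ)} {S : Set ℂ}
    (hS : ∀ x ∈ S, θ x - φ x ∈ J) {x : ℂ} (hx : x ∈ acl S) : θ x - φ x ∈ J := by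
  set K := eqSubfieldMod θ φ J with hK
  have halg : IsAlgebraic K x := isAlgebraic_of_mem_acl (K := K) hS hx
  set p := minpoly K x
  have hsep : aeval x (derivative p) ≠ 0 :=
    (minpoly.irreducible halg.isIntegral).separable.aeval_derivative_ne_zero (minpoly.aeval K x)
  set a := θ.comp K.subtype
  set b := φ.comp K.subtype
  have h1 : p.eval₂ a (θ x) = 0 := by
    have : p.eval₂ (θ.comp K.subtype) (θ x) = θ (p.eval₂ K.subtype x) := hom_eval₂ p _ θ x |>.symm
    rw [this]
    have h := minpoly.aeval K x
    rw [aeval_def] at h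
    exact (congrArg θ h).trans (map_zero _)
  have h2 : p.eval₂ b (φ x) = 0 := by
    have : p.eval₂ (φ.comp K.subtype) (φ x) = φ (p.eval₂ K.subtype x) := hom_eval₂ p _ φ x |>.symm
    rw [this]
    have h := minpoly.aeval K x
    rw [aeval_def] at h
    exact (congrArg φ h).trans (map_zero _)
  have h3 : p.eval₂ a (φ x) ∈ J := by
    rw [← sub_zero (p.eval₂ a (φ x)), ← h2, eval₂_eq_sum_range, eval₂_eq_sum_range,
      ← Finset.sum_sub_distrib]
    refine sum_mem fun i _ => ?_
    rw [← sub_mul]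
    exact J.mul_mem_right _ (p.coeff i).2
  obtain ⟨k, hk⟩ := Polynomial.binomExpansion (p.map a) (φ x) (θ x - φ x)
  rw [add_sub_cancel, eval_map, h1, eval_map, derivative_map, eval_map] at hk
  have hu : IsUnit ((derivative p).eval₂ a (φ x) + k * (θ x - φ x)) := by
    rw [PowerSeries.isUnit_iff_constantCoeff, map_add, map_mul, map_sub, hθ, hφ, sub_self, mul_zero,
      add_zero, hom_eval₂, hφ, isUnit_iff_ne_zero]
    convert hsep using 1
    rw [aeval_def]
    congr 1
    ext y
    exact hθ _
  have h4 : (θ x - φ x) * ((derivative p).eval₂ a (φ x) + k * (θ x - φ x)) ∈ J := by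
    have : (θ x - φ x) * ((derivative p).eval₂ a (φ x) + k * (θ x - φ x)) = -(p.eval₂ a (φ x)) := by
      linear_combination -hk
    rw [this]; exact neg_mem h3
  exact (Ideal.mul_unit_mem_iff_mem J hu).1 h4

end

namespace IsSplit

variable {G G₁ G₂ : GeoGraph}

theorem symm (hs : IsSplit G G₁ G₂) : IsSplit G G₂ G₁ := by
  obtain ⟨h1, h2, h3, h4⟩ := hs
  exact ⟨by rw [h1, Finset.union_comm], by rw [h2, Finset.union_comm], by rw [← h3, Finset.inter_comm],
    by rw [← h4, Finset.inter_comm]⟩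

theorem card_verts (hs : IsSplit G G₁ G₂) : G.V.card + 3 = G₁.V.card + G₂.V.card := by
  rw [hs.1, ← Finset.card_union_add_card_inter, hs.2.2.1]; rfl

theorem card_edges (hs : IsSplit G G₁ G₂) : G.E.card + 1 = G₁.E.card + G₂.E.card := by
  rw [hs.2.1, ← Finset.card_union_add_card_inter, hs.2.2.2]; rfl

theorem verts_left (hs : IsSplit G G₁ G₂) : G₁.V ⊆ G.V := hs.1 ▸ Finset.subset_union_left

theorem edges_left (hs : IsSplit G G₁ G₂) : G₁.E ⊆ G.E := hs.2.1 ▸ Finset.subset_union_left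

theorem mem_inter (hs : IsSplit G G₁ G₂) {v : ℕ} (h1 : v ∈ G₁.V) (h2 : v ∈ G₂.V) :
    v = 0 ∨ v = 1 ∨ v = 2 := by
  have : v ∈ G₁.V ∩ G₂.V := Finset.mem_inter.2 ⟨h1, h2⟩
  rw [hs.2.2.1] at this
  simpa using this

theorem card_eq (hs : IsSplit G G₁ G₂) (h1 : G₁.Tight) (h2 : G₂.Tight) :
    G.E.card + 3 = 2 * G.V.card := by
  have := hs.card_verts
  have := hs.card_edges
  have := h1.card
  have := h2.card
  have h1 : 3 ≤ G₁.V.card := by simpa using Finset.card_le_card h1.sub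
  have h2 : 3 ≤ G₂.V.card := by simpa using Finset.card_le_card h2.sub
  omega

theorem indepOn_left {F : Type*} [Field F] [CharZero F] {μ : Finset ℕ → F} (hs : IsSplit G G₁ G₂)
    (hμ : G.IndepOn μ) : G₁.IndepOn μ :=
  hμ.comp (fun e : G₁.E => (⟨e, hs.edges_left e.2⟩ : G.E)) fun _ _ h =>
    Subtype.ext (congrArg (fun e : G.E => e.1) h)

end IsSplit

section

variable {F : Type*} [Field F] {G G₁ G₂ : GeoGraph} {μ : Finset ℕ → F} {q : ℕ → Fin 3 → F}

/-- The restriction of a tuple of points to the vertices of a graph. -/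
def restrictVerts (H : GeoGraph) (q : ℕ → Fin 3 → F) : ℕ → Fin 3 → F :=
  fun v => if v ∈ H.V then q v else 0

theorem restrictVerts_of_mem {H : GeoGraph} {v : ℕ} (hv : v ∈ H.V) : restrictVerts H q v = q v :=
  if_pos hv

theorem restrictVerts_mem (hs : IsSplit G G₁ G₂) (h1 : G₁.Tight) (hq : q ∈ GramRealization G μ) :
    restrictVerts G₁ q ∈ GramRealization G₁ μ := by
  obtain ⟨-, hq1, hq2, hqV, hqE⟩ := hq
  refine ⟨fun v hv => if_neg hv, ?_, ?_, fun v hv => ?_, fun u v he => ?_⟩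
  · rw [restrictVerts_of_mem (h1.sub (by simp)), hq1]
  · rw [restrictVerts_of_mem (h1.sub (by simp)), hq2]
  · rw [restrictVerts_of_mem hv]; exact hqV v (hs.verts_left hv)
  · have := G₁.edge_sub _ he
    rw [restrictVerts_of_mem (this (by simp)), restrictVerts_of_mem (this (by simp))]
    exact hqE u v (hs.edges_left he)

/-- Two realizations that agree at the vertex `0` glue to a realization of the split graph. -/
def glueVerts (G₁ : GeoGraph) (q₁ q₂ : ℕ → Fin 3 → F) : ℕ → Fin 3 → F :=
  fun v => if v ∈ G₁.V then q₁ v else q₂ v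

variable {q₁ q₂ : ℕ → Fin 3 → F}

omit [Field F] in
theorem glueVerts_left {v : ℕ} (hv : v ∈ G₁.V) : glueVerts G₁ q₁ q₂ v = q₁ v := if_pos hv

theorem glueVerts_right (hs : IsSplit G G₁ G₂) (hq₁ : q₁ ∈ GramRealization G₁ μ)
    (hq₂ : q₂ ∈ GramRealization G₂ μ) (h : q₁ 0 = q₂ 0) {v : ℕ} (hv : v ∈ G₂.V) :
    glueVerts G₁ q₁ q₂ v = q₂ v := by
  by_cases h1 : v ∈ G₁.V
  · rw [glueVerts_left h1]
    obtain rfl | rfl | rfl := hs.mem_inter h1 hv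
    · exact h
    · rw [hq₁.2.1, hq₂.2.1]
    · rw [hq₁.2.2.1, hq₂.2.2.1]
  · exact if_neg h1

theorem glueVerts_mem (hs : IsSplit G G₁ G₂) (h1 : G₁.Tight) (hq₁ : q₁ ∈ GramRealization G₁ μ)
    (hq₂ : q₂ ∈ GramRealization G₂ μ) (h : q₁ 0 = q₂ 0) :
    glueVerts G₁ q₁ q₂ ∈ GramRealization G μ := by
  have hr := fun {v} => glueVerts_right (v := v) hs hq₁ hq₂ h
  refine ⟨fun v hv => ?_, ?_, ?_, fun v hv => ?_, fun u v he => ?_⟩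
  · rw [hs.1, Finset.mem_union, not_or] at hv
    rw [glueVerts, if_neg hv.1, hq₂.1 v hv.2]
  · rw [glueVerts_left (h1.sub (by simp)), hq₁.2.1]
  · rw [glueVerts_left (h1.sub (by simp)), hq₁.2.2.1]
  · rw [hs.1, Finset.mem_union] at hv
    obtain hv | hv := hv
    · rw [glueVerts_left hv]; exact hq₁.2.2.2.1 v hv
    · rw [hr hv]; exact hq₂.2.2.2.1 v hv
  · rw [hs.2.1, Finset.mem_union] at he
    obtain he | he := he
    · have := G₁.edge_sub _ he
      rw [glueVerts_left (this (by simp)), glueVerts_left (this (by simp))]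
      exact hq₁.2.2.2.2 u v he
    · have := G₂.edge_sub _ he
      rw [hr (this (by simp)), hr (this (by simp))]
      exact hq₂.2.2.2.2 u v he

/-- Reflection in the plane spanned by the images of the vertices `1` and `2`. -/
def reflectZ (q : ℕ → Fin 3 → F) : ℕ → Fin 3 → F := fun v => ![q v 0, q v 1, -q v 2]

theorem reflectZ_reflectZ (q : ℕ → Fin 3 → F) : reflectZ (reflectZ q) = q := by
  funext v j; fin_cases j <;> simp [reflectZ]

theorem reflectZ_mem (hq : q ∈ GramRealization G μ) : reflectZ q ∈ GramRealization G μ := by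
  obtain ⟨hq0, hq1, hq2, hqV, hqE⟩ := hq
  have key : ∀ u v, gramForm (μ {1, 2}) (reflectZ q u) (reflectZ q v) =
      gramForm (μ {1, 2}) (q u) (q v) := by
    intro u v; simp [gramForm, reflectZ]
  refine ⟨fun v hv => ?_, ?_, ?_, fun v hv => ?_, fun u v he => ?_⟩
  · simp [reflectZ, hq0 v hv]
  · simp [reflectZ, hq1]
  · simp [reflectZ, hq2]
  · rw [key]; exact hqV v hv
  · rw [key]; exact hqE u v he

theorem reflectZ_mem_gramFiber {l : F} (hq : q ∈ GramFiber G μ l) : reflectZ q ∈ GramFiber G μ l :=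
  ⟨reflectZ_mem hq.1, hq.2⟩

/-- Two realizations with the same first two coordinates at the vertex `0` agree there, up to a
reflection. -/
theorem eq_or_reflectZ (h0₁ : 0 ∈ G₁.V) (h0₂ : 0 ∈ G₂.V) (hq₁ : q₁ ∈ GramRealization G₁ μ)
    (hq₂ : q₂ ∈ GramRealization G₂ μ) (ha : q₁ 0 0 = q₂ 0 0) (hb : q₁ 0 1 = q₂ 0 1) :
    q₁ 0 = q₂ 0 ∨ q₁ 0 = reflectZ q₂ 0 := by
  have e1 := hq₁.2.2.2.1 0 h0₁
  have e2 := hq₂.2.2.2.1 0 h0₂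
  simp only [gramForm, ha, hb] at e1 e2
  have : (q₁ 0 2 - q₂ 0 2) * (q₁ 0 2 + q₂ 0 2) = 0 := by linear_combination e1 - e2
  obtain h | h := mul_eq_zero.1 this
  · left; funext j; fin_cases j
    exacts [ha, hb, sub_eq_zero.1 h]
  · right; funext j; fin_cases j
    exacts [ha, hb, eq_neg_of_add_eq_zero_left h]

end

section

variable {F : Type*} [Field F] [CharZero F] {G G₁ G₂ : GeoGraph} {μ : Finset ℕ → F}
  {q : ℕ → Fin 3 → F}

theorem IsSplit.mem_edges (hs : IsSplit G G₁ G₂) (h1 : G₁.Tight) : ({1, 2} : Finset ℕ) ∈ G.E :=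
  hs.edges_left h1.mem

/-- The Gram coordinates of a realization of a split graph are independent. -/
theorem IsSplit.gramFamily_independent (hs : IsSplit G G₁ G₂) (h1 : G₁.Tight) (h2 : G₂.Tight)
    (hμ : G.IndepOn μ) (hq : q ∈ GramRealization G μ) :
    AlgebraicIndependent ℚ (gramFamily G (μ {1, 2}) q) ∧ coords q ⊆ acl (μ '' G.E) := by
  have hle := acl_le (coords_subset_acl hq)
  obtain ⟨h3, h4⟩ := algebraicIndependent_of_card_le hμ (g := gramFamily G (μ {1, 2}) q)
    (fun e => hle (length_mem_acl_coords
      (AlgebraicIndependent.sq_ne_one hμ ⟨_, hs.mem_edges h1⟩) hq e.2))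
    (by
      have hsub : ({1, 2} : Finset ℕ) ⊆ G.V := G.edge_sub _ (hs.mem_edges h1)
      have := Finset.card_le_card hsub
      have e := hs.card_eq h1 h2
      rw [Finset.card_pair (by decide)] at this
      rw [Fintype.card_option, Fintype.card_prod, Fintype.card_coe,
        Finset.card_sdiff_of_subset hsub, Fintype.card_fin, Finset.card_pair (by decide),
        Fintype.card_coe]
      omega)
  rw [range_edges] at h4
  refine ⟨h3, (coords_subset_acl hq).trans (acl_le ?_)⟩
  rintro _ ⟨k, rfl⟩
  exact h4 k

/-- In a realization of a split graph, the vertex `0` is not determined by one side. -/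
theorem IsSplit.notMem_of_mem (hs : IsSplit G G₁ G₂) (h1 : G₁.Tight) (h2 : G₂.Tight)
    (hμ : G.IndepOn μ) (hq : q ∈ GramRealization G μ) (ha : q 0 0 ∈ acl (μ '' G₁.E)) :
    q 0 1 ∉ acl (μ '' G₁.E) := by
  intro hb
  classical
  let T : Finset F := G₁.E.image μ ∪
    ((G₂.V \ {0, 1, 2}) ×ˢ (Finset.univ : Finset (Fin 2))).image fun p => q p.1 p.2.castSucc
  have hT1 : (acl (μ '' G₁.E) : Subfield F) ≤ acl (T : Set F) := acl_mono (by
    intro x hx; simp only [T, Finset.coe_union, Finset.coe_image]; exact Or.inl hx)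
  have hw : μ {1, 2} ∈ acl (T : Set F) := hT1 (subset_acl _ ⟨_, h1.mem, rfl⟩)
  have hq₂ := restrictVerts_mem hs.symm h2 hq
  have hc2 : coords (restrictVerts G₂ q) ⊆ acl (T : Set F) := by
    refine (coords_subset_acl hq₂).trans (acl_le ?_)
    rintro _ ⟨_ | ⟨⟨v, hv⟩, j⟩, rfl⟩
    · exact hw
    · simp only [Finset.mem_sdiff, Finset.mem_insert, Finset.mem_singleton, not_or] at hv
      show restrictVerts G₂ q v j.castSucc ∈ _
      rw [restrictVerts_of_mem hv.1]
      by_cases h0 : v = 0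
      · subst h0
        fin_cases j
        exacts [hT1 ha, hT1 hb]
      · refine subset_acl _ ?_
        simp only [T, Finset.coe_union, Finset.coe_image]
        exact Or.inr ⟨(v, j), by simp [hv, h0], rfl⟩
  have hcard := hμ.card_le_of_mem_acl (S := T) (by
    rintro ⟨e, he⟩
    rw [hs.2.1, Finset.mem_union] at he
    obtain he | he := he
    · exact hT1 (subset_acl _ ⟨_, he, rfl⟩)
    · exact acl_le hc2 (length_mem_acl_coords
        (AlgebraicIndependent.sq_ne_one hμ ⟨_, hs.mem_edges h1⟩) hq₂ he))
  have c1 : T.card ≤ G₁.E.card + (G₂.V.card - 3) * 2 := by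
    refine (Finset.card_union_le _ _).trans (add_le_add Finset.card_image_le
      (Finset.card_image_le.trans ?_))
    rw [Finset.card_product, Finset.card_sdiff_of_subset h2.sub]
    simp
  have h3 : 3 ≤ G₂.V.card := by simpa using Finset.card_le_card h2.sub
  have := hs.card_edges
  have := h2.card
  rw [Fintype.card_coe] at hcard
  omega

end

section Places

variable {F : Type*} [Field F]

theorem isIntegral_of_forall_valuationSubring {A : Set F} {x : F}
    (h : ∀ 𝒪 : ValuationSubring F, A ⊆ 𝒪 → x ∈ 𝒪) : IsIntegral (Subring.closure A) x := by
  have h1 : x ∈ (integralClosure (Subring.closure A) F).toSubring := by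
    rw [← iInf_valuationSubring_superset, Subring.mem_iInf]
    exact fun V => h V.1 V.2
  exact h1

variable [CharZero F] {S : Set F} {x : F}

theorem mem_acl_of_isIntegral {A : Set F} (hA : A ⊆ acl S) (h : IsIntegral (Subring.closure A) x) :
    x ∈ acl S := by
  obtain ⟨p, hp, hpx⟩ := h
  refine mem_acl_of_root (p := p.map (algebraMap _ F)) (hp.map _).ne_zero (fun n => ?_) ?_
  · rw [coeff_map]
    have : Subring.closure A ≤ (acl S).toSubring := Subring.closure_le.2 hA
    exact this (p.coeff n).2
  · rw [eval_map]; exact hpx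

theorem exists_valuationSubring_notMem (hx : x ∉ acl S) :
    ∃ 𝒪 : ValuationSubring F, (∀ y ∈ acl S, y ∈ 𝒪) ∧ x ∉ 𝒪 := by
  by_contra! h
  have h1 : IsIntegral (Subring.closure (acl S : Set F)) x :=
    isIntegral_of_forall_valuationSubring fun 𝒪 h𝒪 => h 𝒪 h𝒪
  exact hx (mem_acl_of_isIntegral subset_rfl h1)

variable {𝒪 : ValuationSubring F}

omit [CharZero F] in
theorem mem_valuationSubring_of_aeval_eq_zero {p : F[X]} (hp : p.Monic) (hc : ∀ n, p.coeff n ∈ 𝒪)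
    (hx : p.eval x = 0) : x ∈ 𝒪 := by
  have h1 : p ∈ Polynomial.lifts 𝒪.subtype := by
    rw [Polynomial.lifts_iff_coeff_lifts]
    exact fun n => ⟨⟨_, hc n⟩, rfl⟩
  obtain ⟨q, hq, -, hqm⟩ := Polynomial.lifts_and_natDegree_eq_and_monic h1 hp
  have : IsIntegral 𝒪 x := ⟨q, hqm, by
    have : eval₂ 𝒪.subtype x q = 0 := by rw [← eval_map, hq, hx]
    exact this⟩
  obtain ⟨y, rfl⟩ := IsIntegrallyClosed.isIntegral_iff.1 this
  exact y.2

/-- A valuation ring containing a field contains its algebraic closure. -/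
theorem mem_valuationSubring_of_subfield {K : Subfield F} (hK : ∀ y ∈ K, y ∈ 𝒪) (hS : S ⊆ K)
    (hx : x ∈ acl S) : x ∈ 𝒪 := by
  have h := (isAlgebraic_of_mem_acl hS hx).isIntegral
  refine mem_valuationSubring_of_aeval_eq_zero (p := (minpoly K x).map (algebraMap K F))
    ((minpoly.monic h).map _) (fun n => ?_) ?_
  · rw [coeff_map]; exact hK _ ((minpoly K x).coeff n).2
  · rw [eval_map]; exact minpoly.aeval K x

theorem charZero_residueField (hS : ∀ y ∈ acl S, y ∈ 𝒪) :
    CharZero (IsLocalRing.ResidueField 𝒪) := by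
  refine charZero_of_inj_zero fun n hn => ?_
  by_contra h0
  have h1 : 𝒪.rs (n : F) = n := by
    rw [ValuationSubring.rs_of_mem (natCast_mem 𝒪 n)]
    exact map_natCast (IsLocalRing.residue 𝒪) n
  have hF : (n : F) ≠ 0 := by exact_mod_cast h0
  refine ValuationSubring.inv_notMem (h1.trans hn) (natCast_mem 𝒪 n) hF (hS _ ?_)
  exact inv_mem (natCast_mem _ n)

/-- The residue map on a subfield of the valuation ring. -/
noncomputable def residueHom (K : Subfield F) (hK : ∀ y ∈ K, y ∈ 𝒪) :
    K →+* IsLocalRing.ResidueField 𝒪 :=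
  (IsLocalRing.residue 𝒪).comp
    { toFun := fun y => ⟨y.1, hK _ y.2⟩
      map_one' := rfl
      map_mul' := fun _ _ => rfl
      map_zero' := rfl
      map_add' := fun _ _ => rfl }

omit [CharZero F] in
theorem residueHom_apply {K : Subfield F} (hK : ∀ y ∈ K, y ∈ 𝒪) (y : K) :
    residueHom K hK y = 𝒪.rs (y : F) := by
  rw [ValuationSubring.rs_of_mem (hK _ y.2)]; rfl

variable [CharZero (IsLocalRing.ResidueField 𝒪)]

theorem independent_residues {ι : Type*} {f : ι → F} (hf : AlgebraicIndependent ℚ f)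
    {K : Subfield F} (hK : ∀ y ∈ K, y ∈ 𝒪) (hfK : ∀ i, f i ∈ K) :
    AlgebraicIndependent ℚ (fun i => 𝒪.rs (f i)) := by
  have h1 : AlgebraicIndependent ℚ (fun i => (⟨f i, hfK i⟩ : K)) :=
    AlgebraicIndependent.of_comp (K.subtype).toRatAlgHom hf
  have h2 := h1.map_ringHom (residueHom K hK)
  simpa only [residueHom_apply] using h2

theorem rs_mem_acl (hS : ∀ y ∈ acl S, y ∈ 𝒪) (hx : x ∈ acl S) : 𝒪.rs x ∈ acl (𝒪.rs '' S) := by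
  set K := Subfield.closure S
  have hK : ∀ y ∈ K, y ∈ 𝒪 := fun y hy => hS y (Subfield.closure_le.2 (subset_acl S) hy)
  have hKr : ∀ y ∈ K, 𝒪.rs y ∈ acl (𝒪.rs '' S) := by
    have h1 : K ≤ ((acl (𝒪.rs '' S)).comap (residueHom (acl S) hS)).map (acl S).subtype := by
      refine Subfield.closure_le.2 fun y hy => ⟨⟨y, subset_acl _ hy⟩, ?_, rfl⟩
      show residueHom (acl S) hS _ ∈ acl (𝒪.rs '' S)
      rw [residueHom_apply]
      exact subset_acl _ ⟨y, hy, rfl⟩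
    rintro y hy
    obtain ⟨z, hz, rfl⟩ := h1 hy
    have hz : residueHom (acl S) hS z ∈ acl (𝒪.rs '' S) := hz
    rwa [residueHom_apply] at hz
  have h := (isAlgebraic_of_mem_acl (K := K) Subfield.subset_closure hx).isIntegral
  refine mem_acl_of_root (p := (minpoly K x).map (residueHom K hK)) ((minpoly.monic h).map _).ne_zero
    (fun n => ?_) ?_
  · rw [coeff_map, residueHom_apply]
    exact hKr _ ((minpoly K x).coeff n).2
  · have hK' : ∀ y : K, (y : F) ∈ acl S := fun y => Subfield.closure_le.2 (subset_acl S) y.2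
    have e1 : residueHom K hK = (residueHom (acl S) hS).comp
        (Subfield.inclusion fun y hy => hK' ⟨y, hy⟩) := by
      ext y; simp only [RingHom.comp_apply, residueHom_apply]; rfl
    have e2 : 𝒪.rs x = residueHom (acl S) hS ⟨x, hx⟩  := (residueHom_apply hS ⟨x, hx⟩).symm
    rw [e1, e2, eval_map, ← hom_eval₂]
    convert map_zero (residueHom (acl S) hS)
    apply Subtype.ext
    have := minpoly.aeval K x
    rw [aeval_def] at this
    rw [ZeroMemClass.coe_zero, ← this]
    exact hom_eval₂ _ _ (acl S).subtype _

omit [CharZero F] [CharZero (IsLocalRing.ResidueField 𝒪)] in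
theorem aeval_mem_valuationSubring {K : Subfield F} (hK : ∀ y ∈ K, y ∈ 𝒪) (hx : x ∈ 𝒪) (p : K[X]) :
    aeval x p ∈ 𝒪 ∧ 𝒪.rs (aeval x p) = (p.map (residueHom K hK)).eval (𝒪.rs x) := by
  let φ : K →+* 𝒪 :=
    { toFun := fun y => ⟨y.1, hK _ y.2⟩
      map_one' := rfl
      map_mul' := fun _ _ => rfl
      map_zero' := rfl
      map_add' := fun _ _ => rfl }
  have e1 : aeval x p = ((p.eval₂ φ (⟨x, hx⟩ : 𝒪) : 𝒪) : F) := by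
    rw [aeval_def]; exact (hom_eval₂ p φ 𝒪.subtype ⟨x, hx⟩).symm
  have h1 : aeval x p ∈ 𝒪 := by rw [e1]; exact Subtype.prop _
  refine ⟨h1, ?_⟩
  rw [ValuationSubring.rs_of_mem h1, ValuationSubring.rs_of_mem hx, eval_map]
  have e2 : (⟨aeval x p, h1⟩ : 𝒪) = p.eval₂ φ ⟨x, hx⟩ := Subtype.ext e1
  rw [e2, hom_eval₂]
  rfl

theorem mem_valuationSubring_of_mem_acl_insert (hS : ∀ y ∈ acl S, y ∈ 𝒪) (hx : x ∈ 𝒪)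
    (hx' : 𝒪.rs x ∉ acl (𝒪.rs '' S)) {y : F} (hy : y ∈ acl (insert x S)) : y ∈ 𝒪 := by
  refine mem_valuationSubring_of_subfield (K := (IntermediateField.adjoin (acl S) {x}).toSubfield)
    (fun z hz => ?_) ?_ hy
  · obtain ⟨r, s, rfl⟩ := (IntermediateField.mem_adjoin_simple_iff _ _).1 hz
    obtain ⟨r1, -⟩ := aeval_mem_valuationSubring hS hx r
    obtain ⟨s1, s2⟩ := aeval_mem_valuationSubring hS hx s
    by_cases hs : s = 0
    · rw [hs, map_zero, div_zero]; exact ZeroMemClass.zero_mem _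
    · refine ValuationSubring.div_mem_of_rs r1 fun h0 => hx' ?_
      rw [s2] at h0
      refine mem_acl_of_root ((Polynomial.map_ne_zero_iff (residueHom (acl S) hS).injective).2 hs)
        (fun n => ?_) h0
      rw [coeff_map, residueHom_apply]
      exact rs_mem_acl hS (s.coeff n).2
  · refine Set.insert_subset (IntermediateField.mem_adjoin_simple_self _ _) fun z hz => ?_
    exact IntermediateField.algebraMap_mem (IntermediateField.adjoin (acl S) {x}) (⟨z, subset_acl _ hz⟩ : acl S)

omit [CharZero (IsLocalRing.ResidueField 𝒪)] in
theorem mem_acl_insert_of_mem {l : F} (h : x ∉ acl S) (h' : x ∈ acl (insert l S)) :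
    l ∈ acl (insert x S) :=
  ((AlgebraicIndependent.matroid ℚ F).mem_closure_insert h h')

/-- If a place is finite on `acl S` but not on `acl (insert l S)`, it does not enlarge the residue
field. -/
theorem rs_mem_acl_of_notMem (hS : ∀ y ∈ acl S, y ∈ 𝒪) {l y : F} (hy : y ∈ acl (insert l S))
    (hy' : y ∉ 𝒪) (hx : x ∈ acl (insert l S)) : 𝒪.ResIn (acl (𝒪.rs '' S)) x := by
  intro hxO
  by_contra h
  have h1 : x ∉ acl S := fun h1 => h (rs_mem_acl hS h1)
  have h2 := mem_acl_insert_of_mem h1 hx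
  refine hy' (mem_valuationSubring_of_mem_acl_insert hS hxO h ?_)
  refine acl_le ?_ hy
  exact Set.insert_subset h2 ((Set.subset_insert _ _).trans (subset_acl _))

end Places

section Specialize

variable {H G G₁ G₂ : GeoGraph} {μ : Finset ℕ → ℂ} {q : ℕ → Fin 3 → ℂ} {𝒪 : ValuationSubring ℂ}

theorem not_degenerate (hH : H.Tight) (hμ : H.IndepOn μ) (h𝒪 : ∀ y ∈ acl (μ '' H.E), y ∈ 𝒪)
    [CharZero (IsLocalRing.ResidueField 𝒪)] (hq : q ∈ GramRealization H μ)
    (ha : ∀ v ∈ H.V, v ≠ 1 → q v 0 ^ 2 ≠ 1) :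
    ¬ Degenerate 𝒪 (acl {𝒪.rs (μ {1, 2})}) (q 0 0) (q 0 1) := by
  have h1 : ∀ e ∈ H.E, μ e ∈ acl (μ '' H.E) := fun e he => subset_acl _ ⟨e, he, rfl⟩
  exact not_degenerate_of_independent_residues hH 𝒪 Complex.I_sq (fun e he => h𝒪 _ (h1 e he))
    (independent_residues hμ h𝒪 fun e => h1 e e.2) hq ha

open ValuationSubring in
theorem coord_mem_of_length_mem (hH : H.Tight) (hμ : H.IndepOn μ)
    (h𝒪 : ∀ y ∈ acl (μ '' H.E), y ∈ 𝒪) (hq : q ∈ GramRealization H μ)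
    (ha : ∀ v ∈ H.V, v ≠ 1 → q v 0 ^ 2 ≠ 1) (hl : q 0 0 + q 0 1 ∈ 𝒪) : q 0 1 ∈ 𝒪 := by
  have := charZero_residueField h𝒪
  by_contra ht
  have hs : q 0 0 ∉ 𝒪 := fun hs => ht (by simpa using _root_.sub_mem hl hs)
  refine not_degenerate hH hμ h𝒪 hq ha ⟨resIn_of_notMem hs, resIn_of_notMem ht, fun _ _ => ?_⟩
  have h0 := ne_zero_of_notMem ht
  have h1 : q 0 0 / q 0 1 = (q 0 0 + q 0 1) * (q 0 1)⁻¹ - 1 := by field_simp; ring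
  have h2 := MulMemClass.mul_mem hl (inv_mem_of_notMem ht)
  refine ResIn.of_rs_mem ?_
  rw [h1, rs_sub h2 (OneMemClass.one_mem _), rs_mul hl (inv_mem_of_notMem ht),
    rs_inv_of_notMem ht, rs_one, mul_zero]
  exact sub_mem (ZeroMemClass.zero_mem _) (OneMemClass.one_mem _)

theorem rs_coord_notMem (hH : H.Tight) (hμ : H.IndepOn μ)
    (h𝒪 : ∀ y ∈ acl (μ '' H.E), y ∈ 𝒪) [CharZero (IsLocalRing.ResidueField 𝒪)]
    (hq : q ∈ GramRealization H μ)
    (ha : ∀ v ∈ H.V, v ≠ 1 → q v 0 ^ 2 ≠ 1) (hs : q 0 0 ∈ 𝒪)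
    (h0 : 𝒪.rs (q 0 0) ∈ acl {𝒪.rs (μ {1, 2})}) : 𝒪.rs (q 0 1) ∉ acl {𝒪.rs (μ {1, 2})} :=
  fun h1 => not_degenerate hH hμ h𝒪 hq ha ⟨fun _ => h0, fun _ => h1, fun h _ => absurd hs h⟩

theorem IsSplit.sq_ne_one (hs : IsSplit G G₁ G₂) (h1 : G₁.Tight) (h2 : G₂.Tight)
    (hμ : G.IndepOn μ) (hq : q ∈ GramRealization G μ) {v : ℕ} (hv : v ∈ G.V) (hv1 : v ≠ 1) :
    q v 0 ^ 2 ≠ 1 := by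
  by_cases h : v = 2
  · subst h; rw [hq.2.2.1]; exact AlgebraicIndependent.sq_ne_one hμ ⟨_, hs.mem_edges h1⟩
  · exact (hs.gramFamily_independent h1 h2 hμ hq).1.sq_ne_one (some (⟨v, by simp [hv, hv1, h]⟩, 0))

theorem IsSplit.length_notMem (hs : IsSplit G G₁ G₂) (h1 : G₁.Tight) (h2 : G₂.Tight)
    (hμ : G.IndepOn μ) (hq : q ∈ GramRealization G μ) : q 0 0 + q 0 1 ∉ acl (μ '' G₁.E) := by
  intro hl
  have hV0 : 0 ∈ G₁.V := h1.sub (by simp)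
  have ht : q 0 1 ∈ acl (μ '' G₁.E) := by
    by_contra ht
    obtain ⟨𝒪, h𝒪, ht⟩ := exists_valuationSubring_notMem ht
    refine ht ?_
    have h3 := coord_mem_of_length_mem h1 (hs.indepOn_left hμ) h𝒪 (restrictVerts_mem hs h1 hq)
      (fun v hv hv1 => by
        rw [restrictVerts_of_mem hv]; exact hs.sq_ne_one h1 h2 hμ hq (hs.verts_left hv) hv1)
    rw [restrictVerts_of_mem hV0] at h3
    exact h3 (h𝒪 _ hl)
  refine hs.notMem_of_mem h1 h2 hμ hq ?_ ht
  simpa using sub_mem hl ht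

theorem IsSplit.restrictVerts_mem_gramFiber (hs : IsSplit G G₁ G₂) (h1 : G₁.Tight)
    (hq : q ∈ GramRealization G μ) : restrictVerts G₁ q ∈ GramFiber G₁ μ (q 0 0 + q 0 1) :=
  ⟨restrictVerts_mem hs h1 hq, by rw [restrictVerts_of_mem (h1.sub (by simp))]⟩

end Specialize

section FiberPoly

variable {F F' : Type*} [Field F] [Field F'] {H : GeoGraph} {μ μ' : Finset ℕ → F} {l : F}

theorem gramRealization_congr (hH : H.Tight) (h : ∀ e ∈ H.E, μ e = μ' e) :
    GramRealization H μ = GramRealization H μ' := by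
  have key : ∀ {μ μ' : Finset ℕ → F}, (∀ e ∈ H.E, μ e = μ' e) →
      GramRealization H μ ⊆ GramRealization H μ' := by
    rintro μ μ' h q ⟨h0, h1, h2, h3, h4⟩
    have h12 := h _ hH.mem
    exact ⟨h0, by rw [h1, h12], by rw [h2, h12], fun v hv => by rw [← h12, h3 v hv],
      fun u v he => by rw [← h12, h4 u v he, h _ he]⟩
  exact (key h).antisymm (key fun e he => (h e he).symm)

theorem gramFiber_congr (hH : H.Tight) (h : ∀ e ∈ H.E, μ e = μ' e) :
    GramFiber H μ l = GramFiber H μ' l := by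
  rw [GramFiber, GramFiber, gramRealization_congr hH h]

/-- The polynomial whose roots are the second coordinates at the vertex `0` of the realizations in
a fiber. -/
noncomputable def fiberPoly (H : GeoGraph) (μ : Finset ℕ → F) (l : F) : F[X] :=
  ∏ᶠ z ∈ GramFiber H μ l, (X - C (z 0 1))

theorem fiberPoly_congr (hH : H.Tight) (h : ∀ e ∈ H.E, μ e = μ' e) :
    fiberPoly H μ l = fiberPoly H μ' l := by
  rw [fiberPoly, fiberPoly, gramFiber_congr hH h]

theorem fiberPoly_eq_prod (hfin : (GramFiber H μ l).Finite) :
    fiberPoly H μ l = ∏ z ∈ hfin.toFinset, (X - C (z 0 1)) :=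
  finprod_mem_eq_finite_toFinset_prod _ hfin

theorem fiberPoly_monic (hfin : (GramFiber H μ l).Finite) : (fiberPoly H μ l).Monic := by
  rw [fiberPoly_eq_prod hfin]; exact monic_prod_of_monic _ _ fun z _ => monic_X_sub_C _

theorem fiberPoly_natDegree (hfin : (GramFiber H μ l).Finite) :
    (fiberPoly H μ l).natDegree = (GramFiber H μ l).ncard := by
  rw [fiberPoly_eq_prod hfin, natDegree_finsetProd_X_sub_C_eq_card, Set.ncard_eq_toFinset_card _ hfin]

theorem gramFiber_map_bijOn (σ : F →+* F')
    (h : ∀ z ∈ GramFiber H (fun e => σ (μ e)) (σ l), ∀ v j, z v j ∈ σ.range) :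
    Set.BijOn (fun (q : ℕ → Fin 3 → F) v j => σ (q v j)) (GramFiber H μ l)
      (GramFiber H (fun e => σ (μ e)) (σ l)) := by
  refine ⟨fun q hq => gramFiber_map σ hq, fun q _ q' _ hqq => ?_, fun z hz => ?_⟩
  · funext v j; exact σ.injective (congrFun (congrFun hqq v) j)
  · choose q hq using h z hz
    have hqz : (fun v j => σ (q v j)) = z := by funext v j; exact hq v j
    refine ⟨q, ?_, hqz⟩
    obtain ⟨⟨h0, h1, h2, h3, h4⟩, h5⟩ := hz
    have key : ∀ u v, gramForm (σ (μ {1, 2})) (z u) (z v) =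
        σ (gramForm (μ {1, 2}) (q u) (q v)) := by
      intro u v; simp [gramForm, ← hq]
    refine ⟨⟨fun v hv => ?_, ?_, ?_, fun v hv => σ.injective ?_, fun u v he => σ.injective ?_⟩,
      σ.injective ?_⟩
    · funext j; apply σ.injective; rw [hq, h0 v hv]; simp
    · funext j; apply σ.injective; rw [hq, h1]; fin_cases j <;> simp
    · funext j; apply σ.injective; rw [hq, h2]; fin_cases j <;> simp
    · rw [← key, h3 v hv]; simp
    · rw [← key, h4 u v he]; simp
    · rw [map_add, hq, hq, h5]

theorem fiberPoly_map (σ : F →+* F') (hfin : (GramFiber H μ l).Finite)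
    (h : ∀ z ∈ GramFiber H (fun e => σ (μ e)) (σ l), ∀ v j, z v j ∈ σ.range) :
    (fiberPoly H μ l).map σ = fiberPoly H (fun e => σ (μ e)) (σ l) := by
  rw [fiberPoly_eq_prod hfin, Polynomial.map_prod]
  refine (finprod_mem_eq_finite_toFinset_prod _ hfin).symm.trans ?_
  exact finprod_mem_eq_of_bijOn _ (gramFiber_map_bijOn σ h) fun z _ => by simp

end FiberPoly

theorem exists_notMem_acl {H : GeoGraph} {μ : Finset ℕ → ℂ} (hμ : H.IndepOn μ) :
    ∃ l, l ∉ acl (μ '' H.E) := by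
  obtain ⟨f, hf⟩ := exists_algebraicIndependent_complex (Option H.E)
  have h1 : AlgebraicIndependent ℚ (fun e : H.E => f (some e)) :=
    hf.comp some (Option.some_injective _)
  obtain ⟨σ, hσ⟩ := exists_ringEquiv_of_algebraicIndependent h1 hμ
  have h2 : f none ∉ acl (Set.range fun e : H.E => f (some e)) := by
    have hf' : (fun o : Option H.E => o.elim (f none) fun e => f (some e)) = f := by
      funext o; cases o <;> rfl
    exact AlgebraicIndependent.notMem_acl_of_option (by rw [hf']; exact hf)
  refine ⟨σ (f none), fun h => h2 ?_⟩
  rw [← acl_image_ringEquiv σ, ← Set.range_comp]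
  convert h using 2
  rw [← range_edges]
  congr 1
  funext e
  exact hσ e

section Curve

variable {H : GeoGraph} {μ : Finset ℕ → ℂ} {l : ℂ}

open IntermediateField in
theorem fiberPoly_coeff_mem (hH : H.Tight) (hμ : H.IndepOn μ) (hl : l ∉ acl (μ '' H.E)) (n : ℕ) :
    (fiberPoly H μ l).coeff n ∈ adjoin (adjoin ℚ (μ '' H.E)) {l} := by
  classical
  set k := adjoin ℚ (μ '' (H.E : Set (Finset ℕ)))
  set L := adjoin k {l}
  set M := algebraicClosure L ℂ
  have hμk : ∀ e ∈ H.E, μ e ∈ k := fun e he => subset_adjoin _ _ ⟨e, he, rfl⟩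
  have hkL : ∀ x ∈ k, x ∈ L := fun x hx => L.algebraMap_mem ⟨x, hx⟩
  have hLM : ∀ x ∈ L, x ∈ M := fun x hx => M.algebraMap_mem ⟨x, hx⟩
  have hlL : l ∈ L := mem_adjoin_simple_self _ _
  let μM : Finset ℕ → M := fun e => if h : e ∈ H.E then ⟨μ e, hLM _ (hkL _ (hμk e h))⟩ else 0
  let lM : M := ⟨l, hLM _ hlL⟩
  let ι : M →+* ℂ := algebraMap M ℂ
  have hιμ : ∀ e ∈ H.E, ι (μM e) = μ e := fun e he => by simp only [μM, dif_pos he]; rfl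
  have hιl : ι lM = l := rfl
  have hfib : GramFiber H (fun e => ι (μM e)) (ι lM) = GramFiber H μ l := gramFiber_congr hH hιμ
  have hM : ∀ z ∈ GramFiber H (fun e => ι (μM e)) (ι lM), ∀ v j, z v j ∈ ι.range := by
    intro z hz v j
    rw [hfib] at hz
    have h1 := GramFiber.coord_mem_acl hH hμ hl hz v j
    have h2 : IsAlgebraic L (z v j) := isAlgebraic_of_mem_acl (K := L.toSubfield) (by
      rintro x (rfl | ⟨e, he, rfl⟩)
      · exact hlL
      · exact hkL _ (hμk e he)) h1
    exact ⟨⟨z v j, mem_algebraicClosure_iff.2 h2⟩, rfl⟩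
  have hfinM : (GramFiber H μM lM).Finite := by
    refine Set.Finite.of_finite_image (f := fun q v j => ι (q v j)) ?_
      (gramFiber_map_bijOn ι hM).injOn
    rw [(gramFiber_map_bijOn ι hM).image_eq, hfib]
    exact gramFiber_finite hH hμ hl
  have e1 : (fiberPoly H μM lM).map ι = fiberPoly H μ l := by
    rw [fiberPoly_map ι hfinM hM, hιl, fiberPoly_congr hH hιμ]
  have e2 : ∀ σ : M ≃ₐ[L] M, (fiberPoly H μM lM).map (σ : M →+* M) = fiberPoly H μM lM := by
    intro σ
    have h1 : ∀ e, (σ : M →+* M) (μM e) = μM e := by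
      intro e
      simp only [μM]
      split_ifs with he
      · exact σ.commutes (⟨μ e, hkL _ (hμk e he)⟩ : L)
      · simp
    have h2 : (σ : M →+* M) lM = lM := σ.commutes (⟨l, hlL⟩ : L)
    have h3 := fiberPoly_map (σ : M →+* M) hfinM fun z _ v j => ⟨σ.symm (z v j), by simp⟩
    simp only [h1, h2] at h3
    exact h3
  have : IsGalois L M := inferInstance
  have h4 : (fiberPoly H μM lM).coeff n ∈ Set.range (algebraMap L M) := by
    rw [InfiniteGalois.mem_range_algebraMap_iff_fixed]
    intro σ
    conv_rhs => rw [← e2 σ]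
    rw [coeff_map]; rfl
  obtain ⟨y, hy⟩ := h4
  rw [← e1, coeff_map, ← hy]
  exact y.2

end Curve

section Integral

variable {K E : Type*} [Field K] [Field E] [Algebra K E]

open IntermediateField.algebraAdjoinAdjoin in
/-- Elements of a simple transcendental extension that are integral over the polynomials in the
generator are polynomials in the generator. -/
theorem mem_adjoin_of_isIntegral {l x : E} (hl : Transcendental K l)
    (hx : x ∈ IntermediateField.adjoin K {l})
    (hint : IsIntegral (Algebra.adjoin K {l}) x) : ∃ p : K[X], aeval l p = x := by
  let e : K[X] ≃ₐ[K] Algebra.adjoin K {l} := Polynomial.algEquivOfTranscendental K l hl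
  have : IsIntegrallyClosed (Algebra.adjoin K {l}) := IsIntegrallyClosed.of_equiv e.toRingEquiv
  have h1 : IsIntegral (Algebra.adjoin K {l}) (⟨x, hx⟩ : IntermediateField.adjoin K {l}) := by
    obtain ⟨p, hp, hpx⟩ := hint
    refine ⟨p, hp, Subtype.ext ?_⟩
    rw [← aeval_def] at hpx ⊢
    rw [ZeroMemClass.coe_zero, ← hpx]
    exact (aeval_algebraMap_apply E (⟨x, hx⟩ : IntermediateField.adjoin K {l}) p).symm
  obtain ⟨y, hy⟩ := IsIntegrallyClosed.isIntegral_iff.1 h1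
  have h2 : (y : E) = x := congrArg Subtype.val hy
  have h3 : x ∈ Algebra.adjoin K {l} := h2 ▸ y.2
  rw [Algebra.adjoin_singleton_eq_range_aeval] at h3
  obtain ⟨p, hp⟩ := h3
  exact ⟨p, hp⟩

end Integral

section Curve

variable {H : GeoGraph} {μ : Finset ℕ → ℂ} {l : ℂ}

open IntermediateField in
theorem fiberPoly_coeff_eq_aeval (hH : H.Tight) (hμ : H.IndepOn μ) (hl : l ∉ acl (μ '' H.E)) (n : ℕ) :
    ∃ p : (adjoin ℚ (μ '' H.E))[X], aeval l p = (fiberPoly H μ l).coeff n := by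
  set k := adjoin ℚ (μ '' (H.E : Set (Finset ℕ)))
  have hk : ∀ x ∈ k, x ∈ acl (μ '' H.E) := fun x hx => adjoin_le_acl _ hx
  have htr : Transcendental k l := by
    intro h
    obtain ⟨p, hp, hpx⟩ := h
    refine hl (mem_acl_of_root (p := p.map (algebraMap k ℂ))
      ((Polynomial.map_ne_zero_iff (algebraMap k ℂ).injective).2 hp) (fun n => ?_) ?_)
    · rw [coeff_map]; exact hk _ (p.coeff n).2
    · rw [eval_map]; exact hpx
  refine mem_adjoin_of_isIntegral htr (fiberPoly_coeff_mem hH hμ hl n) ?_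
  have h1 : IsIntegral (Subring.closure (Algebra.adjoin k {l} : Set ℂ))
      ((fiberPoly H μ l).coeff n) := by
    refine isIntegral_of_forall_valuationSubring fun 𝒪 h𝒪 => ?_
    have hl𝒪 : l ∈ 𝒪 := h𝒪 (Algebra.subset_adjoin rfl)
    have hk𝒪 : ∀ y ∈ k.toSubfield, y ∈ 𝒪 :=
      fun y hy => h𝒪 ((Algebra.adjoin k {l}).algebraMap_mem (⟨y, hy⟩ : k))
    have hacl : ∀ y ∈ acl (μ '' H.E), y ∈ 𝒪 := fun y hy =>
      mem_valuationSubring_of_subfield hk𝒪 (subset_adjoin ℚ _) hy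
    have ht : ∀ z ∈ GramFiber H μ l, z 0 1 ∈ 𝒪 := fun z hz =>
      coord_mem_of_length_mem hH hμ hacl hz.1 (fun v hv hv1 => GramFiber.sq_ne_one hH hμ hl hz hv hv1)
        (by rw [hz.2]; exact hl𝒪)
    have hlift : fiberPoly H μ l ∈ Polynomial.lifts 𝒪.subtype := by
      rw [fiberPoly_eq_prod (gramFiber_finite hH hμ hl)]
      refine prod_mem fun z hz => ?_
      have hz' := ht z ((gramFiber_finite hH hμ hl).mem_toFinset.1 hz)
      exact ⟨X - C ⟨_, hz'⟩, by simp⟩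
    obtain ⟨p, hp⟩ := hlift
    rw [← hp]
    simp
  have h2 : Subring.closure (Algebra.adjoin k {l} : Set ℂ) ≤ (Algebra.adjoin k {l}).toSubring :=
    Subring.closure_le.2 subset_rfl
  obtain ⟨p, hp, hpx⟩ := h1
  refine ⟨p.map (Subring.inclusion h2), hp.map _, ?_⟩
  rw [eval₂_map]
  exact hpx

/-- The fibres of the projection of the configuration curve to the `l`-line are cut out by a monic
polynomial. -/
theorem exists_curve (hH : H.Tight) (hμ : H.IndepOn μ) :
    ∃ P : ℂ[X][X], P.Monic ∧ (∀ i j, (P.coeff i).coeff j ∈ IntermediateField.adjoin ℚ (μ '' H.E)) ∧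
      ∀ l ∉ acl (μ '' H.E), P.map (evalRingHom l) = fiberPoly H μ l := by
  obtain ⟨l, hl⟩ := exists_notMem_acl hμ
  set k := IntermediateField.adjoin ℚ (μ '' (H.E : Set (Finset ℕ)))
  have hlift : fiberPoly H μ l ∈ Polynomial.lifts (aeval (R := k) l).toRingHom := by
    rw [Polynomial.lifts_iff_coeff_lifts]
    exact fun n => fiberPoly_coeff_eq_aeval hH hμ hl n
  obtain ⟨P₀, hP₀, -, hm⟩ := Polynomial.lifts_and_natDegree_eq_and_monic hlift
    (fiberPoly_monic (gramFiber_finite hH hμ hl))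
  have hPl : (P₀.map (mapRingHom (algebraMap k ℂ))).map (evalRingHom l) = fiberPoly H μ l := by
    rw [← hP₀, Polynomial.map_map]
    congr 1
    refine RingHom.ext fun p => ?_
    simp [aeval_def, eval_map]
  refine ⟨P₀.map (mapRingHom (algebraMap k ℂ)), hm.map _, fun i j => ?_, fun l' hl' => ?_⟩
  · simp only [coeff_map, coe_mapRingHom]
    exact ((P₀.coeff i).coeff j).2
  · obtain ⟨σ, hσ⟩ := exists_ringEquiv_of_algebraicIndependent (hμ.option hl) (hμ.option hl')
    have hσl : σ l = l' := hσ none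
    have hσμ : ∀ e ∈ H.E, σ (μ e) = μ e := fun e he => hσ (some ⟨e, he⟩)
    have hσk : ∀ y : k, σ (algebraMap k ℂ y) = algebraMap k ℂ y := by
      have : k ≤ (RingHom.eqLocusField (σ : ℂ →+* ℂ) (RingHom.id ℂ)).toIntermediateField (K := ℚ)
          (fun x => by simp) := by
        rw [IntermediateField.adjoin_le_iff]
        rintro _ ⟨e, he, rfl⟩
        exact hσμ e he
      exact fun y => this y.2
    have h1 := fiberPoly_map (σ : ℂ →+* ℂ) (gramFiber_finite hH hμ hl)
      fun z _ v j => ⟨σ.symm (z v j), by simp⟩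
    rw [show (σ : ℂ →+* ℂ) l = l' from hσl, fiberPoly_congr (μ := fun e => (σ : ℂ →+* ℂ) (μ e)) (μ' := μ) hH hσμ] at h1
    rw [← h1, ← hPl, Polynomial.map_map, Polynomial.map_map, Polynomial.map_map]
    congr 1
    refine RingHom.ext fun p => ?_
    simp only [RingHom.comp_apply, coe_mapRingHom, coe_evalRingHom]
    rw [← hσl, eval_map, eval_map, hom_eval₂]
    congr 1
    exact (RingHom.ext hσk).symm

end Curve

section Curve

variable {H : GeoGraph} {μ μ' : Finset ℕ → ℂ} {P : ℂ[X][X]}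

/-- `P` is a monic equation of the plane curve formed by the pairs `(a₀ + b₀, b₀)`, where `a₀` and
`b₀` are the coordinates at the vertex `0` of a realization. -/
structure IsCurve (H : GeoGraph) (μ : Finset ℕ → ℂ) (P : ℂ[X][X]) : Prop where
  monic : P.Monic
  coeff_mem : ∀ i j, (P.coeff i).coeff j ∈ acl (μ '' H.E)
  map_eval : ∀ l ∉ acl (μ '' H.E), P.map (evalRingHom l) = fiberPoly H μ l

theorem exists_isCurve (hH : H.Tight) (hμ : H.IndepOn μ) : ∃ P, IsCurve H μ P := by
  obtain ⟨P, h1, h2, h3⟩ := exists_curve hH hμ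
  exact ⟨P, h1, fun i j => adjoin_le_acl _ (h2 i j), h3⟩

theorem IsCurve.map_ringEquiv (hH : H.Tight) (hμ : H.IndepOn μ) (hP : IsCurve H μ P) (σ : ℂ ≃+* ℂ)
    (hσ : ∀ e ∈ H.E, σ (μ e) = μ' e) : IsCurve H μ' (P.map (mapRingHom (σ : ℂ →+* ℂ))) := by
  have himg : μ' '' H.E = σ '' (μ '' H.E) := by
    rw [Set.image_image]
    exact Set.image_congr fun e he => (hσ e he).symm
  refine ⟨hP.monic.map _, fun i j => ?_, fun l' hl' => ?_⟩
  · rw [himg, coeff_map, coe_mapRingHom, coeff_map]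
    exact (acl_image_ringEquiv σ _ _).2 (hP.coeff_mem i j)
  · obtain ⟨l, rfl⟩ := σ.surjective l'
    rw [himg, acl_image_ringEquiv] at hl'
    have h1 := fiberPoly_map (σ : ℂ →+* ℂ) (gramFiber_finite hH hμ hl')
      fun z _ v j => ⟨σ.symm (z v j), by simp⟩
    have h2 : fiberPoly H (fun e => (σ : ℂ →+* ℂ) (μ e)) (σ l) = fiberPoly H μ' (σ l) :=
      fiberPoly_congr hH hσ
    rw [← h2]
    refine Eq.trans ?_ h1
    rw [← hP.map_eval l hl', Polynomial.map_map, Polynomial.map_map]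
    congr 1
    refine RingHom.ext fun p => ?_
    simp only [RingHom.comp_apply, coe_mapRingHom, coe_evalRingHom, eval_map]
    exact ((eval₂_at_apply (σ : ℂ →+* ℂ) l).trans rfl)

theorem IsCurve.eval_eq (hH : H.Tight) (hμ : H.IndepOn μ) (hP : IsCurve H μ P) {l : ℂ}
    (hl : l ∉ acl (μ '' H.E)) : P.map (evalRingHom l) =
      ∏ z ∈ (gramFiber_finite hH hμ hl).toFinset, (X - C (z 0 1)) := by
  rw [hP.map_eval l hl, fiberPoly_eq_prod]

theorem IsCurve.natDegree_eq (hH : H.Tight) (hμ : H.IndepOn μ) (hP : IsCurve H μ P) {l : ℂ}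
    (hl : l ∉ acl (μ '' H.E)) : P.natDegree = (GramFiber H μ l).ncard := by
  rw [← hP.monic.natDegree_map (evalRingHom l), hP.map_eval l hl,
    fiberPoly_natDegree (gramFiber_finite hH hμ hl)]

end Curve

namespace ValuationSubring

variable {F : Type*} [Field F] {𝒪 : ValuationSubring F} {l t t' : F}

theorem rs_div_of_notMem (hl : l ∉ 𝒪) (ht : t ∈ 𝒪) : 𝒪.rs (t / l) = 0 := by
  rw [div_eq_mul_inv, rs_mul ht (inv_mem_of_notMem hl), rs_inv_of_notMem hl, mul_zero]

theorem rs_prod {ι : Type*} (s : Finset ι) {f : ι → F} (hf : ∀ i ∈ s, f i ∈ 𝒪) :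
    𝒪.rs (∏ i ∈ s, f i) = ∏ i ∈ s, 𝒪.rs (f i) := by
  classical
  induction s using Finset.induction_on with
  | empty => simp
  | insert a s ha ih =>
    have h1 : ∀ i ∈ s, f i ∈ 𝒪 := fun i hi => hf i (Finset.mem_insert_of_mem hi)
    rw [Finset.prod_insert ha, Finset.prod_insert ha,
      rs_mul (hf a (Finset.mem_insert_self a s)) (prod_mem h1), ih h1]

/-- The degree of a polynomial with constant coefficients is its order of growth at a place at
infinity. -/
theorem natDegree_eq_of_rs_ne_zero {K : Subfield F} (hK : ∀ y ∈ K, y ∈ 𝒪) (hl : l ∉ 𝒪) {p : F[X]}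
    (hp : ∀ n, p.coeff n ∈ K) {m : ℕ} (h : 𝒪.rs (p.eval l / l ^ m) ≠ 0) : p.natDegree = m := by
  have hl0 := ne_zero_of_notMem hl
  have hp0 : p ≠ 0 := by rintro rfl; simp at h
  have hlc : p.leadingCoeff ∈ 𝒪 := hK _ (hp _)
  have hlead : 𝒪.rs p.leadingCoeff ≠ 0 := by
    intro h0
    have h1 : p.leadingCoeff ≠ 0 := leadingCoeff_ne_zero.2 hp0
    exact inv_notMem h0 (hK _ (hp _)) h1 (hK _ (InvMemClass.inv_mem (hp _)))
  have key : 𝒪.rs (p.eval l / l ^ p.natDegree) ≠ 0 := by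
    have : Invertible l := invertibleOfNonzero hl0
    have h1 : p.eval l / l ^ p.natDegree = p.reverse.divX.eval l⁻¹ * l⁻¹ + p.leadingCoeff := by
      have h2 := eval₂_reverse_mul_pow (RingHom.id F) l p
      rw [eval₂_id, eval₂_id, invOf_eq_inv] at h2
      rw [div_eq_iff (pow_ne_zero _ hl0), ← h2]
      congr 1
      conv_lhs => rw [← divX_mul_X_add p.reverse]
      rw [eval_add, eval_mul, eval_X, eval_C, coeff_zero_reverse]
    have hli := inv_mem_of_notMem hl
    have h2 : p.reverse.divX.eval l⁻¹ ∈ 𝒪 := by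
      rw [eval_eq_sum_range]
      refine sum_mem fun i _ => MulMemClass.mul_mem ?_ (pow_mem hli _)
      rw [coeff_divX, coeff_reverse]
      exact hK _ (hp _)
    rw [h1, rs_add (MulMemClass.mul_mem h2 hli) hlc, rs_mul h2 hli, rs_inv_of_notMem hl,
      mul_zero, zero_add]
    exact hlead
  by_contra hne
  rcases lt_or_gt_of_ne hne with h1 | h1
  · refine h ?_
    obtain ⟨k, rfl⟩ := Nat.exists_eq_add_of_lt h1
    have : p.eval l / l ^ (p.natDegree + k + 1) = p.eval l / l ^ p.natDegree * (l⁻¹) ^ k * l⁻¹ := by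
      rw [inv_pow, pow_succ, pow_add]; field_simp
    rw [this, rs_mul (MulMemClass.mul_mem (mem_of_rs_ne_zero key) (pow_mem (inv_mem_of_notMem hl) _))
      (inv_mem_of_notMem hl), rs_inv_of_notMem hl, mul_zero]
  · refine key ?_
    obtain ⟨k, hk⟩ := Nat.exists_eq_add_of_lt h1
    have : p.eval l / l ^ p.natDegree = p.eval l / l ^ m * (l⁻¹) ^ k * l⁻¹ := by
      rw [hk, inv_pow, pow_succ, pow_add]; field_simp
    rw [this, rs_mul (MulMemClass.mul_mem (mem_of_rs_ne_zero h) (pow_mem (inv_mem_of_notMem hl) _))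
      (inv_mem_of_notMem hl), rs_inv_of_notMem hl, mul_zero]

/-- The possible behaviours of a coordinate `t` at a place at infinity, given the length `l`. -/
def TypeAtInfinity (𝒪 : ValuationSubring F) (K₀ K : Subfield (IsLocalRing.ResidueField 𝒪))
    (l t : F) : Prop :=
  (𝒪.rs t ∈ K ∧ 𝒪.rs t ∉ K₀) ∨ (𝒪.rs (l - t) ∈ K ∧ 𝒪.rs (l - t) ∉ K₀) ∨
    (𝒪.rs (t / l) ∈ K ∧ 𝒪.rs (t / l) ∉ K₀)

variable {K₀ K K' : Subfield (IsLocalRing.ResidueField 𝒪)}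

theorem ne_zero_of_notMem_subfield {x : IsLocalRing.ResidueField 𝒪} (h : x ∉ K₀) : x ≠ 0 := by
  rintro rfl; exact h (ZeroMemClass.zero_mem _)

theorem ne_one_of_notMem_subfield {x : IsLocalRing.ResidueField 𝒪} (h : x ∉ K₀) : x ≠ 1 := by
  rintro rfl; exact h (OneMemClass.one_mem _)

open scoped Classical in
theorem TypeAtInfinity.rs_coord_ne_zero (hl : l ∉ 𝒪) (h : 𝒪.TypeAtInfinity K₀ K l t) :
    𝒪.rs (t / l ^ (if t ∈ 𝒪 then 0 else 1)) ≠ 0 := by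
  have hl0 := ne_zero_of_notMem hl
  rcases h with h | h | h
  · have h0 := ne_zero_of_notMem_subfield h.2
    rw [if_pos (mem_of_rs_ne_zero h0)]; simpa using h0
  · have h0 := ne_zero_of_notMem_subfield h.2
    have h1 : t ∉ 𝒪 := fun h1 => hl (by simpa using AddMemClass.add_mem (mem_of_rs_ne_zero h0) h1)
    rw [if_neg h1, pow_one]
    have h2 : t / l = 1 - (l - t) / l := by field_simp; ring
    rw [h2, rs_sub (OneMemClass.one_mem _) (by
      rw [div_eq_mul_inv]; exact MulMemClass.mul_mem (mem_of_rs_ne_zero h0) (inv_mem_of_notMem hl)),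
      rs_div_of_notMem hl (mem_of_rs_ne_zero h0), rs_one, sub_zero]
    exact one_ne_zero
  · have h0 := ne_zero_of_notMem_subfield h.2
    rw [if_neg fun ht => h0 (rs_div_of_notMem hl ht), pow_one]
    exact h0

theorem TypeAtInfinity.symm (hl : l ∉ 𝒪) (h : 𝒪.TypeAtInfinity K₀ K l t) :
    𝒪.TypeAtInfinity K₀ K l (l - t) := by
  have hl0 := ne_zero_of_notMem hl
  rcases h with h | h | h
  · right; left; rwa [sub_sub_cancel]
  · left; exact h
  · right; right
    have h1 : (l - t) / l = 1 - t / l := by field_simp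
    rw [h1, rs_sub (OneMemClass.one_mem _) (mem_of_rs_ne_zero (ne_zero_of_notMem_subfield h.2)), rs_one]
    exact ⟨_root_.sub_mem (OneMemClass.one_mem _) h.1, fun h2 => h.2 (by
      simpa using _root_.sub_mem (OneMemClass.one_mem K₀) h2)⟩

open scoped Classical in
theorem TypeAtInfinity.rs_sub_ne_zero (hl : l ∉ 𝒪) (hK : ∀ x, x ∈ K → x ∈ K' → x ∈ K₀)
    (h : 𝒪.TypeAtInfinity K₀ K l t) (h' : 𝒪.TypeAtInfinity K₀ K' l t') :
    𝒪.rs ((t - t') / l ^ (if t ∈ 𝒪 ∧ t' ∈ 𝒪 ∨ l - t ∈ 𝒪 ∧ l - t' ∈ 𝒪 then 0 else 1)) ≠ 0 := by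
  have hl0 := ne_zero_of_notMem hl
  have hli := inv_mem_of_notMem hl
  have hexcl : ∀ {t}, t ∈ 𝒪 → l - t ∉ 𝒪 := fun h1 h2 => hl (by
    simpa using AddMemClass.add_mem h2 h1)
  have hA : ∀ {K t}, 𝒪.TypeAtInfinity K₀ K l t → t ∈ 𝒪 → 𝒪.rs t ∈ K ∧ 𝒪.rs t ∉ K₀ := by
    rintro K t (h | h | h) ht
    · exact h
    · exact absurd (mem_of_rs_ne_zero (ne_zero_of_notMem_subfield h.2)) (hexcl ht)
    · exact absurd (rs_div_of_notMem hl ht) (ne_zero_of_notMem_subfield h.2)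
  have hAA : ∀ {K K' t t'}, (∀ x, x ∈ K → x ∈ K' → x ∈ K₀) → 𝒪.TypeAtInfinity K₀ K l t →
      𝒪.TypeAtInfinity K₀ K' l t' → t ∈ 𝒪 → t' ∈ 𝒪 → 𝒪.rs (t - t') ≠ 0 := by
    intro K K' t t' hK h h' ht ht' h0
    rw [rs_sub ht ht', sub_eq_zero] at h0
    exact (hA h ht).2 (hK _ (hA h ht).1 (h0 ▸ (hA h' ht').1))
  -- the limit of `t / l` and its relation to the types
  have hlim : ∀ {K t}, 𝒪.TypeAtInfinity K₀ K l t → t / l ∈ 𝒪 ∧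
      (t ∈ 𝒪 ∧ 𝒪.rs (t / l) = 0 ∨ l - t ∈ 𝒪 ∧ 𝒪.rs (t / l) = 1 ∨
        𝒪.rs (t / l) ∈ K ∧ 𝒪.rs (t / l) ∉ K₀) := by
    rintro K t (h | h | h)
    · have ht := mem_of_rs_ne_zero (ne_zero_of_notMem_subfield h.2)
      refine ⟨?_, Or.inl ⟨ht, rs_div_of_notMem hl ht⟩⟩
      rw [div_eq_mul_inv]; exact MulMemClass.mul_mem ht hli
    · have ht := mem_of_rs_ne_zero (ne_zero_of_notMem_subfield h.2)
      have h2 : t / l = 1 - (l - t) / l := by field_simp; ring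
      have h3 : (l - t) / l ∈ 𝒪 := by rw [div_eq_mul_inv]; exact MulMemClass.mul_mem ht hli
      rw [h2]
      exact ⟨_root_.sub_mem (OneMemClass.one_mem _) h3, Or.inr (Or.inl ⟨ht, by
        rw [rs_sub (OneMemClass.one_mem _) h3, rs_div_of_notMem hl ht, rs_one, sub_zero]⟩)⟩
    · exact ⟨mem_of_rs_ne_zero (ne_zero_of_notMem_subfield h.2), Or.inr (Or.inr h)⟩
  split_ifs with hc
  · rw [pow_zero, div_one]
    rcases hc with ⟨h1, h2⟩ | ⟨h1, h2⟩
    · exact hAA hK h h' h1 h2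
    · have := hAA (fun x hx hx' => hK x hx' hx) (h'.symm hl) (h.symm hl) h2 h1
      rwa [sub_sub_sub_cancel_left] at this
  · obtain ⟨m1, h1⟩ := hlim h
    obtain ⟨m2, h2⟩ := hlim h'
    rw [pow_one, sub_div, rs_sub m1 m2, sub_ne_zero]
    push Not at hc
    rcases h1 with ⟨h1, e1⟩ | ⟨h1, e1⟩ | ⟨h1, e1⟩ <;> rcases h2 with ⟨h2, e2⟩ | ⟨h2, e2⟩ | ⟨h2, e2⟩
    · exact absurd h2 (hc.1 h1)
    · rw [e1, e2]; exact zero_ne_one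
    · rw [e1]; exact (ne_zero_of_notMem_subfield e2).symm
    · rw [e1, e2]; exact one_ne_zero
    · exact absurd h2 (hc.2 h1)
    · rw [e1]; exact (ne_one_of_notMem_subfield e2).symm
    · rw [e2]; exact ne_zero_of_notMem_subfield e1
    · rw [e2]; exact ne_one_of_notMem_subfield e1
    · exact fun e => e1 (hK _ h1 (e ▸ h2))

end ValuationSubring

theorem Polynomial.resultant_prod_X_sub_C {R ι κ : Type*} [CommRing R] [Nontrivial R]
    (s : Finset ι) (t : Finset κ) (a : ι → R) (b : κ → R) :
    resultant (∏ i ∈ s, (X - C (a i))) (∏ j ∈ t, (X - C (b j))) =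
      ∏ i ∈ s, ∏ j ∈ t, (a i - b j) := by
  rw [resultant_prod_left _ _ _ _ (by simp) le_rfl]
  refine Finset.prod_congr rfl fun i _ => ?_
  rw [natDegree_X_sub_C, resultant_X_sub_C_left _ _ _ le_rfl, eval_prod]
  simp

theorem Polynomial.mem_lifts_mapRingHom {k : Type*} [Field k] {K : Subfield k} {P : k[X][X]}
    (h : ∀ i j, (P.coeff i).coeff j ∈ K) : ∃ Q : K[X][X], Q.map (mapRingHom K.subtype) = P := by
  have : P ∈ lifts (mapRingHom K.subtype) := by
    rw [lifts_iff_coeff_lifts]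
    intro i
    have : P.coeff i ∈ lifts K.subtype := by
      rw [lifts_iff_coeff_lifts]
      exact fun j => ⟨⟨_, h i j⟩, rfl⟩
    exact this
  exact this

theorem Polynomial.coeff_resultant_mem {k : Type*} [Field k] {K : Subfield k} {P Q : k[X][X]}
    (hP : ∀ i j, (P.coeff i).coeff j ∈ K) (hQ : ∀ i j, (Q.coeff i).coeff j ∈ K) (m n i : ℕ) :
    (resultant P Q m n).coeff i ∈ K := by
  obtain ⟨P, rfl⟩ := mem_lifts_mapRingHom hP
  obtain ⟨Q, rfl⟩ := mem_lifts_mapRingHom hQ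
  rw [resultant_map_map, coe_mapRingHom, coeff_map]
  exact ((resultant P Q m n).coeff i).2

theorem Polynomial.coeff_eval_mem {k : Type*} [Field k] {K : Subfield k} {P : k[X][X]} {x : k[X]}
    (hP : ∀ i j, (P.coeff i).coeff j ∈ K) (hx : ∀ i, x.coeff i ∈ K) (i : ℕ) :
    (P.eval x).coeff i ∈ K := by
  obtain ⟨P, rfl⟩ := mem_lifts_mapRingHom hP
  have hx' : x ∈ lifts K.subtype := by
    rw [lifts_iff_coeff_lifts]
    exact fun j => ⟨⟨_, hx j⟩, rfl⟩
  obtain ⟨x, rfl⟩ := hx'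
  rw [eval_map, eval₂_at_apply, coe_mapRingHom, coeff_map]
  exact ((P.eval x).coeff i).2

theorem Polynomial.eval_eval_eq {k : Type*} [CommRing k] (P : k[X][X]) (x : k[X]) (l : k) :
    (P.eval x).eval l = (P.map (evalRingHom l)).eval (x.eval l) := by
  rw [eval_map]
  exact (eval₂_at_apply (evalRingHom l) x).symm

section Infinity

variable {H : GeoGraph} {μ : Finset ℕ → ℂ} {P : ℂ[X][X]} {𝒪 : ValuationSubring ℂ} {l : ℂ}
  {z : ℕ → Fin 3 → ℂ}

open ValuationSubring in
theorem GramFiber.typeAtInfinity (hH : H.Tight) (hμ : H.IndepOn μ)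
    (h𝒪 : ∀ y ∈ acl (μ '' H.E), y ∈ 𝒪) [CharZero (IsLocalRing.ResidueField 𝒪)] (hl : l ∉ 𝒪)
    (hz : z ∈ GramFiber H μ l) :
    𝒪.TypeAtInfinity (acl {𝒪.rs (μ {1, 2})}) (acl (𝒪.rs '' (μ '' H.E))) l (z 0 1) := by
  have hl' : l ∉ acl (μ '' H.E) := fun h => hl (h𝒪 l h)
  have h1 := not_degenerate hH hμ h𝒪 hz.1 fun v hv hv1 => GramFiber.sq_ne_one hH hμ hl' hz hv hv1
  have hl'' : l ∈ acl (insert l (μ '' H.E)) := subset_acl _ (Set.mem_insert _ _)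
  have hR : ∀ {x}, x ∈ acl (insert l (μ '' H.E)) → 𝒪.rs x ∈ acl (𝒪.rs '' (μ '' H.E)) := fun hx =>
    (rs_mem_acl_of_notMem h𝒪 hl'' hl hx).rs_mem
  have ht := GramFiber.coord_mem_acl hH hμ hl' hz 0 1
  have hs := GramFiber.coord_mem_acl hH hμ hl' hz 0 0
  have hsum : z 0 0 = l - z 0 1 := by rw [← hz.2]; ring
  by_contra hneg
  simp only [TypeAtInfinity, not_or, not_and, not_not] at hneg
  obtain ⟨hA, hB, hC⟩ := hneg
  refine h1 ⟨fun _ => ?_, fun _ => hA (hR ht), fun hs0 ht0 => ?_⟩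
  · rw [hsum]; exact hB (hsum ▸ hR hs)
  · have h2 := (ResIn.of_rs_mem (hC (hR (div_mem ht hl'')))).inv
    rw [inv_div] at h2
    have h3 := h2.add (c := -1) (NegMemClass.neg_mem (OneMemClass.one_mem _)) (by
      rw [rs_neg (OneMemClass.one_mem _), rs_one]; exact NegMemClass.neg_mem (OneMemClass.one_mem _))
    have h4 : z 0 0 / z 0 1 = l / z 0 1 + -1 := by
      have := ne_zero_of_notMem ht0
      rw [hsum]; field_simp; ring
    rwa [h4]

open scoped Classical in
open ValuationSubring in
theorem IsCurve.natDegree_eval_zero (hH : H.Tight) (hμ : H.IndepOn μ) (hP : IsCurve H μ P)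
    (h𝒪 : ∀ y ∈ acl (μ '' H.E), y ∈ 𝒪) (hl : l ∉ 𝒪) (hl' : l ∉ acl (μ '' H.E)) :
    (P.eval 0).natDegree +
      ((gramFiber_finite hH hμ hl').toFinset.filter fun z => z 0 1 ∈ 𝒪).card = P.natDegree := by
  have := charZero_residueField h𝒪
  set Z := (gramFiber_finite hH hμ hl').toFinset
  have hmem : ∀ z ∈ Z, z ∈ GramFiber H μ l := fun z hz => (Set.Finite.mem_toFinset _).1 hz
  have h1 : (P.eval 0).natDegree = (Z.filter fun z => ¬ z 0 1 ∈ 𝒪).card := by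
    refine natDegree_eq_of_rs_ne_zero h𝒪 hl (fun n => coeff_eval_mem hP.coeff_mem (by simp) n) ?_
    have h2 : (P.eval 0).eval l / l ^ (Z.filter fun z => ¬ z 0 1 ∈ 𝒪).card =
        ∏ z ∈ Z, -(z 0 1 / l ^ (if z 0 1 ∈ 𝒪 then 0 else 1)) := by
      rw [eval_eval_eq, hP.eval_eq hH hμ hl', eval_prod, Finset.card_filter, ← Finset.prod_pow_eq_pow_sum,
        ← Finset.prod_div_distrib]
      refine Finset.prod_congr rfl fun z _ => ?_
      by_cases h : z 0 1 ∈ 𝒪 <;> simp [h, neg_div]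
    have h3 : ∀ z ∈ Z, 𝒪.rs (z 0 1 / l ^ (if z 0 1 ∈ 𝒪 then 0 else 1)) ≠ 0 := fun z hz =>
      (GramFiber.typeAtInfinity hH hμ h𝒪 hl (hmem z hz)).rs_coord_ne_zero hl
    rw [h2, rs_prod _ fun z hz => NegMemClass.neg_mem (mem_of_rs_ne_zero (h3 z hz))]
    refine Finset.prod_ne_zero_iff.2 fun z hz => ?_
    rw [rs_neg (mem_of_rs_ne_zero (h3 z hz))]
    exact neg_ne_zero.2 (h3 z hz)
  rw [h1, hP.natDegree_eq hH hμ hl', Set.ncard_eq_toFinset_card _ (gramFiber_finite hH hμ hl'), add_comm]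
  exact Finset.card_filter_add_card_filter_not _

open scoped Classical in
open ValuationSubring in
theorem IsCurve.natDegree_eval_X (hH : H.Tight) (hμ : H.IndepOn μ) (hP : IsCurve H μ P)
    (h𝒪 : ∀ y ∈ acl (μ '' H.E), y ∈ 𝒪) (hl : l ∉ 𝒪) (hl' : l ∉ acl (μ '' H.E)) :
    (P.eval X).natDegree +
      ((gramFiber_finite hH hμ hl').toFinset.filter fun z => l - z 0 1 ∈ 𝒪).card = P.natDegree := by
  have := charZero_residueField h𝒪
  set Z := (gramFiber_finite hH hμ hl').toFinset
  have hmem : ∀ z ∈ Z, z ∈ GramFiber H μ l := fun z hz => (Set.Finite.mem_toFinset _).1 hz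
  have h1 : (P.eval X).natDegree = (Z.filter fun z => ¬ l - z 0 1 ∈ 𝒪).card := by
    refine natDegree_eq_of_rs_ne_zero h𝒪 hl (fun n => coeff_eval_mem hP.coeff_mem (fun i => by
      rw [coeff_X]; split_ifs <;> simp) n) ?_
    have h2 : (P.eval X).eval l / l ^ (Z.filter fun z => ¬ l - z 0 1 ∈ 𝒪).card =
        ∏ z ∈ Z, ((l - z 0 1) / l ^ (if l - z 0 1 ∈ 𝒪 then 0 else 1)) := by
      rw [eval_eval_eq, hP.eval_eq hH hμ hl', eval_prod, Finset.card_filter, ← Finset.prod_pow_eq_pow_sum,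
        ← Finset.prod_div_distrib]
      refine Finset.prod_congr rfl fun z _ => ?_
      by_cases h : l - z 0 1 ∈ 𝒪 <;> simp [h]
    have h3 : ∀ z ∈ Z, 𝒪.rs ((l - z 0 1) / l ^ (if l - z 0 1 ∈ 𝒪 then 0 else 1)) ≠ 0 := fun z hz =>
      ((GramFiber.typeAtInfinity hH hμ h𝒪 hl (hmem z hz)).symm hl).rs_coord_ne_zero hl
    rw [h2, rs_prod _ fun z hz => mem_of_rs_ne_zero (h3 z hz)]
    exact Finset.prod_ne_zero_iff.2 h3
  rw [h1, hP.natDegree_eq hH hμ hl', Set.ncard_eq_toFinset_card _ (gramFiber_finite hH hμ hl'), add_comm]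
  exact Finset.card_filter_add_card_filter_not _

end Infinity

section Resultant

variable {G G₁ G₂ : GeoGraph} {μ : Finset ℕ → ℂ} {P₁ P₂ : ℂ[X][X]} {l : ℂ}

theorem IsCurve.eval_resultant (h1 : G₁.Tight) (h2 : G₂.Tight) (hμ₁ : G₁.IndepOn μ)
    (hμ₂ : G₂.IndepOn μ) (hP₁ : IsCurve G₁ μ P₁) (hP₂ : IsCurve G₂ μ P₂)
    (hl₁ : l ∉ acl (μ '' G₁.E)) (hl₂ : l ∉ acl (μ '' G₂.E)) :
    (resultant P₁ P₂).eval l = ∏ z₁ ∈ (gramFiber_finite h1 hμ₁ hl₁).toFinset,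
      ∏ z₂ ∈ (gramFiber_finite h2 hμ₂ hl₂).toFinset, (z₁ 0 1 - z₂ 0 1) := by
  have h3 := resultant_map_map P₁ P₂ P₁.natDegree P₂.natDegree (evalRingHom l)
  rw [coe_evalRingHom] at h3
  rw [← h3, ← resultant_prod_X_sub_C, ← hP₁.eval_eq h1 hμ₁ hl₁, ← hP₂.eval_eq h2 hμ₂ hl₂,
    hP₁.monic.natDegree_map, hP₂.monic.natDegree_map]

theorem IsSplit.mem_acl_inter (hs : IsSplit G G₁ G₂) (hμ : G.IndepOn μ) {x : ℂ}
    (hx₁ : x ∈ acl (μ '' G₁.E)) (hx₂ : x ∈ acl (μ '' G₂.E)) : x ∈ acl {μ {1, 2}} := by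
  have h1 : AlgebraicIndepOn ℚ μ ((G₁.E : Set (Finset ℕ)) ∪ G₂.E) := by
    rw [← Finset.coe_union, ← hs.2.1]; exact hμ
  have h2 := _root_.mem_acl_inter h1 hx₁ hx₂
  rwa [← Finset.coe_inter, hs.2.2.2, Finset.coe_singleton, Set.image_singleton] at h2

theorem IsSplit.rs_mem_acl_inter (hs : IsSplit G G₁ G₂) (hμ : G.IndepOn μ) {𝒪 : ValuationSubring ℂ}
    (h𝒪 : ∀ y ∈ acl (μ '' G.E), y ∈ 𝒪) [CharZero (IsLocalRing.ResidueField 𝒪)]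
    {x : IsLocalRing.ResidueField 𝒪}
    (hx₁ : x ∈ acl (𝒪.rs '' (μ '' G₁.E))) (hx₂ : x ∈ acl (𝒪.rs '' (μ '' G₂.E))) :
    x ∈ acl {𝒪.rs (μ {1, 2})} := by
  have h1 : AlgebraicIndepOn ℚ (fun e => 𝒪.rs (μ e)) ((G₁.E : Set (Finset ℕ)) ∪ G₂.E) := by
    rw [← Finset.coe_union, ← hs.2.1]
    exact independent_residues hμ h𝒪 fun e => subset_acl _ ⟨e, e.2, rfl⟩
  rw [Set.image_image] at hx₁ hx₂
  have h2 := _root_.mem_acl_inter h1 hx₁ hx₂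
  rwa [← Finset.coe_inter, hs.2.2.2, Finset.coe_singleton, Set.image_singleton] at h2

open scoped Classical in
open ValuationSubring in
/-- The degree of the resultant of the two curves of a split. -/
theorem IsSplit.natDegree_resultant (hs : IsSplit G G₁ G₂) (h1 : G₁.Tight) (h2 : G₂.Tight)
    (hμ : G.IndepOn μ) (hP₁ : IsCurve G₁ μ P₁) (hP₂ : IsCurve G₂ μ P₂) :
    resultant P₁ P₂ ≠ 0 ∧ ((resultant P₁ P₂).natDegree : ℤ) = P₁.natDegree * P₂.natDegree -
      (P₁.natDegree - (P₁.eval 0).natDegree) * (P₂.natDegree - (P₂.eval 0).natDegree) -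
      (P₁.natDegree - (P₁.eval X).natDegree) * (P₂.natDegree - (P₂.eval X).natDegree) := by
  have hμ₁ := hs.indepOn_left hμ
  have hμ₂ := hs.symm.indepOn_left hμ
  have hsub₁ : acl (μ '' G₁.E) ≤ acl (μ '' G.E) := acl_mono (Set.image_mono hs.edges_left)
  have hsub₂ : acl (μ '' G₂.E) ≤ acl (μ '' G.E) := acl_mono (Set.image_mono hs.symm.edges_left)
  obtain ⟨l₀, hl₀⟩ := exists_notMem_acl hμ
  obtain ⟨𝒪, h𝒪, hl⟩ := exists_valuationSubring_notMem hl₀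
  have := charZero_residueField h𝒪
  have hO₁ : ∀ y ∈ acl (μ '' G₁.E), y ∈ 𝒪 := fun y hy => h𝒪 y (hsub₁ hy)
  have hO₂ : ∀ y ∈ acl (μ '' G₂.E), y ∈ 𝒪 := fun y hy => h𝒪 y (hsub₂ hy)
  have hl₁ : l₀ ∉ acl (μ '' G₁.E) := fun h => hl (hO₁ _ h)
  have hl₂ : l₀ ∉ acl (μ '' G₂.E) := fun h => hl (hO₂ _ h)
  have a1 := hP₁.natDegree_eval_zero h1 hμ₁ hO₁ hl hl₁
  have a2 := hP₂.natDegree_eval_zero h2 hμ₂ hO₂ hl hl₂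
  have b1 := hP₁.natDegree_eval_X h1 hμ₁ hO₁ hl hl₁
  have b2 := hP₂.natDegree_eval_X h2 hμ₂ hO₂ hl hl₂
  have n1 := hP₁.natDegree_eq h1 hμ₁ hl₁
  have n2 := hP₂.natDegree_eq h2 hμ₂ hl₂
  rw [Set.ncard_eq_toFinset_card _ (gramFiber_finite h1 hμ₁ hl₁)] at n1
  rw [Set.ncard_eq_toFinset_card _ (gramFiber_finite h2 hμ₂ hl₂)] at n2
  have hR := hP₁.eval_resultant h1 h2 hμ₁ hμ₂ hP₂ hl₁ hl₂
  have hZ₁ : ∀ z ∈ (gramFiber_finite h1 hμ₁ hl₁).toFinset, z ∈ GramFiber G₁ μ l₀ :=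
    fun z hz => (Set.Finite.mem_toFinset _).1 hz
  have hZ₂ : ∀ z ∈ (gramFiber_finite h2 hμ₂ hl₂).toFinset, z ∈ GramFiber G₂ μ l₀ :=
    fun z hz => (Set.Finite.mem_toFinset _).1 hz
  generalize (gramFiber_finite h1 hμ₁ hl₁).toFinset = Z₁ at *
  generalize (gramFiber_finite h2 hμ₂ hl₂).toFinset = Z₂ at *
  let Q : (ℕ → Fin 3 → ℂ) × (ℕ → Fin 3 → ℂ) → Prop := fun z =>
    z.1 0 1 ∈ 𝒪 ∧ z.2 0 1 ∈ 𝒪 ∨ l₀ - z.1 0 1 ∈ 𝒪 ∧ l₀ - z.2 0 1 ∈ 𝒪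
  have h3 : ∀ z ∈ Z₁ ×ˢ Z₂, 𝒪.rs ((z.1 0 1 - z.2 0 1) / l₀ ^ (if Q z then 0 else 1)) ≠ 0 := by
    intro z hz
    obtain ⟨m1, m2⟩ := Finset.mem_product.1 hz
    exact (GramFiber.typeAtInfinity h1 hμ₁ hO₁ hl (hZ₁ _ m1)).rs_sub_ne_zero hl
      (fun x => hs.rs_mem_acl_inter hμ h𝒪) (GramFiber.typeAtInfinity h2 hμ₂ hO₂ hl (hZ₂ _ m2))
  have h4 : (resultant P₁ P₂).eval l₀ / l₀ ^ ((Z₁ ×ˢ Z₂).filter fun z => ¬ Q z).card =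
      ∏ z ∈ Z₁ ×ˢ Z₂, ((z.1 0 1 - z.2 0 1) / l₀ ^ (if Q z then 0 else 1)) := by
    rw [hR, ← Finset.prod_product', Finset.card_filter, ← Finset.prod_pow_eq_pow_sum,
      ← Finset.prod_div_distrib]
    refine Finset.prod_congr rfl fun z _ => ?_
    by_cases h : Q z <;> simp [h]
  have h5 : 𝒪.rs ((resultant P₁ P₂).eval l₀ / l₀ ^ ((Z₁ ×ˢ Z₂).filter fun z => ¬ Q z).card) ≠ 0 := by
    rw [h4, rs_prod _ fun z hz => mem_of_rs_ne_zero (h3 z hz)]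
    exact Finset.prod_ne_zero_iff.2 h3
  have h6 := natDegree_eq_of_rs_ne_zero h𝒪 hl (coeff_resultant_mem
    (fun i j => hsub₁ (hP₁.coeff_mem i j)) (fun i j => hsub₂ (hP₂.coeff_mem i j)) _ _) h5
  refine ⟨fun h0 => h5 (by simp [h0]), ?_⟩
  have h7 := Finset.card_filter_add_card_filter_not (s := Z₁ ×ˢ Z₂) Q
  have h8 : ((Z₁ ×ˢ Z₂).filter Q) =
      (Z₁.filter fun z => z 0 1 ∈ 𝒪) ×ˢ (Z₂.filter fun z => z 0 1 ∈ 𝒪) ∪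
      (Z₁.filter fun z => l₀ - z 0 1 ∈ 𝒪) ×ˢ (Z₂.filter fun z => l₀ - z 0 1 ∈ 𝒪) := by
    ext z; simp only [Finset.mem_filter, Finset.mem_product, Finset.mem_union, Q]; tauto
  rw [h8, Finset.card_union_of_disjoint, Finset.card_product, Finset.card_product,
    Finset.card_product, ← h6, ← n1, ← n2] at h7
  · zify at h7 a1 a2 b1 b2
    rw [eq_sub_of_add_eq' a1, eq_sub_of_add_eq' a2, eq_sub_of_add_eq' b1, eq_sub_of_add_eq' b2] at h7
    linear_combination h7
  · rw [Finset.disjoint_left]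
    intro z m1 m2
    simp only [Finset.mem_product, Finset.mem_filter] at m1 m2
    exact hl (by simpa using AddMemClass.add_mem m2.1.2 m1.1.2)

end Resultant

section Roots

variable {H G G₁ G₂ : GeoGraph} {μ : Finset ℕ → ℂ} {P P₁ P₂ : ℂ[X][X]} {l t : ℂ}
  {z : ℕ → Fin 3 → ℂ}

theorem exists_place_reducing_to (S : Set ℂ) {l₀ : ℂ} (hl₀ : l₀ ∈ acl S) (hl : l ∉ acl S) :
    ∃ 𝒪 : ValuationSubring ℂ, (∀ y ∈ acl S, y ∈ 𝒪) ∧ l ∈ 𝒪 ∧ 𝒪.rs l = 𝒪.rs l₀ := by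
  have h1 : (l - l₀)⁻¹ ∉ acl S := fun h => hl (by
    have := add_mem (inv_mem h) hl₀
    rwa [inv_inv, sub_add_cancel] at this)
  obtain ⟨𝒪, h𝒪, h2⟩ := exists_valuationSubring_notMem h1
  have h3 := ValuationSubring.inv_mem_of_notMem h2
  have h4 := ValuationSubring.rs_inv_of_notMem h2
  rw [inv_inv] at h3 h4
  have h5 : l = (l - l₀) + l₀ := by ring
  refine ⟨𝒪, h𝒪, ?_, ?_⟩
  · rw [h5]; exact add_mem h3 (h𝒪 _ hl₀)
  · rw [h5, ValuationSubring.rs_add h3 (h𝒪 _ hl₀), h4, zero_add]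

open ValuationSubring in
theorem IsCurve.eval_eval_ne_zero (hH : H.Tight) (hμ : H.IndepOn μ) (hP : IsCurve H μ P)
    (hl : l ∈ acl {μ {1, 2}}) (ht : t ∈ acl {μ {1, 2}}) : (P.map (evalRingHom l)).eval t ≠ 0 := by
  intro h0
  have hsub : acl {μ {1, 2}} ≤ acl (μ '' H.E) :=
    acl_mono (Set.singleton_subset_iff.2 ⟨_, hH.mem, rfl⟩)
  obtain ⟨l', hl'⟩ := exists_notMem_acl hμ
  obtain ⟨𝒪, h𝒪, hlO, hrl⟩ := exists_place_reducing_to _ (hsub hl) hl'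
  have := charZero_residueField h𝒪
  have htO := h𝒪 _ (hsub ht)
  have hp : ∀ i, (P.eval (C t)).coeff i ∈ acl (μ '' H.E) := coeff_eval_mem hP.coeff_mem fun i => by
    rw [coeff_C]; split_ifs
    exacts [hsub ht, ZeroMemClass.zero_mem _]
  obtain ⟨p, hp⟩ : P.eval (C t) ∈ lifts (acl (μ '' H.E)).subtype := by
    rw [lifts_iff_coeff_lifts]; exact fun i => ⟨⟨_, hp i⟩, rfl⟩
  have haeval : ∀ x, aeval x p = (P.map (evalRingHom x)).eval t := by
    intro x
    have := eval_eval_eq P (C t) x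
    rw [eval_C] at this
    rw [← this, ← hp, coe_mapRingHom, eval_map, aeval_def]
    rfl
  have hr : 𝒪.rs ((P.map (evalRingHom l')).eval t) = 0 := by
    rw [← haeval, (aeval_mem_valuationSubring h𝒪 hlO p).2, hrl,
      ← (aeval_mem_valuationSubring h𝒪 (h𝒪 _ (hsub hl)) p).2, haeval, h0, rs_zero]
  have hz : ∀ z ∈ GramFiber H μ l', z 0 1 ∈ 𝒪 := fun z hz =>
    coord_mem_of_length_mem hH hμ h𝒪 hz.1 (fun v hv hv1 => GramFiber.sq_ne_one hH hμ hl' hz hv hv1)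
      (by rw [hz.2]; exact hlO)
  have hmem : ∀ z ∈ (gramFiber_finite hH hμ hl').toFinset, z ∈ GramFiber H μ l' :=
    fun z hz => (Set.Finite.mem_toFinset _).1 hz
  rw [hP.eval_eq hH hμ hl', eval_prod, rs_prod _ fun z h => by
    simpa using _root_.sub_mem htO (hz z (hmem z h)), Finset.prod_eq_zero_iff] at hr
  obtain ⟨z, hzm, hz0⟩ := hr
  have hzm := hmem z hzm
  have hzO := hz z hzm
  rw [eval_sub, eval_X, eval_C, rs_sub htO hzO, sub_eq_zero] at hz0
  have hrs : ∀ {x}, x ∈ acl {μ {1, 2}} → 𝒪.rs x ∈ acl {𝒪.rs (μ {1, 2})} := fun {x} hx => by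
    have := rs_mem_acl (fun y hy => h𝒪 y (hsub hy)) hx
    rwa [Set.image_singleton] at this
  have hs : z 0 0 = l' - z 0 1 := by rw [← hzm.2]; ring
  refine rs_coord_notMem hH hμ h𝒪 hzm.1 (fun v hv hv1 => GramFiber.sq_ne_one hH hμ hl' hzm hv hv1)
    ?_ ?_ (hz0 ▸ hrs ht)
  · rw [hs]; exact _root_.sub_mem hlO hzO
  · rw [hs, rs_sub hlO hzO, hrl, ← hz0]; exact _root_.sub_mem (hrs hl) (hrs ht)

open ValuationSubring in
theorem GramFiber.coord_notMem (hH : H.Tight) (hμ : H.IndepOn μ) (hl : l ∉ acl (μ '' H.E))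
    (hz : z ∈ GramFiber H μ l) : z 0 1 ∉ acl {l, μ {1, 2}} := by
  intro ht
  have hsub : ({μ {1, 2}} : Set ℂ) ⊆ μ '' H.E := Set.singleton_subset_iff.2 ⟨_, hH.mem, rfl⟩
  obtain ⟨𝒪, h𝒪, hlO, hrl⟩ := exists_place_reducing_to _ (ZeroMemClass.zero_mem _) hl
  rw [rs_zero] at hrl
  have := charZero_residueField h𝒪
  have ha := fun v hv hv1 => GramFiber.sq_ne_one hH hμ hl hz (v := v) hv hv1
  have hzO : z 0 1 ∈ 𝒪 := coord_mem_of_length_mem hH hμ h𝒪 hz.1 ha (by rw [hz.2]; exact hlO)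
  have hs : z 0 0 = l - z 0 1 := by rw [← hz.2]; ring
  have hr : 𝒪.rs (z 0 1) ∈ acl {𝒪.rs (μ {1, 2})} := by
    by_contra hr
    have h1 : z 0 1 ∉ acl {μ {1, 2}} := fun h => hr (by
      have := rs_mem_acl (fun y hy => h𝒪 y (acl_mono hsub hy)) h
      rwa [Set.image_singleton] at this)
    have h2 : l ∈ acl (insert (z 0 1) {μ {1, 2}}) := mem_acl_insert_of_mem h1 ht
    have hl0 : l ≠ 0 := fun h => hl (h ▸ ZeroMemClass.zero_mem _)
    refine inv_notMem hrl hlO hl0 (mem_valuationSubring_of_mem_acl_insert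
      (S := {μ {1, 2}}) (fun y hy => h𝒪 y (acl_mono hsub hy)) hzO ?_ (InvMemClass.inv_mem h2))
    rwa [Set.image_singleton]
  refine rs_coord_notMem hH hμ h𝒪 hz.1 ha ?_ ?_ hr
  · rw [hs]; exact _root_.sub_mem hlO hzO
  · rw [hs, rs_sub hlO hzO, hrl, zero_sub]; exact NegMemClass.neg_mem hr

open Matroid in
theorem IsSplit.mem_acl_pair (hs : IsSplit G G₁ G₂) (hμ : G.IndepOn μ)
    (hl₁ : l ∈ acl (μ '' G₁.E)) (hl₂ : l ∉ acl (μ '' G₂.E)) (ht₁ : t ∈ acl (μ '' G₁.E))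
    (ht₂ : t ∈ acl (insert l (μ '' G₂.E))) : t ∈ acl {l, μ {1, 2}} := by
  by_contra ht
  set M := AlgebraicIndependent.matroid ℚ ℂ
  have h12 : ({1, 2} : Finset ℕ) ∈ G₁.E ∩ G₂.E := by rw [hs.2.2.2]; simp
  have h12₁ := (Finset.mem_inter.1 h12).1
  have h12₂ := (Finset.mem_inter.1 h12).2
  have hI : M.Indep (μ '' G.E) := by
    have := hμ.to_subtype_range
    rwa [range_edges] at this
  have hcard : (μ '' G.E).encard = G.E.card := by
    rw [Set.InjOn.encard_image, Set.encard_coe_eq_coe_finsetCard]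
    intro a ha b hb hab
    exact congrArg Subtype.val (hμ.injective (a₁ := ⟨a, ha⟩) (a₂ := ⟨b, hb⟩) hab)
  have hw : M.Indep {μ {1, 2}} :=
    hI.subset (Set.singleton_subset_iff.2 ⟨_, hs.edges_left h12₁, rfl⟩)
  have hsub₂ : ({μ {1, 2}} : Set ℂ) ⊆ μ '' G₂.E := Set.singleton_subset_iff.2 ⟨_, h12₂, rfl⟩
  have hl : l ∉ acl {μ {1, 2}} := fun h => hl₂ (acl_mono hsub₂ h)
  have hlw := hw.notMem_closure_iff.1 hl
  have htw := hlw.1.notMem_closure_iff.1 ht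
  have hle := M.eRk_inter_add_eRk_union_le (M.closure (μ '' G₁.E)) (M.closure (insert l (μ '' G₂.E)))
  have hc1 : M.eRk (M.closure (μ '' G₁.E)) ≤ G₁.E.card := by
    rw [eRk_closure_eq]
    refine (M.eRk_le_encard _).trans ((Set.encard_image_le _ _).trans ?_)
    rw [Set.encard_coe_eq_coe_finsetCard]
  have hc2 : M.eRk (M.closure (insert l (μ '' G₂.E))) ≤ G₂.E.card + 1 := by
    rw [eRk_closure_eq]
    refine (M.eRk_le_encard _).trans ((Set.encard_insert_le _ _).trans ?_)
    gcongr
    refine (Set.encard_image_le _ _).trans ?_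
    rw [Set.encard_coe_eq_coe_finsetCard]
  have hc3 : (3 : ℕ∞) ≤ M.eRk (M.closure (μ '' G₁.E) ∩ M.closure (insert l (μ '' G₂.E))) := by
    have h3 : ({t, l, μ {1, 2}} : Set ℂ).encard = 3 := by
      rw [Set.encard_insert_of_notMem htw.2, Set.encard_insert_of_notMem hlw.2, Set.encard_singleton]
      norm_num
    rw [← h3, ← htw.1.eRk_eq_encard]
    refine M.eRk_mono ?_
    rintro x (rfl | rfl | rfl)
    · exact ⟨ht₁, ht₂⟩
    · exact ⟨hl₁, subset_acl _ (Set.mem_insert _ _)⟩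
    · exact ⟨subset_acl _ ⟨_, h12₁, rfl⟩, subset_acl _ (Set.mem_insert_of_mem _ ⟨_, h12₂, rfl⟩)⟩
  have hc4 : (G.E.card : ℕ∞) ≤ M.eRk (M.closure (μ '' G₁.E) ∪ M.closure (insert l (μ '' G₂.E))) := by
    rw [← hcard, ← hI.eRk_eq_encard]
    refine M.eRk_mono ?_
    rw [hs.2.1, Finset.coe_union, Set.image_union]
    exact Set.union_subset_union (subset_acl _)
      ((Set.subset_insert _ _).trans (subset_acl _))
  have h5 := (add_le_add hc3 hc4).trans (hle.trans (add_le_add hc1 hc2))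
  have h6 : 3 + G.E.card ≤ G₁.E.card + (G₂.E.card + 1) := by exact_mod_cast h5
  have := hs.card_edges
  omega

/-- The roots of the resultant are generic for both sides of the split. -/
theorem IsSplit.notMem_acl_of_isRoot (hs : IsSplit G G₁ G₂) (h1 : G₁.Tight) (h2 : G₂.Tight)
    (hμ : G.IndepOn μ) (hP₁ : IsCurve G₁ μ P₁) (hP₂ : IsCurve G₂ μ P₂)
    (hl : (resultant P₁ P₂).IsRoot l) : l ∉ acl (μ '' G₁.E) ∧ l ∉ acl (μ '' G₂.E) := by
  have hμ₁ := hs.indepOn_left hμ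
  have hμ₂ := hs.symm.indepOn_left hμ
  obtain ⟨t, ht₁, ht₂⟩ : ∃ t, (P₁.map (evalRingHom l)).eval t = 0 ∧
      (P₂.map (evalRingHom l)).eval t = 0 := by
    have h3 := resultant_map_map P₁ P₂ P₁.natDegree P₂.natDegree (evalRingHom l)
    rw [coe_evalRingHom, hl.eq_zero, ← hP₁.monic.natDegree_map (evalRingHom l),
      ← hP₂.monic.natDegree_map (evalRingHom l), resultant_eq_zero_iff] at h3
    have h4 := h3.2
    rw [isCoprime_iff_aeval_ne_zero_of_isAlgClosed ℂ ℂ] at h4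
    push Not at h4
    simpa using h4
  have key : ∀ {G₁ G₂ P₁ P₂}, IsSplit G G₁ G₂ → G₁.Tight → G₂.Tight → G₁.IndepOn μ → G₂.IndepOn μ →
      IsCurve G₁ μ P₁ → IsCurve G₂ μ P₂ → (P₁.map (evalRingHom l)).eval t = 0 →
      (P₂.map (evalRingHom l)).eval t = 0 → l ∉ acl (μ '' G₁.E) := by
    intro G₁ G₂ P₁ P₂ hs h1 h2 hμ₁ hμ₂ hP₁ hP₂ ht₁ ht₂ hl₁
    have hroot : ∀ {H P}, IsCurve H μ P → (P.map (evalRingHom l)).eval t = 0 →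
        t ∈ acl (insert l (μ '' H.E)) := by
      intro H P hP ht
      refine mem_acl_of_root (hP.monic.map (evalRingHom l)).ne_zero (fun n => ?_) ht
      rw [coeff_map, coe_evalRingHom, eval_eq_sum_range]
      exact sum_mem fun i _ => mul_mem (acl_mono (Set.subset_insert _ _) (hP.coeff_mem n i))
        (pow_mem (subset_acl _ (Set.mem_insert _ _)) _)
    have hins : ∀ {S : Set ℂ}, l ∈ acl S → acl (insert l S) ≤ acl S := fun hl =>
      acl_le (Set.insert_subset hl (subset_acl _))
    have htk₁ := hins hl₁ (hroot hP₁ ht₁)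
    by_cases hl₂ : l ∈ acl (μ '' G₂.E)
    · exact hP₁.eval_eval_ne_zero h1 hμ₁ (hs.mem_acl_inter hμ hl₁ hl₂)
        (hs.mem_acl_inter hμ htk₁ (hins hl₂ (hroot hP₂ ht₂))) ht₁
    · rw [hP₂.eval_eq h2 hμ₂ hl₂, eval_prod, Finset.prod_eq_zero_iff] at ht₂
      obtain ⟨z, hz, hzt⟩ := ht₂
      have hz := (Set.Finite.mem_toFinset _).1 hz
      rw [eval_sub, eval_X, eval_C, sub_eq_zero] at hzt
      refine GramFiber.coord_notMem h2 hμ₂ hl₂ hz ?_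
      rw [← hzt]
      refine hs.mem_acl_pair hμ hl₁ hl₂ htk₁ ?_
      rw [hzt]
      exact GramFiber.coord_mem_acl h2 hμ₂ hl₂ hz 0 1
  exact ⟨key hs h1 h2 hμ₁ hμ₂ hP₁ hP₂ ht₁ ht₂, key hs.symm h2 h1 hμ₂ hμ₁ hP₂ hP₁ ht₂ ht₁⟩

end Roots

section Multiplicity

variable {H G G₁ G₂ : GeoGraph} {μ : Finset ℕ → ℂ} {P P₁ P₂ : ℂ[X][X]} {l : ℂ}
  {z z₁ z₂ : ℕ → Fin 3 → ℂ} {θ θ₁ θ₂ : ℂ →+* PowerSeries ℂ}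

/-- The substitution `X ↦ l + X` into power series. -/
noncomputable def taylorHom (l : ℂ) : ℂ[X] →+* PowerSeries ℂ :=
  eval₂RingHom PowerSeries.C (PowerSeries.C l + PowerSeries.X)

/-- An extension of the Taylor expansion at `l` that fixes the elements algebraic over `S`. -/
structure IsTaylorLift (S : Set ℂ) (l : ℂ) (θ : ℂ →+* PowerSeries ℂ) : Prop where
  constantCoeff : ∀ x, PowerSeries.constantCoeff (θ x) = x
  map_mem : ∀ x ∈ acl S, θ x = PowerSeries.C x
  map_self : θ l = PowerSeries.C l + PowerSeries.X

theorem exists_isTaylorLift (hμ : H.IndepOn μ) (hl : l ∉ acl (μ '' H.E)) :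
    ∃ θ, IsTaylorLift (μ '' H.E) l θ := by
  obtain ⟨θ, h0, h1⟩ := exists_taylor (hμ.option hl) (fun o => o.elim 1 fun _ => 0)
  refine ⟨θ, h0, fun x hx => ?_, by simpa using h1 none⟩
  have := acl_le_eqSubfieldMod (θ := θ) (φ := PowerSeries.C) (J := ⊥) h0 (fun _ => by simp)
    (S := μ '' H.E) ?_ hx
  · simpa [sub_eq_zero] using this
  · rintro _ ⟨e, he, rfl⟩
    have := h1 (some ⟨e, he⟩)
    simp at this
    simp [this]

theorem rootMultiplicity_eq_order {R : ℂ[X]} (hR : R ≠ 0) (l : ℂ) :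
    (R.rootMultiplicity l : ℕ∞) = (taylorHom l R).order := by
  obtain ⟨g, hg, hgl⟩ := exists_eq_pow_rootMultiplicity_mul_and_not_dvd R hR l
  have hX : taylorHom l (X - C l) = PowerSeries.X := by simp [taylorHom]
  have hunit : IsUnit (taylorHom l g) := by
    rw [PowerSeries.isUnit_iff_constantCoeff, isUnit_iff_ne_zero]
    have : (PowerSeries.constantCoeff (R := ℂ)).comp (taylorHom l) = evalRingHom l := by
      ext <;> simp [taylorHom]
    rw [← RingHom.comp_apply, this, coe_evalRingHom]
    exact fun h => hgl (dvd_iff_isRoot.2 h)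
  conv_rhs => rw [hg, map_mul, map_pow, hX, PowerSeries.order_mul, PowerSeries.order_X_pow,
    PowerSeries.order_zero_of_unit hunit, add_zero]

theorem IsCurve.map_taylorHom (hH : H.Tight) (hμ : H.IndepOn μ) (hP : IsCurve H μ P)
    (hl : l ∉ acl (μ '' H.E)) (hθ : IsTaylorLift (μ '' H.E) l θ) : P.map (taylorHom l) =
      ∏ z ∈ (gramFiber_finite hH hμ hl).toFinset, (X - C (θ (z 0 1))) := by
  have h1 := congrArg (Polynomial.map θ) (hP.eval_eq hH hμ hl)
  rw [Polynomial.map_map, Polynomial.map_prod] at h1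
  simp only [Polynomial.map_sub, map_X, map_C] at h1
  rw [← h1]
  ext1 i
  rw [coeff_map, coeff_map, RingHom.comp_apply, coe_evalRingHom, taylorHom, coe_eval₂RingHom,
    eval₂_eq_sum_range, eval_eq_sum_range, map_sum]
  refine Finset.sum_congr rfl fun j _ => ?_
  rw [map_mul, map_pow, hθ.map_self, hθ.map_mem _ (hP.coeff_mem i j)]

theorem IsCurve.taylorHom_resultant (h1 : G₁.Tight) (h2 : G₂.Tight) (hμ₁ : G₁.IndepOn μ)
    (hμ₂ : G₂.IndepOn μ) (hP₁ : IsCurve G₁ μ P₁) (hP₂ : IsCurve G₂ μ P₂)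
    (hl₁ : l ∉ acl (μ '' G₁.E)) (hl₂ : l ∉ acl (μ '' G₂.E)) (hθ₁ : IsTaylorLift (μ '' G₁.E) l θ₁)
    (hθ₂ : IsTaylorLift (μ '' G₂.E) l θ₂) :
    taylorHom l (resultant P₁ P₂) = ∏ z₁ ∈ (gramFiber_finite h1 hμ₁ hl₁).toFinset,
      ∏ z₂ ∈ (gramFiber_finite h2 hμ₂ hl₂).toFinset, (θ₁ (z₁ 0 1) - θ₂ (z₂ 0 1)) := by
  have h3 := resultant_map_map P₁ P₂ P₁.natDegree P₂.natDegree (taylorHom l)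
  rw [← h3]
  conv_lhs => rw [← hP₁.monic.natDegree_map (taylorHom l), ← hP₂.monic.natDegree_map (taylorHom l)]
  rw [hP₁.map_taylorHom h1 hμ₁ hl₁ hθ₁, hP₂.map_taylorHom h2 hμ₂ hl₂ hθ₂,
    resultant_prod_X_sub_C]

theorem PowerSeries.sub_mem_span_X_sq {x y : PowerSeries ℂ} :
    x - y ∈ Ideal.span {(PowerSeries.X : PowerSeries ℂ) ^ 2} ↔
      PowerSeries.constantCoeff x = PowerSeries.constantCoeff y ∧
        PowerSeries.coeff 1 x = PowerSeries.coeff 1 y := by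
  rw [Ideal.mem_span_singleton, PowerSeries.X_pow_dvd_iff]
  constructor
  · intro h
    have h0 := h 0 (by norm_num)
    have h1 := h 1 (by norm_num)
    rw [map_sub, sub_eq_zero] at h0 h1
    exact ⟨by simpa using h0, h1⟩
  · rintro ⟨h0, h1⟩ m hm
    interval_cases m
    · simpa [sub_eq_zero] using h0
    · rw [map_sub, h1, sub_self]

theorem IsSplit.coeff_one_ne (hs : IsSplit G G₁ G₂) (h1 : G₁.Tight) (h2 : G₂.Tight)
    (hμ : G.IndepOn μ) (hθ₁ : IsTaylorLift (μ '' G₁.E) l θ₁) (hθ₂ : IsTaylorLift (μ '' G₂.E) l θ₂)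
    (hz₁ : z₁ ∈ GramFiber G₁ μ l) (hz₂ : z₂ ∈ GramFiber G₂ μ l) (ht : z₁ 0 1 = z₂ 0 1) :
    PowerSeries.coeff 1 (θ₁ (z₁ 0 1)) ≠ PowerSeries.coeff 1 (θ₂ (z₂ 0 1)) := by
  intro hc
  have hs0 : z₁ 0 0 = z₂ 0 0 := by linear_combination hz₁.2 - hz₂.2 - ht
  wlog h : z₁ 0 = z₂ 0 generalizing z₂
  · obtain h' | h' := eq_or_reflectZ (h1.sub (by simp)) (h2.sub (by simp)) hz₁.1 hz₂.1 hs0 ht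
    · exact h h'
    · exact this (reflectZ_mem_gramFiber hz₂) ht hc hs0 h'
  set q := glueVerts G₁ z₁ z₂ with hqdef
  have hq : q ∈ GramRealization G μ := glueVerts_mem hs h1 hz₁.1 hz₂.1 h
  have hql : ∀ {v}, v ∈ G₁.V → q v = z₁ v := fun hv => glueVerts_left hv
  have hqr : ∀ {v}, v ∈ G₂.V → q v = z₂ v := fun hv => glueVerts_right hs hz₁.1 hz₂.1 h hv
  obtain ⟨hind, hcoords⟩ := hs.gramFamily_independent h1 h2 hμ hq
  obtain ⟨θ, hθ0, hθ⟩ := exists_taylor hind fun o => o.elim 0 fun p =>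
    if p.1.1 ∈ G₁.V then PowerSeries.coeff 1 (θ₁ (q p.1 p.2.castSucc))
      else PowerSeries.coeff 1 (θ₂ (q p.1 p.2.castSucc))
  have hw : θ (μ {1, 2}) = PowerSeries.C (μ {1, 2}) := by
    have := hθ none
    simp only [gramFamily, Option.elim_none] at this
    simpa using this
  have hcoef : ∀ v (hv : v ∈ (G.V \ {1, 2} : Finset ℕ)) (j : Fin 2),
      PowerSeries.coeff 1 (θ (q v j.castSucc)) =
        if v ∈ G₁.V then PowerSeries.coeff 1 (θ₁ (q v j.castSucc))
          else PowerSeries.coeff 1 (θ₂ (q v j.castSucc)) := by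
    intro v hv j
    have := hθ (some (⟨v, hv⟩, j))
    simp only [gramFamily, Option.elim_some] at this
    rw [this]
    simp [PowerSeries.coeff_C]
  have hmem₁ : ∀ x ∈ Set.range (gramFamily G₁ (μ {1, 2}) z₁),
      θ x - θ₁ x ∈ Ideal.span {(PowerSeries.X : PowerSeries ℂ) ^ 2} := by
    rintro _ ⟨_ | ⟨⟨v, hv⟩, j⟩, rfl⟩
    · simp only [gramFamily, Option.elim_none]
      rw [hw, hθ₁.map_mem _ (subset_acl _ ⟨_, h1.mem, rfl⟩), sub_self]
      exact zero_mem _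
    · simp only [gramFamily, Option.elim_some]
      rw [PowerSeries.sub_mem_span_X_sq, hθ0, hθ₁.constantCoeff]
      have hv' := Finset.mem_sdiff.1 hv
      refine ⟨rfl, ?_⟩
      rw [← hql hv'.1, hcoef v (Finset.mem_sdiff.2 ⟨hs.verts_left hv'.1, hv'.2⟩) j, if_pos hv'.1]
  have hmem₂ : ∀ x ∈ Set.range (gramFamily G₂ (μ {1, 2}) z₂),
      θ x - θ₂ x ∈ Ideal.span {(PowerSeries.X : PowerSeries ℂ) ^ 2} := by
    rintro _ ⟨_ | ⟨⟨v, hv⟩, j⟩, rfl⟩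
    · simp only [gramFamily, Option.elim_none]
      rw [hw, hθ₂.map_mem _ (subset_acl _ ⟨_, h2.mem, rfl⟩), sub_self]
      exact zero_mem _
    · simp only [gramFamily, Option.elim_some]
      rw [PowerSeries.sub_mem_span_X_sq, hθ0, hθ₂.constantCoeff]
      have hv' := Finset.mem_sdiff.1 hv
      refine ⟨rfl, ?_⟩
      rw [← hqr hv'.1, hcoef v (Finset.mem_sdiff.2 ⟨hs.symm.verts_left hv'.1, hv'.2⟩) j]
      split_ifs with hv1
      · obtain rfl | rfl | rfl := hs.mem_inter hv1 hv'.1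
        · rw [hql hv1]
          have key : PowerSeries.coeff 1 (θ₁ (z₁ 0 0)) = PowerSeries.coeff 1 (θ₂ (z₁ 0 0)) := by
            have e1 : z₁ 0 0 = l - z₁ 0 1 := by rw [← hz₁.2]; ring
            rw [e1, map_sub, map_sub, map_sub, map_sub, hθ₁.map_self, hθ₂.map_self, hc, ht]
          fin_cases j
          · exact key
          · show PowerSeries.coeff 1 (θ₁ (z₁ 0 1)) = PowerSeries.coeff 1 (θ₂ (z₁ 0 1))
            rw [hc, ht]
        · simp at hv'
        · simp at hv'
      · rfl
  have hcl₁ := fun {x : ℂ} (hx : x ∈ acl (coords z₁)) => acl_le_eqSubfieldMod hθ0 hθ₁.constantCoeff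
    hmem₁ (acl_le (coords_subset_acl hz₁.1) hx)
  have hcl₂ := fun {x : ℂ} (hx : x ∈ acl (coords z₂)) => acl_le_eqSubfieldMod hθ0 hθ₂.constantCoeff
    hmem₂ (acl_le (coords_subset_acl hz₂.1) hx)
  have hw1 : μ {1, 2} ^ 2 ≠ 1 := (hs.indepOn_left hμ).sq_ne_one h1
  have hC : ∀ x ∈ μ '' G.E, θ x - PowerSeries.C x ∈
      Ideal.span {(PowerSeries.X : PowerSeries ℂ) ^ 2} := by
    rintro _ ⟨e, he, rfl⟩
    rw [hs.2.1, Finset.coe_union] at he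
    obtain he | he := he
    · rw [← hθ₁.map_mem _ (subset_acl _ ⟨_, he, rfl⟩)]
      exact hcl₁ (length_mem_acl_coords hw1 hz₁.1 he)
    · rw [← hθ₂.map_mem _ (subset_acl _ ⟨_, he, rfl⟩)]
      exact hcl₂ (length_mem_acl_coords hw1 hz₂.1 he)
  have hl : l ∈ acl (μ '' G.E) := by
    rw [← hz₁.2, ← hql (h1.sub (by simp))]
    exact add_mem (hcoords ⟨(0, 0), rfl⟩) (hcoords ⟨(0, 1), rfl⟩)
  have e1 := acl_le_eqSubfieldMod hθ0 (φ := PowerSeries.C) (fun _ => by simp) hC hl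
  have e2 := hcl₁ (GramFiber.mem_acl_coords hz₁)
  rw [PowerSeries.sub_mem_span_X_sq] at e1 e2
  have e3 := e1.2.symm.trans e2.2
  rw [hθ₁.map_self] at e3
  simp at e3

theorem PowerSeries.order_eq_ite {x y : PowerSeries ℂ} {a b : ℂ}
    (ha : PowerSeries.constantCoeff x = a) (hb : PowerSeries.constantCoeff y = b)
    (h : a = b → PowerSeries.coeff 1 x ≠ PowerSeries.coeff 1 y) [Decidable (a = b)] :
    (x - y).order = if a = b then 1 else 0 := by
  split_ifs with hab
  · rw [← Nat.cast_one, PowerSeries.order_eq_nat]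
    refine ⟨by rw [map_sub]; exact sub_ne_zero.2 (h hab), fun i hi => ?_⟩
    obtain rfl : i = 0 := by omega
    simp [ha, hb, hab]
  · by_contra h0
    rw [← ne_eq, PowerSeries.order_ne_zero_iff_constCoeff_eq_zero, map_sub, ha, hb, sub_eq_zero] at h0
    exact hab h0

open scoped Classical in
theorem IsSplit.rootMultiplicity_eq (hs : IsSplit G G₁ G₂) (h1 : G₁.Tight) (h2 : G₂.Tight)
    (hμ : G.IndepOn μ) (hP₁ : IsCurve G₁ μ P₁) (hP₂ : IsCurve G₂ μ P₂)
    (hl₁ : (GramFiber G₁ μ l).Finite) (hl₂ : (GramFiber G₂ μ l).Finite)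
    (hl : (resultant P₁ P₂).IsRoot l) : (resultant P₁ P₂).rootMultiplicity l =
      ((hl₁.toFinset ×ˢ hl₂.toFinset).filter fun z => z.1 0 1 = z.2 0 1).card := by
  have hμ₁ := hs.indepOn_left hμ
  have hμ₂ := hs.symm.indepOn_left hμ
  obtain ⟨h3, h4⟩ := hs.notMem_acl_of_isRoot h1 h2 hμ hP₁ hP₂ hl
  obtain ⟨θ₁, hθ₁⟩ := exists_isTaylorLift hμ₁ h3
  obtain ⟨θ₂, hθ₂⟩ := exists_isTaylorLift hμ₂ h4
  have hR := (hs.natDegree_resultant h1 h2 hμ hP₁ hP₂).1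
  have e : ((resultant P₁ P₂).rootMultiplicity l : ℕ∞) =
      ((hl₁.toFinset ×ˢ hl₂.toFinset).filter fun z => z.1 0 1 = z.2 0 1).card := by
    rw [rootMultiplicity_eq_order hR, hP₁.taylorHom_resultant h1 h2 hμ₁ hμ₂ hP₂ h3 h4 hθ₁ hθ₂,
      ← Finset.prod_product', PowerSeries.order_prod, Finset.card_filter, Nat.cast_sum]
    refine Finset.sum_congr rfl fun z hz => ?_
    rw [Finset.mem_product, Set.Finite.mem_toFinset, Set.Finite.mem_toFinset] at hz
    rw [PowerSeries.order_eq_ite (hθ₁.constantCoeff _) (hθ₂.constantCoeff _)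
      (hs.coeff_one_ne h1 h2 hμ hθ₁ hθ₂ hz.1 hz.2)]
    split_ifs <;> rfl
  exact_mod_cast e

end Multiplicity

section Count

variable {G G₁ G₂ : GeoGraph} {μ : Finset ℕ → ℂ} {P₁ P₂ : ℂ[X][X]}

/-- Pairs of realizations whose first two coordinates agree at the vertex `0`, over a set of
parameters. -/
def MatchingPairs (G₁ G₂ : GeoGraph) (μ : Finset ℕ → ℂ) (L : Set ℂ) :
    Set ((ℕ → Fin 3 → ℂ) × (ℕ → Fin 3 → ℂ)) :=
  {z | ∃ l ∈ L, z.1 ∈ GramFiber G₁ μ l ∧ z.2 ∈ GramFiber G₂ μ l ∧ z.1 0 1 = z.2 0 1}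

theorem IsSplit.ncard_matchingPairs (hs : IsSplit G G₁ G₂) (h1 : G₁.Tight) (h2 : G₂.Tight)
    (hμ : G.IndepOn μ) (hP₁ : IsCurve G₁ μ P₁) (hP₂ : IsCurve G₂ μ P₂) :
    (MatchingPairs G₁ G₂ μ {l | (resultant P₁ P₂).IsRoot l}).Finite ∧
      (MatchingPairs G₁ G₂ μ {l | (resultant P₁ P₂).IsRoot l}).ncard =
        (resultant P₁ P₂).natDegree := by
  classical
  set R := resultant P₁ P₂ with hRdef
  have hR : R ≠ 0 := (hs.natDegree_resultant h1 h2 hμ hP₁ hP₂).1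
  have hfin : ∀ l, R.IsRoot l → (GramFiber G₁ μ l).Finite ∧ (GramFiber G₂ μ l).Finite := fun l hl =>
    have h := hs.notMem_acl_of_isRoot h1 h2 hμ hP₁ hP₂ hl
    ⟨gramFiber_finite h1 (hs.indepOn_left hμ) h.1,
      gramFiber_finite h2 (hs.symm.indepOn_left hμ) h.2⟩
  let T : ℂ → Finset ((ℕ → Fin 3 → ℂ) × (ℕ → Fin 3 → ℂ)) := fun l =>
    if h : R.IsRoot l then
      ((hfin l h).1.toFinset ×ˢ (hfin l h).2.toFinset).filter fun z => z.1 0 1 = z.2 0 1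
    else ∅
  have hT : ∀ {l z}, z ∈ T l ↔ R.IsRoot l ∧ z.1 ∈ GramFiber G₁ μ l ∧ z.2 ∈ GramFiber G₂ μ l ∧
      z.1 0 1 = z.2 0 1 := by
    intro l z
    simp only [T]
    split_ifs with h
    · simp only [Finset.mem_filter, Finset.mem_product, Set.Finite.mem_toFinset]
      tauto
    · simp only [Finset.notMem_empty]
      tauto
  have hcoe : MatchingPairs G₁ G₂ μ {l | R.IsRoot l} = (R.roots.toFinset.biUnion T : Set _) := by
    ext z
    simp only [MatchingPairs, Set.mem_ofPred_eq, Finset.coe_biUnion, Set.mem_iUnion, Finset.mem_coe,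
      Multiset.mem_toFinset, mem_roots hR, hT, exists_prop]
    tauto
  rw [hcoe]
  refine ⟨Finset.finite_toSet _, ?_⟩
  rw [Set.ncard_coe_finset, Finset.card_biUnion, IsAlgClosed.splits R |>.natDegree_eq_card_roots,
    ← Multiset.toFinset_sum_count_eq]
  · refine Finset.sum_congr rfl fun l hl => ?_
    have hl : R.IsRoot l := (mem_roots hR).1 (Multiset.mem_toFinset.1 hl)
    rw [count_roots, hs.rootMultiplicity_eq h1 h2 hμ hP₁ hP₂ (hfin l hl).1 (hfin l hl).2 hl]
    simp only [T, dif_pos hl]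
  · intro l _ l' _ hll
    rw [Function.onFun, Finset.disjoint_left]
    intro z hz hz'
    exact hll ((hT.1 hz).2.1.2.symm.trans (hT.1 hz').2.1.2)

/-- Realizations of the whole graph are counted by the resultant. -/
theorem IsSplit.ncard_gramRealization (hs : IsSplit G G₁ G₂) (h1 : G₁.Tight) (h2 : G₂.Tight)
    (hμ : G.IndepOn μ) (hP₁ : IsCurve G₁ μ P₁) (hP₂ : IsCurve G₂ μ P₂) :
    (GramRealization G μ).Finite ∧
      2 * (GramRealization G μ).ncard = (resultant P₁ P₂).natDegree := by
  obtain ⟨hfin, hcard⟩ := hs.ncard_matchingPairs h1 h2 hμ hP₁ hP₂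
  set R := resultant P₁ P₂ with hRdef
  have hμ₁ := hs.indepOn_left hμ
  have hμ₂ := hs.symm.indepOn_left hμ
  have h01 : 0 ∈ G₁.V := h1.sub (by simp)
  have h02 : 0 ∈ G₂.V := h2.sub (by simp)
  let T := MatchingPairs G₁ G₂ μ {l | R.IsRoot l}
  let φ : (ℕ → Fin 3 → ℂ) → (ℕ → Fin 3 → ℂ) × (ℕ → Fin 3 → ℂ) := fun q =>
    (restrictVerts G₁ q, restrictVerts G₂ q)
  let A := φ '' GramRealization G μ
  have hinj : Set.InjOn φ (GramRealization G μ) := by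
    intro q hq q' hq' h
    obtain ⟨e1, e2⟩ := Prod.ext_iff.1 h
    funext v
    by_cases hv1 : v ∈ G₁.V
    · have := congrFun e1 v
      simpa [φ, restrictVerts_of_mem hv1] using this
    by_cases hv2 : v ∈ G₂.V
    · have := congrFun e2 v
      simpa [φ, restrictVerts_of_mem hv2] using this
    have hv : v ∉ G.V := by rw [hs.1, Finset.mem_union]; tauto
    rw [hq.1 v hv, hq'.1 v hv]
  have hA : A = {z ∈ T | z.1 0 = z.2 0} := by
    ext z
    constructor
    · rintro ⟨q, hq, rfl⟩
      have hz1 := hs.restrictVerts_mem_gramFiber h1 hq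
      have hz2 := hs.symm.restrictVerts_mem_gramFiber h2 hq
      have h0 : restrictVerts G₁ q 0 = restrictVerts G₂ q 0 := by
        rw [restrictVerts_of_mem h01, restrictVerts_of_mem h02]
      refine ⟨⟨q 0 0 + q 0 1, ?_, hz1, hz2, congrFun h0 1⟩, h0⟩
      show R.eval _ = 0
      have hn1 := hs.length_notMem h1 h2 hμ hq
      have hn2 := hs.symm.length_notMem h2 h1 hμ hq
      rw [hRdef, IsCurve.eval_resultant h1 h2 hμ₁ hμ₂ hP₁ hP₂ hn1 hn2]
      refine Finset.prod_eq_zero ((Set.Finite.mem_toFinset _).2 hz1)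
        (Finset.prod_eq_zero ((Set.Finite.mem_toFinset _).2 hz2) ?_)
      rw [h0, sub_self]
    · rintro ⟨⟨l, -, hz1, hz2, -⟩, h0⟩
      refine ⟨glueVerts G₁ z.1 z.2, glueVerts_mem hs h1 hz1.1 hz2.1 h0, ?_⟩
      refine Prod.ext (funext fun v => ?_) (funext fun v => ?_)
      · by_cases hv : v ∈ G₁.V
        · simp only [φ]; rw [restrictVerts_of_mem hv, glueVerts_left hv]
        · simp [φ, restrictVerts, hv, hz1.1.1 v hv]
      · by_cases hv : v ∈ G₂.V
        · simp only [φ]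
          rw [restrictVerts_of_mem hv, glueVerts_right hs hz1.1 hz2.1 h0 hv]
        · simp [φ, restrictVerts, hv, hz2.1.1 v hv]
  let ψ : (ℕ → Fin 3 → ℂ) × (ℕ → Fin 3 → ℂ) → (ℕ → Fin 3 → ℂ) × (ℕ → Fin 3 → ℂ) := fun z =>
    (z.1, reflectZ z.2)
  have hψψ : ∀ z, ψ (ψ z) = z := fun z => by simp [ψ, reflectZ_reflectZ]
  have hψT : ∀ z ∈ T, ψ z ∈ T := by
    rintro z ⟨l, hl, hz1, hz2, ht⟩
    exact ⟨l, hl, hz1, reflectZ_mem_gramFiber hz2, ht⟩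
  have hAT : A ⊆ T := by rw [hA]; exact fun z hz => hz.1
  have hunion : T = A ∪ ψ '' A := by
    apply Set.Subset.antisymm
    · intro z hz
      obtain ⟨l, hl, hz1, hz2, ht⟩ := id hz
      have hs0 : z.1 0 0 = z.2 0 0 := by linear_combination hz1.2 - hz2.2 - ht
      obtain h | h := eq_or_reflectZ h01 h02 hz1.1 hz2.1 hs0 ht
      · left; rw [hA]; exact ⟨hz, h⟩
      · right
        refine ⟨ψ z, ?_, hψψ z⟩
        rw [hA]; exact ⟨hψT z hz, h⟩
    · refine Set.union_subset hAT ?_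
      rintro _ ⟨z, hz, rfl⟩
      exact hψT z (hAT hz)
  have hdisj : Disjoint A (ψ '' A) := by
    rw [Set.disjoint_left]
    rintro _ hz ⟨z, hz', rfl⟩
    rw [hA] at hz hz'
    obtain ⟨l, hl, hz1, -, -⟩ := hz'.1
    have hn := (hs.notMem_acl_of_isRoot h1 h2 hμ hP₁ hP₂ hl).1
    refine GramFiber.third_ne_zero h1 hμ₁ hn hz1 ?_
    have e1 : z.1 0 2 = z.2 0 2 := congrFun hz'.2 2
    have e2 : z.1 0 2 = -z.2 0 2 := congrFun hz.2 2
    linear_combination (e1 + e2) / 2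
  have hAfin : A.Finite := hfin.subset hAT
  refine ⟨hAfin.of_finite_image hinj, ?_⟩
  rw [← hcard]
  show _ = T.ncard
  rw [hunion, Set.ncard_union_eq hdisj hAfin (hAfin.image _),
    Set.ncard_image_of_injective _ (Function.LeftInverse.injective hψψ), hinj.ncard_image]
  ring

end Count

end

section Sphere

open Matrix

variable {G : GeoGraph} {lam : Finset ℕ → ℝ} {ρ ρ' : ℕ → Fin 3 → ℂ}

/-- The inner products prescribed by edge lengths on the sphere. -/
noncomputable def sphereGram (lam : Finset ℕ → ℝ) (e : Finset ℕ) : ℂ := 1 - (lam e : ℂ) / 2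

/-- The frame spanned by two vectors and their cross product. -/
def frame (x y : Fin 3 → ℂ) : Matrix (Fin 3) (Fin 3) ℂ :=
  Matrix.of ![x, y, crossProduct x y]

theorem frame_mulVec (x y p : Fin 3 → ℂ) :
    frame x y *ᵥ p = ![x ⬝ᵥ p, y ⬝ᵥ p, crossProduct x y ⬝ᵥ p] := by
  ext j; fin_cases j <;> rfl

theorem frame_mul_transpose (x y : Fin 3 → ℂ) (hx : x ⬝ᵥ x = 1) (hy : y ⬝ᵥ y = 1) :
    frame x y * (frame x y)ᵀ =
      !![1, x ⬝ᵥ y, 0; x ⬝ᵥ y, 1, 0; 0, 0, 1 - (x ⬝ᵥ y) ^ 2] := by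
  simp only [vec3_dotProduct] at *
  ext i j
  fin_cases i <;> fin_cases j <;>
    simp [frame, Matrix.mul_apply, Fin.sum_univ_three, cross_apply]
  · exact hx
  · ring
  · ring
  · exact hy
  · ring
  · ring
  · ring
  · linear_combination (y 0 * y 0 + y 1 * y 1 + y 2 * y 2) * hx + hy

theorem det_frame (x y : Fin 3 → ℂ) (hx : x ⬝ᵥ x = 1) (hy : y ⬝ᵥ y = 1) :
    (frame x y).det = 1 - (x ⬝ᵥ y) ^ 2 := by
  simp only [vec3_dotProduct] at *
  simp [frame, Matrix.det_fin_three, cross_apply]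
  linear_combination (y 0 * y 0 + y 1 * y 1 + y 2 * y 2) * hx + hy

theorem gramForm_frame (x y p q : Fin 3 → ℂ) (hx : x ⬝ᵥ x = 1) (hy : y ⬝ᵥ y = 1) :
    gramForm (x ⬝ᵥ y) (frame x y *ᵥ p) (frame x y *ᵥ q) = (1 - (x ⬝ᵥ y) ^ 2) * (p ⬝ᵥ q) := by
  rw [frame_mulVec, frame_mulVec]
  simp only [vec3_dotProduct] at *
  simp [gramForm, cross_apply]
  linear_combination
    ((y 0 * y 0 + y 1 * y 1 + y 2 * y 2) * (p 0 * q 0 + p 1 * q 1 + p 2 * q 2) -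
      (y 0 * q 0 + y 1 * q 1 + y 2 * q 2) * (y 0 * p 0 + y 1 * p 1 + y 2 * p 2)) * hx +
    ((p 0 * q 0 + p 1 * q 1 + p 2 * q 2) -
      (x 0 * q 0 + x 1 * q 1 + x 2 * q 2) * (x 0 * p 0 + x 1 * p 1 + x 2 * p 2)) * hy

theorem frame_mulVec_mulVec {A : Matrix (Fin 3) (Fin 3) ℂ} (hA : A * Aᵀ = 1) (hdet : A.det = 1)
    (x y p : Fin 3 → ℂ) : frame (A *ᵥ x) (A *ᵥ y) *ᵥ (A *ᵥ p) = frame x y *ᵥ p := by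
  have hA' : Aᵀ * A = 1 := mul_eq_one_comm.1 hA
  have hdot : ∀ u v : Fin 3 → ℂ, (A *ᵥ u) ⬝ᵥ (A *ᵥ v) = u ⬝ᵥ v := fun u v => by
    rw [dotProduct_mulVec, vecMul_mulVec, hA', vecMul_one]
  rw [frame_mulVec, frame_mulVec, hdot, hdot]
  have h1 : ∀ x y p : Fin 3 → ℂ, crossProduct x y ⬝ᵥ p = (Matrix.of ![x, y, p]).det := fun x y p => by
    rw [det_fin_three, vec3_dotProduct]
    simp [cross_apply]; ring
  have h2 : Matrix.of ![A *ᵥ x, A *ᵥ y, A *ᵥ p] = Matrix.of ![x, y, p] * Aᵀ := by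
    ext i j
    fin_cases i <;> simp [Matrix.mul_apply, mulVec, dotProduct, mul_comm]
  rw [h1, h1, h2, det_mul, det_transpose, hdet, mul_one]

/-- The Gram coordinates of a spherical realization. -/
def toGram (G : GeoGraph) (ρ : ℕ → Fin 3 → ℂ) : ℕ → Fin 3 → ℂ :=
  fun v => if v ∈ G.V then frame (ρ 1) (ρ 2) *ᵥ ρ v else 0

theorem toGram_of_mem {v : ℕ} (hv : v ∈ G.V) : toGram G ρ v = frame (ρ 1) (ρ 2) *ᵥ ρ v := if_pos hv

theorem SphereRealization.dotProduct_self (h : SphereRealization G ρ) {v : ℕ} (hv : v ∈ G.V) :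
    ρ v ⬝ᵥ ρ v = 1 := by
  rw [← h v hv, dotProduct]; simp [sq]

theorem dotProduct_eq_sphereGram (h : SphereRealization G ρ) (h' : SphereInduces G ρ lam) {u v : ℕ}
    (he : {u, v} ∈ G.E) : ρ u ⬝ᵥ ρ v = sphereGram lam {u, v} := by
  have hu := h u (G.edge_sub _ he (by simp))
  have hv := h v (G.edge_sub _ he (by simp))
  rw [sphereGram, ← h' u v he, vec3_dotProduct]
  simp only [Fin.sum_univ_three] at *
  linear_combination (1 / 2) * hu + (1 / 2) * hv

theorem toGram_mem (he : {1, 2} ∈ G.E) (h : SphereRealization G ρ) (h' : SphereInduces G ρ lam) :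
    toGram G ρ ∈ GramRealization G (sphereGram lam) := by
  have hV1 : 1 ∈ G.V := G.edge_sub _ he (by simp)
  have hV2 : 2 ∈ G.V := G.edge_sub _ he (by simp)
  have h1 := h.dotProduct_self hV1
  have h2 := h.dotProduct_self hV2
  have h12 := dotProduct_eq_sphereGram h h' he
  have key : ∀ {u v}, u ∈ G.V → v ∈ G.V → gramForm (sphereGram lam {1, 2}) (toGram G ρ u)
      (toGram G ρ v) = (1 - sphereGram lam {1, 2} ^ 2) * (ρ u ⬝ᵥ ρ v) := fun {u v} hu hv => by
    rw [toGram_of_mem hu, toGram_of_mem hv, ← h12, gramForm_frame _ _ _ _ h1 h2]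
  refine ⟨fun v hv => if_neg hv, ?_, ?_, fun v hv => ?_, fun u v huv => ?_⟩
  · rw [toGram_of_mem hV1, frame_mulVec, h1, dotProduct_comm, h12, dotProduct_comm, dot_self_cross]
  · rw [toGram_of_mem hV2, frame_mulVec, h2, h12, dotProduct_comm, dot_cross_self]
  · rw [key hv hv, h.dotProduct_self hv, mul_one]
  · rw [key (G.edge_sub _ huv (by simp)) (G.edge_sub _ huv (by simp)),
      dotProduct_eq_sphereGram h h' huv]

theorem toGram_congr (he : {1, 2} ∈ G.E) (h : SphereCongruent G ρ ρ') :
    toGram G ρ = toGram G ρ' := by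
  obtain ⟨A, hA, hdet, h⟩ := h
  funext v
  by_cases hv : v ∈ G.V
  · rw [toGram_of_mem hv, toGram_of_mem hv, h v hv, h 1 (G.edge_sub _ he (by simp)),
      h 2 (G.edge_sub _ he (by simp)), frame_mulVec_mulVec hA hdet]
  · rw [toGram, toGram, if_neg hv, if_neg hv]

theorem sphereCongruent_of_toGram_eq (he : {1, 2} ∈ G.E) (hw : sphereGram lam {1, 2} ^ 2 ≠ 1)
    (h : SphereRealization G ρ) (h' : SphereRealization G ρ') (hl : SphereInduces G ρ lam)
    (hl' : SphereInduces G ρ' lam) (heq : toGram G ρ = toGram G ρ') : SphereCongruent G ρ ρ' := by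
  have hV1 : 1 ∈ G.V := G.edge_sub _ he (by simp)
  have hV2 : 2 ∈ G.V := G.edge_sub _ he (by simp)
  set M := frame (ρ 1) (ρ 2)
  set M' := frame (ρ' 1) (ρ' 2)
  have hdet : M.det = 1 - sphereGram lam {1, 2} ^ 2 := by
    rw [det_frame _ _ (h.dotProduct_self hV1) (h.dotProduct_self hV2),
      dotProduct_eq_sphereGram h hl he]
  have hdet' : M'.det = 1 - sphereGram lam {1, 2} ^ 2 := by
    rw [det_frame _ _ (h'.dotProduct_self hV1) (h'.dotProduct_self hV2),
      dotProduct_eq_sphereGram h' hl' he]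
  have hmul : M * Mᵀ = M' * M'ᵀ := by
    rw [frame_mul_transpose _ _ (h.dotProduct_self hV1) (h.dotProduct_self hV2),
      frame_mul_transpose _ _ (h'.dotProduct_self hV1) (h'.dotProduct_self hV2),
      dotProduct_eq_sphereGram h hl he, dotProduct_eq_sphereGram h' hl' he]
  have h0 : 1 - sphereGram lam {1, 2} ^ 2 ≠ 0 := fun h => hw (by linear_combination -h)
  have hu : IsUnit M'.det := by rw [hdet']; exact h0.isUnit
  refine ⟨M'⁻¹ * M, ?_, ?_, fun v hv => ?_⟩
  · rw [transpose_mul, Matrix.mul_assoc, ← Matrix.mul_assoc M, hmul, Matrix.mul_assoc,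
      ← transpose_mul, nonsing_inv_mul _ hu, transpose_one, mul_one, nonsing_inv_mul _ hu]
  · rw [det_mul, det_nonsing_inv, hdet, hdet', Ring.inverse_mul_cancel _ h0.isUnit]
  · have := congrFun heq v
    rw [toGram_of_mem hv, toGram_of_mem hv] at this
    rw [← mulVec_mulVec, this, mulVec_mulVec, nonsing_inv_mul _ hu, one_mulVec]

theorem exists_toGram_eq (he : {1, 2} ∈ G.E) (hw : sphereGram lam {1, 2} ^ 2 ≠ 1)
    {q : ℕ → Fin 3 → ℂ} (hq : q ∈ GramRealization G (sphereGram lam)) :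
    ∃ ρ, SphereRealization G ρ ∧ SphereInduces G ρ lam ∧ toGram G ρ = q := by
  obtain ⟨hq0, hq1, hq2, hqV, hqE⟩ := hq
  set w := sphereGram lam {1, 2} with hwdef
  have h0 : 1 - w ^ 2 ≠ 0 := fun h => hw (by linear_combination -h)
  obtain ⟨g, hg⟩ := IsAlgClosed.exists_pow_nat_eq (1 - w ^ 2) (n := 2) (by norm_num)
  have hg0 : g ≠ 0 := fun h => h0 (by rw [← hg, h]; norm_num)
  have hV1 : 1 ∈ G.V := G.edge_sub _ he (by simp)
  have hV2 : 2 ∈ G.V := G.edge_sub _ he (by simp)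
  let ρ : ℕ → Fin 3 → ℂ := fun v => ![(q v 1 - w * q v 0) / g, q v 2 / g, q v 0]
  have hdot : ∀ u v, ρ u ⬝ᵥ ρ v = gramForm w (q u) (q v) / (1 - w ^ 2) := fun u v => by
    rw [eq_div_iff h0, ← hg]
    simp only [vec3_dotProduct, ρ, gramForm]
    simp
    field_simp
    linear_combination (q u 0 * q v 0) * hg
  have hsph : SphereRealization G ρ := fun v hv => by
    have := hdot v v
    rw [hqV v hv, div_self h0, dotProduct] at this
    simpa [sq] using this
  refine ⟨ρ, hsph, fun u v huv => ?_, ?_⟩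
  · have hu := hsph u (G.edge_sub _ huv (by simp))
    have hv := hsph v (G.edge_sub _ huv (by simp))
    have := hdot u v
    rw [hqE u v huv, mul_div_cancel_left₀ _ h0, vec3_dotProduct, sphereGram] at this
    simp only [Fin.sum_univ_three] at *
    linear_combination hu + hv - 2 * this
  · have h1 : ρ 1 = ![0, 0, 1] := by simp [ρ, hq1]
    have h2 : ρ 2 = ![g, 0, w] := by
      have : (1 - w * w) / g = g := by rw [div_eq_iff hg0]; linear_combination -hg
      simp [ρ, hq2, this]
    funext v
    by_cases hv : v ∈ G.V
    · rw [toGram_of_mem hv, frame_mulVec, h1, h2]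
      ext j
      fin_cases j
      · simp [ρ]
      · simp [ρ]; field_simp; ring
      · simp [ρ, cross_apply]; field_simp
    · rw [toGram, if_neg hv, hq0 v hv]

theorem sphereClasses_equiv (he : {1, 2} ∈ G.E) (hw : sphereGram lam {1, 2} ^ 2 ≠ 1) :
    Nonempty (SphereClasses G lam ≃ GramRealization G (sphereGram lam)) := by
  let f : SphereClasses G lam → GramRealization G (sphereGram lam) :=
    Quot.lift (fun ρ => ⟨toGram G ρ.1, toGram_mem he ρ.2.1 ρ.2.2⟩) fun ρ ρ' h =>
      Subtype.ext (toGram_congr he h)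
  refine ⟨Equiv.ofBijective f ⟨?_, ?_⟩⟩
  · rintro ⟨ρ⟩ ⟨ρ'⟩ h
    exact Quot.sound (sphereCongruent_of_toGram_eq he hw ρ.2.1 ρ'.2.1 ρ.2.2 ρ'.2.2
      (Subtype.ext_iff.1 h))
  · rintro ⟨q, hq⟩
    obtain ⟨ρ, h1, h2, h3⟩ := exists_toGram_eq he hw hq
    exact ⟨Quot.mk _ ⟨ρ, h1, h2⟩, Subtype.ext h3⟩

end Sphere

section

open Polynomial

section Class

open scoped Classical in
/-- A set of fibre points cut out by a condition on the second coordinate is preserved by the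
reflection, hence has even cardinality. -/
theorem even_card_filter_gramFiber {H : GeoGraph} {μ : Finset ℕ → ℂ} {l : ℂ} (hH : H.Tight)
    (hμ : H.IndepOn μ) (hl : l ∉ acl (μ '' H.E)) (p : ℂ → Prop) :
    Even ((gramFiber_finite hH hμ hl).toFinset.filter fun z => p (z 0 1)).card := by
  set Z := (gramFiber_finite hH hμ hl).toFinset.filter fun z => p (z 0 1)
  have hmem : ∀ z, z ∈ Z ↔ z ∈ GramFiber H μ l ∧ p (z 0 1) := fun z => by simp [Z]
  have h : ∑ _z ∈ Z, (1 : ZMod 2) = 0 := by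
    refine Finset.sum_involution (fun z _ => reflectZ z) ?_ ?_ ?_ ?_
    · intro z hz; decide
    · intro z hz _ heq
      have h1 := GramFiber.third_ne_zero hH hμ hl ((hmem z).1 hz).1
      have h2 : -z 0 2 = z 0 2 := congrFun (congrFun heq 0) 2
      exact h1 (self_eq_neg.1 h2.symm)
    · intro z hz
      exact (hmem _).2 ⟨reflectZ_mem_gramFiber ((hmem z).1 hz).1, ((hmem z).1 hz).2⟩
    · intro z hz; exact reflectZ_reflectZ z
  rw [Finset.sum_const, nsmul_one] at h
  exact (ZMod.natCast_eq_zero_iff_even).1 h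

/-- The class of a curve in terms of the degrees of its equation. -/
noncomputable def curveClass (P : ℂ[X][X]) : ℤ × ℤ × ℤ :=
  (P.natDegree / 2, (P.natDegree - (P.eval X).natDegree) / 2,
    (P.natDegree - (P.eval 0).natDegree) / 2)

variable {H : GeoGraph} {μ μ' : Finset ℕ → ℂ} {P P' : ℂ[X][X]}

theorem exists_place (hμ : H.IndepOn μ) : ∃ (l : ℂ) (𝒪 : ValuationSubring ℂ),
    l ∉ acl (μ '' H.E) ∧ (∀ y ∈ acl (μ '' H.E), y ∈ 𝒪) ∧ l ∉ 𝒪 := by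
  obtain ⟨l, hl⟩ := exists_notMem_acl hμ
  obtain ⟨𝒪, h1, h2⟩ := exists_valuationSubring_notMem hl
  exact ⟨l, 𝒪, hl, h1, h2⟩

open scoped Classical in
theorem IsCurve.curveClass_eq (hH : H.Tight) (hμ : H.IndepOn μ) (hP : IsCurve H μ P) {l : ℂ}
    {𝒪 : ValuationSubring ℂ} (h𝒪 : ∀ y ∈ acl (μ '' H.E), y ∈ 𝒪) (hl : l ∉ 𝒪)
    (hl' : l ∉ acl (μ '' H.E)) :
    curveClass P = (((gramFiber_finite hH hμ hl').toFinset.card : ℤ) / 2,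
      (((gramFiber_finite hH hμ hl').toFinset.filter fun z => l - z 0 1 ∈ 𝒪).card : ℤ) / 2,
      (((gramFiber_finite hH hμ hl').toFinset.filter fun z => z 0 1 ∈ 𝒪).card : ℤ) / 2) := by
  have h1 := hP.natDegree_eval_X hH hμ h𝒪 hl hl'
  have h2 := hP.natDegree_eval_zero hH hμ h𝒪 hl hl'
  have h3 := hP.natDegree_eq hH hμ hl'
  rw [Set.ncard_eq_toFinset_card _ (gramFiber_finite hH hμ hl')] at h3
  simp only [curveClass, ← h3, Prod.mk.injEq, true_and]
  constructor
  · congr 1; omega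
  · congr 1; omega

theorem IsCurve.curveClass_spec (hH : H.Tight) (hμ : H.IndepOn μ) (hP : IsCurve H μ P) :
    (P.natDegree : ℤ) = 2 * (curveClass P).1 ∧
      (P.natDegree : ℤ) - (P.eval X).natDegree = 2 * (curveClass P).2.1 ∧
      (P.natDegree : ℤ) - (P.eval 0).natDegree = 2 * (curveClass P).2.2 := by
  classical
  obtain ⟨l, 𝒪, hl', h𝒪, hl⟩ := exists_place hμ
  have h1 := hP.natDegree_eval_X hH hμ h𝒪 hl hl'
  have h2 := hP.natDegree_eval_zero hH hμ h𝒪 hl hl'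
  have h3 := hP.natDegree_eq hH hμ hl'
  rw [Set.ncard_eq_toFinset_card _ (gramFiber_finite hH hμ hl')] at h3
  have e1 := even_card_filter_gramFiber hH hμ hl' fun t => l - t ∈ 𝒪
  have e2 := even_card_filter_gramFiber hH hμ hl' fun t => t ∈ 𝒪
  have e3 := even_card_filter_gramFiber hH hμ hl' fun _ => True
  simp only [Finset.filter_true] at e3
  obtain ⟨a, e1⟩ := e1
  obtain ⟨b, e2⟩ := e2
  obtain ⟨c, e3⟩ := e3
  simp only [curveClass]
  omega

theorem IsCurve.curveClass_congr (hH : H.Tight) (hμ : H.IndepOn μ) (hμ' : H.IndepOn μ')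
    (hP : IsCurve H μ P) (hP' : IsCurve H μ' P') : curveClass P = curveClass P' := by
  obtain ⟨σ, hσ⟩ := exists_ringEquiv_of_algebraicIndependent hμ hμ'
  have h1 := hP.map_ringEquiv hH hμ σ fun e he => hσ ⟨e, he⟩
  have h2 : curveClass (P.map (mapRingHom (σ : ℂ →+* ℂ))) = curveClass P := by
    have hX : (P.map (mapRingHom (σ : ℂ →+* ℂ))).eval X = (P.eval X).map (σ : ℂ →+* ℂ) := by
      have := eval₂_at_apply (p := P) (mapRingHom (σ : ℂ →+* ℂ)) X
      rw [← eval_map, coe_mapRingHom, map_X] at this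
      exact this
    have h0 : (P.map (mapRingHom (σ : ℂ →+* ℂ))).eval 0 = (P.eval 0).map (σ : ℂ →+* ℂ) := by
      have := eval₂_at_apply (p := P) (mapRingHom (σ : ℂ →+* ℂ)) 0
      rw [← eval_map, coe_mapRingHom, Polynomial.map_zero] at this
      exact this
    rw [curveClass, hX, h0, natDegree_map_eq_of_injective (σ : ℂ →+* ℂ).injective,
      natDegree_map_eq_of_injective (σ : ℂ →+* ℂ).injective, hP.monic.natDegree_map]
    rfl
  obtain ⟨l, 𝒪, hl', h𝒪, hl⟩ := exists_place hμ'
  classical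
  rw [← h2, h1.curveClass_eq hH hμ' h𝒪 hl hl', hP'.curveClass_eq hH hμ' h𝒪 hl hl']

theorem exists_indepOn_isCurve (hH : H.Tight) : ∃ (μ : Finset ℕ → ℂ) (P : ℂ[X][X]),
    H.IndepOn μ ∧ IsCurve H μ P := by
  classical
  obtain ⟨f, hf⟩ := exists_algebraicIndependent_complex H.E
  have hμ : H.IndepOn fun e => if h : e ∈ H.E then f ⟨e, h⟩ else 0 := by
    have h : (fun e : H.E => if h : e.1 ∈ H.E then f ⟨e.1, h⟩ else 0) = f := by
      funext e; simp
    unfold GeoGraph.IndepOn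
    rwa [h]
  obtain ⟨P, hP⟩ := exists_isCurve hH hμ
  exact ⟨_, P, hμ, hP⟩

/-- The class of a graph: the class of the curve of positions of the vertex `0`. -/
noncomputable def graphClass (hH : H.Tight) : ℤ × ℤ × ℤ :=
  curveClass (exists_indepOn_isCurve hH).choose_spec.choose

theorem IsCurve.curveClass_eq_graphClass (hH : H.Tight) (hμ : H.IndepOn μ) (hP : IsCurve H μ P) :
    curveClass P = graphClass hH := by
  obtain ⟨h1, h2⟩ := (exists_indepOn_isCurve hH).choose_spec.choose_spec
  exact hP.curveClass_congr hH hμ h1 h2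

theorem IsSplit.ncard_eq_graphClass {G G₁ G₂ : GeoGraph} (hs : IsSplit G G₁ G₂) (h1 : G₁.Tight)
    (h2 : G₂.Tight) (hμ : G.IndepOn μ) :
    (GramRealization G μ).Finite ∧ ((GramRealization G μ).ncard : ℤ) =
      2 * ((graphClass h1).1 * (graphClass h2).1 - (graphClass h1).2.1 * (graphClass h2).2.1 -
        (graphClass h1).2.2 * (graphClass h2).2.2) := by
  have hμ₁ := hs.indepOn_left hμ
  have hμ₂ := hs.symm.indepOn_left hμ
  obtain ⟨P₁, hP₁⟩ := exists_isCurve h1 hμ₁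
  obtain ⟨P₂, hP₂⟩ := exists_isCurve h2 hμ₂
  obtain ⟨hfin, hN⟩ := hs.ncard_gramRealization h1 h2 hμ hP₁ hP₂
  refine ⟨hfin, ?_⟩
  have hr := (hs.natDegree_resultant h1 h2 hμ hP₁ hP₂).2
  obtain ⟨a1, b1, c1⟩ := hP₁.curveClass_spec h1 hμ₁
  obtain ⟨a2, b2, c2⟩ := hP₂.curveClass_spec h2 hμ₂
  rw [hP₁.curveClass_eq_graphClass h1 hμ₁] at a1 b1 c1
  rw [hP₂.curveClass_eq_graphClass h2 hμ₂] at a2 b2 c2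
  rw [← hN, b1, b2, c1, c2, a1, a2] at hr
  push_cast at hr
  linarith

theorem Calligraph.tight (h : Calligraph H) : H.Tight := ⟨h.1, h.2.1, h.2.2.1⟩

theorem Generic.indepOn_sphereGram {lam : Finset ℕ → ℝ} (h : Generic H lam) :
    H.IndepOn (sphereGram lam) := by
  have h1 := h.2.map_ringHom Complex.ofRealHom
  refine (algebraicIndependent_of_card_le h1 (fun e => ?_) le_rfl).1
  have h2 : sphereGram lam e ∈ acl (Set.range fun e : H.E => sphereGram lam e) :=
    subset_acl _ ⟨e, rfl⟩
  have h3 : Complex.ofRealHom (lam e) = 2 * (1 - sphereGram lam e) := by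
    simp [sphereGram]; ring
  show Complex.ofRealHom (lam e) ∈ _
  rw [h3]
  exact mul_mem (ofNat_mem _ 2) (sub_mem (one_mem _) h2)

end Class

section Basic

theorem Finset.pair_eq_pair_iff' {u v a b : ℕ} :
    ({u, v} : Finset ℕ) = {a, b} ↔ u = a ∧ v = b ∨ u = b ∧ v = a := by
  rw [← Finset.coe_inj, Finset.coe_pair, Finset.coe_pair, Set.pair_eq_pair_iff]

theorem gramForm_comm {F : Type*} [Field F] (w : F) (p q : Fin 3 → F) :
    gramForm w p q = gramForm w q p := by
  simp only [gramForm]; ring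

theorem gramForm_left_frame {F : Type*} [Field F] (w : F) (p : Fin 3 → F) :
    gramForm w p ![1, w, 0] = (1 - w ^ 2) * p 0 := by
  simp [gramForm]; ring

theorem gramForm_right_frame {F : Type*} [Field F] (w : F) (p : Fin 3 → F) :
    gramForm w p ![w, 1, 0] = (1 - w ^ 2) * p 1 := by
  simp [gramForm]; ring

theorem ValuationSubring.mem_of_quadratic {F : Type*} [Field F] {𝒪 : ValuationSubring F}
    {k b c s : F} (hk : k ≠ 0) (hk' : k⁻¹ ∈ 𝒪) (hb : b ∈ 𝒪) (hc : c ∈ 𝒪)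
    (h : k * s ^ 2 = b * s + c) : s ∈ 𝒪 := by
  by_contra hs
  have h0 : s ≠ 0 := fun h0 => hs (h0 ▸ ZeroMemClass.zero_mem _)
  have h1 : s = k⁻¹ * (b + c * s⁻¹) := by
    field_simp
    linear_combination h
  apply hs
  rw [h1]
  exact MulMemClass.mul_mem hk' (AddMemClass.add_mem hb (MulMemClass.mul_mem hc
    (inv_mem_of_notMem hs)))

theorem AlgebraicIndependent.aeval_ne_zero_of_constantCoeff {F : Type*} [Field F] [CharZero F]
    {ι : Type*} {f : ι → F} (hf : AlgebraicIndependent ℚ f) {p : MvPolynomial ι ℚ}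
    (hp : MvPolynomial.constantCoeff p ≠ 0) : MvPolynomial.aeval f p ≠ 0 := by
  intro h
  apply hp
  rw [(injective_iff_map_eq_zero _).1 hf p h, map_zero]

/-- The position of the vertices `1` and `2` in Gram coordinates, completed by positions of the
vertices `0` and `3`. -/
def gramPlacement (w : ℂ) (p r : Fin 3 → ℂ) : ℕ → Fin 3 → ℂ
  | 0 => p
  | 1 => ![1, w, 0]
  | 2 => ![w, 1, 0]
  | 3 => r
  | _ => 0

variable {H : GeoGraph} {μ : Finset ℕ → ℂ} {P : ℂ[X][X]} {l : ℂ} {z : ℕ → Fin 3 → ℂ}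

theorem GramRealization.coord_zero (hw : μ {1, 2} ^ 2 ≠ 1) (hz : z ∈ GramRealization H μ) {v : ℕ}
    (h : {v, 1} ∈ H.E) : z v 0 = μ {v, 1} := by
  have h1 := hz.2.2.2.2 v 1 h
  rw [hz.2.1, gramForm_left_frame] at h1
  exact mul_left_cancel₀ (fun h => hw (by linear_combination -h)) h1

theorem GramRealization.coord_one (hw : μ {1, 2} ^ 2 ≠ 1) (hz : z ∈ GramRealization H μ) {v : ℕ}
    (h : {v, 2} ∈ H.E) : z v 1 = μ {v, 2} := by
  have h1 := hz.2.2.2.2 v 2 h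
  rw [hz.2.2.1, gramForm_right_frame] at h1
  exact mul_left_cancel₀ (fun h => hw (by linear_combination -h)) h1

theorem gramForm_of_forall_edges {w : ℂ} (h : ∀ e ∈ H.E, ∃ u v, e = {u, v} ∧
    gramForm w (z u) (z v) = (1 - w ^ 2) * μ e) {u v : ℕ} (he : {u, v} ∈ H.E) :
    gramForm w (z u) (z v) = (1 - w ^ 2) * μ {u, v} := by
  obtain ⟨a, b, h1, h2⟩ := h _ he
  obtain ⟨rfl, rfl⟩ | ⟨rfl, rfl⟩ := Finset.pair_eq_pair_iff'.1 h1
  · exact h2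
  · rw [gramForm_comm]; exact h2

theorem card_gramFiber_of_forall_eq (hV : H.V = {0, 1, 2}) (hH : H.Tight) (hμ : H.IndepOn μ)
    (hl : l ∉ acl (μ '' H.E)) (hz : z ∈ GramFiber H μ l) (h : ∀ z' ∈ GramFiber H μ l, z' 0 1 = z 0 1) :
    (gramFiber_finite hH hμ hl).toFinset.card = 2 := by
  have hne : z ≠ reflectZ z := fun heq => by
    have h2 : z 0 2 = -z 0 2 := congrFun (congrFun heq 0) 2
    exact GramFiber.third_ne_zero hH hμ hl hz (self_eq_neg.1 h2)
  rw [← Set.ncard_eq_toFinset_card _ (gramFiber_finite hH hμ hl), ← Set.ncard_pair hne]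
  congr 1
  refine Set.Subset.antisymm (fun z' hz' => ?_) ?_
  · have key : ∀ y ∈ GramFiber H μ l, z' 0 = y 0 → z' = y := by
      intro y hy h0
      funext v
      by_cases hv : v ∈ H.V
      · rw [hV] at hv
        simp only [Finset.mem_insert, Finset.mem_singleton] at hv
        obtain rfl | rfl | rfl := hv
        · exact h0
        · rw [hz'.1.2.1, hy.1.2.1]
        · rw [hz'.1.2.2.1, hy.1.2.2.1]
      · rw [hz'.1.1 v hv, hy.1.1 v hv]
    have hV0 : 0 ∈ H.V := hH.sub (by simp)
    have h1 := h z' hz'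
    have h0 : z' 0 0 = z 0 0 := by linear_combination hz'.2 - hz.2 - h1
    rcases eq_or_reflectZ hV0 hV0 hz'.1 hz.1 h0 h1 with h2 | h2
    · exact Or.inl (key z hz h2)
    · exact Or.inr (key _ (reflectZ_mem_gramFiber hz) h2)
  · rintro _ (rfl | rfl)
    exacts [hz, reflectZ_mem_gramFiber hz]

theorem gramPlacement_mem_of_verts (hV : H.V = {0, 1, 2}) {p : Fin 3 → ℂ}
    (hp : gramForm (μ {1, 2}) p p = 1 - μ {1, 2} ^ 2)
    (h : ∀ e ∈ H.E, ∃ u v, e = {u, v} ∧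
      gramForm (μ {1, 2}) (gramPlacement (μ {1, 2}) p 0 u) (gramPlacement (μ {1, 2}) p 0 v) =
        (1 - μ {1, 2} ^ 2) * μ e) : gramPlacement (μ {1, 2}) p 0 ∈ GramRealization H μ := by
  refine ⟨fun v hv => ?_, rfl, rfl, fun v hv => ?_, fun u v he => gramForm_of_forall_edges h he⟩
  · rw [hV] at hv
    match v, hv with
    | 0, hv | 1, hv | 2, hv => simp at hv
    | 3, _ => rfl
    | n + 4, _ => rfl
  · rw [hV] at hv
    simp only [Finset.mem_insert, Finset.mem_singleton] at hv
    obtain rfl | rfl | rfl := hv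
    · exact hp
    · show gramForm _ ![1, _, 0] ![1, _, 0] = _
      rw [gramForm_left_frame]; simp
    · show gramForm _ ![_, 1, 0] ![_, 1, 0] = _
      rw [gramForm_right_frame]; simp

theorem graphClass_left (hV : H.V = {0, 1, 2}) (hE : H.E = {{1, 2}, {0, 1}}) (hH : H.Tight) :
    graphClass hH = (1, 1, 0) := by
  classical
  obtain ⟨μ, P, hμ, hP⟩ := exists_indepOn_isCurve hH
  obtain ⟨l, 𝒪, hl', h𝒪, hl⟩ := exists_place hμ
  have hw := hμ.sq_ne_one hH
  have h01 : {0, 1} ∈ H.E := by simp [hE]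
  have hm : μ {0, 1} ∈ 𝒪 := h𝒪 _ (subset_acl _ ⟨_, h01, rfl⟩)
  have hs : ∀ z ∈ GramFiber H μ l, z 0 1 = l - μ {0, 1} := fun z hz => by
    rw [← hz.2, GramRealization.coord_zero hw hz.1 h01]; ring
  obtain ⟨d, hd⟩ := IsAlgClosed.exists_pow_nat_eq (1 - μ {1, 2} ^ 2 - μ {0, 1} ^ 2 -
    (l - μ {0, 1}) ^ 2 + 2 * μ {1, 2} * μ {0, 1} * (l - μ {0, 1})) (n := 2) (by norm_num)
  have hz : gramPlacement (μ {1, 2}) ![μ {0, 1}, l - μ {0, 1}, d] 0 ∈ GramFiber H μ l := by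
    refine ⟨gramPlacement_mem_of_verts hV ?_ ?_, ?_⟩
    · simp [gramForm]; linear_combination hd
    · intro e he
      rw [hE] at he
      simp only [Finset.mem_insert, Finset.mem_singleton] at he
      obtain rfl | rfl := he
      · refine ⟨1, 2, rfl, (gramForm_right_frame _ _).trans ?_⟩
        simp [gramPlacement]
      · refine ⟨0, 1, rfl, (gramForm_left_frame _ _).trans ?_⟩
        simp [gramPlacement]
    · simp [gramPlacement]
  rw [← hP.curveClass_eq_graphClass hH hμ, hP.curveClass_eq hH hμ h𝒪 hl hl',
    Finset.filter_true_of_mem, Finset.filter_false_of_mem,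
    card_gramFiber_of_forall_eq hV hH hμ hl' hz fun z' hz' => by rw [hs _ hz', hs _ hz]]
  · norm_num
  · intro z hz h
    rw [hs z ((Set.Finite.mem_toFinset _).1 hz)] at h
    exact hl (by simpa using AddMemClass.add_mem h hm)
  · intro z hz
    rw [hs z ((Set.Finite.mem_toFinset _).1 hz)]
    simpa using hm

theorem graphClass_right (hV : H.V = {0, 1, 2}) (hE : H.E = {{1, 2}, {0, 2}}) (hH : H.Tight) :
    graphClass hH = (1, 0, 1) := by
  classical
  obtain ⟨μ, P, hμ, hP⟩ := exists_indepOn_isCurve hH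
  obtain ⟨l, 𝒪, hl', h𝒪, hl⟩ := exists_place hμ
  have hw := hμ.sq_ne_one hH
  have h02 : {0, 2} ∈ H.E := by simp [hE]
  have hm : μ {0, 2} ∈ 𝒪 := h𝒪 _ (subset_acl _ ⟨_, h02, rfl⟩)
  have hs : ∀ z ∈ GramFiber H μ l, z 0 1 = μ {0, 2} := fun z hz => GramRealization.coord_one hw hz.1 h02
  obtain ⟨d, hd⟩ := IsAlgClosed.exists_pow_nat_eq (1 - μ {1, 2} ^ 2 - μ {0, 2} ^ 2 -
    (l - μ {0, 2}) ^ 2 + 2 * μ {1, 2} * μ {0, 2} * (l - μ {0, 2})) (n := 2) (by norm_num)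
  have hz : gramPlacement (μ {1, 2}) ![l - μ {0, 2}, μ {0, 2}, d] 0 ∈ GramFiber H μ l := by
    refine ⟨gramPlacement_mem_of_verts hV ?_ ?_, ?_⟩
    · simp [gramForm]; linear_combination hd
    · intro e he
      rw [hE] at he
      simp only [Finset.mem_insert, Finset.mem_singleton] at he
      obtain rfl | rfl := he
      · refine ⟨1, 2, rfl, (gramForm_right_frame _ _).trans ?_⟩
        simp [gramPlacement]
      · refine ⟨0, 2, rfl, (gramForm_right_frame _ _).trans ?_⟩
        simp [gramPlacement]
    · simp [gramPlacement]
  rw [← hP.curveClass_eq_graphClass hH hμ, hP.curveClass_eq hH hμ h𝒪 hl hl',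
    Finset.filter_false_of_mem, Finset.filter_true_of_mem,
    card_gramFiber_of_forall_eq hV hH hμ hl' hz fun z' hz' => by rw [hs _ hz', hs _ hz]]
  · norm_num
  · intro z hz
    rw [hs z ((Set.Finite.mem_toFinset _).1 hz)]
    exact hm
  · intro z hz h
    rw [hs z ((Set.Finite.mem_toFinset _).1 hz)] at h
    exact hl (by simpa using AddMemClass.add_mem h hm)

end Basic

section Center

variable {H : GeoGraph} {μ : Finset ℕ → ℂ} {l : ℂ} {z : ℕ → Fin 3 → ℂ}

/-- In the center calligraph, the Gram coordinates of `0` and `3` satisfy these equations. -/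
theorem mem_gramFiber_center_iff (hV : H.V = {0, 1, 2, 3})
    (hE : H.E = {{1, 2}, {0, 3}, {1, 3}, {2, 3}}) (hw : μ {1, 2} ^ 2 ≠ 1) :
    z ∈ GramFiber H μ l ↔ ∃ s d₀ d, z = gramPlacement (μ {1, 2}) ![s, l - s, d₀] ![μ {1, 3}, μ {2, 3}, d] ∧
      d ^ 2 = 1 - μ {1, 2} ^ 2 - μ {1, 3} ^ 2 - μ {2, 3} ^ 2 + 2 * μ {1, 2} * μ {1, 3} * μ {2, 3} ∧
      d₀ ^ 2 = 1 - μ {1, 2} ^ 2 - s ^ 2 - (l - s) ^ 2 + 2 * μ {1, 2} * s * (l - s) ∧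
      d₀ * d = (1 - μ {1, 2} ^ 2) * μ {0, 3} - s * (μ {1, 3} - μ {1, 2} * μ {2, 3}) -
        (l - s) * (μ {2, 3} - μ {1, 2} * μ {1, 3}) := by
  have e31 : ({3, 1} : Finset ℕ) = {1, 3} := Finset.pair_comm _ _
  have e32 : ({3, 2} : Finset ℕ) = {2, 3} := Finset.pair_comm _ _
  constructor
  · intro hz
    have h1 : z 3 0 = μ {1, 3} := e31 ▸ GramRealization.coord_zero hw hz.1 (by rw [e31, hE]; simp)
    have h2 : z 3 1 = μ {2, 3} := e32 ▸ GramRealization.coord_one hw hz.1 (by rw [e32, hE]; simp)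
    have h3 := hz.1.2.2.2.1 3 (by rw [hV]; simp)
    have h0 := hz.1.2.2.2.1 0 (by rw [hV]; simp)
    have h4 := hz.1.2.2.2.2 0 3 (by rw [hE]; simp)
    have ht : z 0 1 = l - z 0 0 := by rw [← hz.2]; ring
    simp only [gramForm, h1, h2, ht] at h3 h0 h4
    refine ⟨z 0 0, z 0 2, z 3 2, ?_, by linear_combination h3, by linear_combination h0,
      by linear_combination h4⟩
    funext v
    match v with
    | 0 => funext j; fin_cases j <;> simp [gramPlacement, ht]
    | 1 => exact hz.1.2.1
    | 2 => exact hz.1.2.2.1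
    | 3 => funext j; fin_cases j <;> simp [gramPlacement, h1, h2]
    | n + 4 => exact hz.1.1 _ (by rw [hV]; simp)
  · rintro ⟨s, d₀, d, rfl, h1, h2, h3⟩
    refine ⟨⟨fun v hv => ?_, rfl, rfl, fun v hv => ?_,
      fun u v he => gramForm_of_forall_edges ?_ he⟩, by simp [gramPlacement]⟩
    · rw [hV] at hv
      match v, hv with
      | 0, hv | 1, hv | 2, hv | 3, hv => simp at hv
      | n + 4, _ => rfl
    · rw [hV] at hv
      simp only [Finset.mem_insert, Finset.mem_singleton] at hv
      obtain rfl | rfl | rfl | rfl := hv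
      · simp [gramForm, gramPlacement]; linear_combination h2
      · simp [gramForm, gramPlacement]; ring
      · simp [gramForm, gramPlacement]; ring
      · simp [gramForm, gramPlacement]; linear_combination h1
    · intro e he
      rw [hE] at he
      simp only [Finset.mem_insert, Finset.mem_singleton] at he
      obtain rfl | rfl | rfl | rfl := he
      · exact ⟨1, 2, rfl, by simp [gramForm, gramPlacement]; ring⟩
      · exact ⟨0, 3, rfl, by simp [gramForm, gramPlacement]; linear_combination h3⟩
      · exact ⟨1, 3, rfl, by simp [gramForm, gramPlacement]; ring⟩
      · exact ⟨2, 3, rfl, by simp [gramForm, gramPlacement]; ring⟩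

/-- Nonvanishing of the determinant of the vectors `1`, `2`, `3`, and of the leading coefficient and
discriminant of the quadratic equation for the position of `0` in the center calligraph. -/
theorem center_ne_zero (hE : H.E = {{1, 2}, {0, 3}, {1, 3}, {2, 3}}) (hμ : H.IndepOn μ)
    (hl : l ∉ acl (μ '' H.E)) {w a b m δ α β κ : ℂ} (hw : w = μ {1, 2}) (ha : a = μ {1, 3})
    (hb : b = μ {2, 3}) (hm : m = μ {0, 3})
    (hδ : δ = 1 - w ^ 2 - a ^ 2 - b ^ 2 + 2 * w * a * b) (hα : α = (1 + w) * (a - b))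
    (hβ : β = (1 - w ^ 2) * m - l * (b - w * a)) (hκ : κ = (2 + 2 * w) * δ + α ^ 2) :
    δ ≠ 0 ∧ κ ≠ 0 ∧ ((2 + 2 * w) * l * δ + 2 * α * β) ^ 2 -
      4 * κ * (δ * l ^ 2 + β ^ 2 - (1 - w ^ 2) * δ) ≠ 0 := by
  have hf := hμ.option hl
  have key := fun p => hf.aeval_ne_zero_of_constantCoeff (p := p)
  have hx : ∀ e ∈ H.E, ∃ X : MvPolynomial (Option H.E) ℚ, X.aeval (fun i : Option H.E =>
      i.elim l fun e => μ e) = μ e ∧ X.constantCoeff = 0 := fun e he =>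
    ⟨.X (some ⟨e, he⟩), by simp, by simp⟩
  obtain ⟨W, hW, hW0⟩ := hx {1, 2} (by simp [hE])
  obtain ⟨A, hA, hA0⟩ := hx {1, 3} (by simp [hE])
  obtain ⟨B, hB, hB0⟩ := hx {2, 3} (by simp [hE])
  obtain ⟨M, hM, hM0⟩ := hx {0, 3} (by simp [hE])
  obtain ⟨N, hN, hN0⟩ : ∃ X : MvPolynomial (Option H.E) ℚ, X.aeval (fun i : Option H.E =>
      i.elim l fun e => μ e) = l ∧ X.constantCoeff = 0 := ⟨.X none, by simp, by simp⟩
  have c2 : MvPolynomial.constantCoeff (2 : MvPolynomial (Option H.E) ℚ) = 2 := map_ofNat _ 2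
  have c4 : MvPolynomial.constantCoeff (4 : MvPolynomial (Option H.E) ℚ) = 4 := map_ofNat _ 4
  rw [← hw] at hW
  rw [← ha] at hA
  rw [← hb] at hB
  rw [← hm] at hM
  obtain ⟨D, hD, hD0⟩ : ∃ X : MvPolynomial (Option H.E) ℚ, X.aeval (fun i : Option H.E =>
      i.elim l fun e => μ e) = δ ∧ X.constantCoeff = 1 :=
    ⟨1 - W ^ 2 - A ^ 2 - B ^ 2 + 2 * W * A * B,
      by simp only [map_sub, map_add, map_mul, map_pow, map_one, map_ofNat, hW, hA, hB, hδ],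
      by simp [hW0, hA0, hB0]⟩
  obtain ⟨P, hP, hP0⟩ : ∃ X : MvPolynomial (Option H.E) ℚ, X.aeval (fun i : Option H.E =>
      i.elim l fun e => μ e) = α ∧ X.constantCoeff = 0 :=
    ⟨(1 + W) * (A - B),
      by simp only [map_sub, map_add, map_mul, map_one, hW, hA, hB, hα],
      by simp [hA0, hB0]⟩
  obtain ⟨Q, hQ, hQ0⟩ : ∃ X : MvPolynomial (Option H.E) ℚ, X.aeval (fun i : Option H.E =>
      i.elim l fun e => μ e) = β ∧ X.constantCoeff = 0 :=
    ⟨(1 - W ^ 2) * M - N * (B - W * A),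
      by simp only [map_sub, map_mul, map_pow, map_one, hW, hA, hB, hM, hN, hβ],
      by simp [hM0, hN0]⟩
  obtain ⟨K, hK, hK0⟩ : ∃ X : MvPolynomial (Option H.E) ℚ, X.aeval (fun i : Option H.E =>
      i.elim l fun e => μ e) = κ ∧ X.constantCoeff = 2 :=
    ⟨(2 + 2 * W) * D + P ^ 2,
      by simp only [map_add, map_mul, map_pow, map_ofNat, hW, hD, hP, hκ],
      by simp [c2, hW0, hD0, hP0]⟩
  refine ⟨hD ▸ key D (by simp [hD0]), hK ▸ key K (by simp [hK0]), ?_⟩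
  have h := key (((2 + 2 * W) * N * D + 2 * P * Q) ^ 2 -
    4 * K * (D * N ^ 2 + Q ^ 2 - (1 - W ^ 2) * D)) (by
      simp [c2, c4, hW0, hN0, hD0, hP0, hQ0, hK0])
  simpa only [map_sub, map_add, map_mul, map_pow, map_one, map_ofNat, hW, hN, hD, hP, hQ, hK]
    using h

theorem card_gramFiber_center (hV : H.V = {0, 1, 2, 3})
    (hE : H.E = {{1, 2}, {0, 3}, {1, 3}, {2, 3}}) (hw : μ {1, 2} ^ 2 ≠ 1) (hμ : H.IndepOn μ)
    (hl : l ∉ acl (μ '' H.E)) : (GramFiber H μ l).ncard = 4 := by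
  classical
  obtain ⟨w, hw'⟩ : ∃ w, w = μ {1, 2} := ⟨_, rfl⟩
  obtain ⟨a, ha⟩ : ∃ a, a = μ {1, 3} := ⟨_, rfl⟩
  obtain ⟨b, hb⟩ : ∃ b, b = μ {2, 3} := ⟨_, rfl⟩
  obtain ⟨m, hm⟩ : ∃ m, m = μ {0, 3} := ⟨_, rfl⟩
  obtain ⟨δ, hδ⟩ : ∃ δ, δ = 1 - w ^ 2 - a ^ 2 - b ^ 2 + 2 * w * a * b := ⟨_, rfl⟩
  obtain ⟨α, hα⟩ : ∃ α, α = (1 + w) * (a - b) := ⟨_, rfl⟩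
  obtain ⟨β, hβ⟩ : ∃ β, β = (1 - w ^ 2) * m - l * (b - w * a) := ⟨_, rfl⟩
  obtain ⟨κ, hκ⟩ : ∃ κ, κ = (2 + 2 * w) * δ + α ^ 2 := ⟨_, rfl⟩
  obtain ⟨h1, h2, h3⟩ := center_ne_zero hE hμ hl hw' ha hb hm hδ hα hβ hκ
  obtain ⟨d, hd⟩ := IsAlgClosed.exists_pow_nat_eq δ (n := 2) (by norm_num)
  obtain ⟨r, hr⟩ := IsAlgClosed.exists_pow_nat_eq (((2 + 2 * w) * l * δ + 2 * α * β) ^ 2 -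
      4 * κ * (δ * l ^ 2 + β ^ 2 - (1 - w ^ 2) * δ)) (n := 2) (by norm_num)
  obtain ⟨c, hc⟩ : ∃ c, c = (2 + 2 * w) * l * δ + 2 * α * β := ⟨_, rfl⟩
  rw [← hc] at hr h3
  have hd0 : d ≠ 0 := by rintro rfl; exact h1 (by rw [← hd]; simp)
  have hr0 : r ≠ 0 := by rintro rfl; exact h3 (by rw [← hr]; simp)
  have hquad : ∀ s, κ * (s * s) + -c * s + (δ * l ^ 2 + β ^ 2 - (1 - w ^ 2) * δ) = 0 ↔
      s = (- -c + r) / (2 * κ) ∨ s = (- -c - r) / (2 * κ) := fun s =>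
    quadratic_eq_zero_iff h2 (by rw [discrim]; linear_combination -hr) s
  set s₁ := (- -c + r) / (2 * κ) with hs₁
  set s₂ := (- -c - r) / (2 * κ) with hs₂
  have hs : s₁ ≠ s₂ := by
    rw [hs₁, hs₂]
    intro h
    field_simp at h
    exact hr0 (by linear_combination h / 2)
  let Φ : ℂ × ℂ → ℕ → Fin 3 → ℂ := fun y =>
    gramPlacement w ![y.2, l - y.2, (β - α * y.2) / y.1] ![a, b, y.1]
  have hΦ : Function.Injective Φ := by
    intro y y' h
    exact Prod.ext (congrFun (congrFun h 3) 2) (congrFun (congrFun h 0) 0)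
  have hfib : GramFiber H μ l = ((({d, -d} : Finset ℂ) ×ˢ ({s₁, s₂} : Finset ℂ)).image Φ : Finset _) := by
    ext z
    rw [mem_gramFiber_center_iff hV hE hw, ← hw', ← ha, ← hb, ← hm, ← hδ]
    simp only [Finset.coe_image, Set.mem_image, Finset.mem_coe, Finset.mem_product, Finset.mem_insert,
      Finset.mem_singleton, Prod.exists]
    constructor
    · rintro ⟨s, d₀, e, rfl, e1, e2, e3⟩
      have he : e = d ∨ e = -d := sq_eq_sq_iff_eq_or_eq_neg.1 (by rw [e1, hd])
      have he0 : e ≠ 0 := by rintro rfl; exact h1 (by rw [← e1]; simp)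
      have e4 : d₀ * e = β - α * s := by rw [e3, hβ, hα]; ring
      refine ⟨e, s, ⟨he, (hquad s).1 ?_⟩, ?_⟩
      · have e5 : d₀ ^ 2 * δ = (β - α * s) ^ 2 := by rw [← e4, ← e1]; ring
        rw [e2] at e5
        rw [hκ, hc]
        linear_combination -e5
      · simp only [Φ]
        rw [← e4, mul_div_cancel_right₀ _ he0]
    · rintro ⟨e, s, ⟨he, hs⟩, rfl⟩
      have e1 : e ^ 2 = δ := by rw [← hd]; exact sq_eq_sq_iff_eq_or_eq_neg.2 he
      have he0 : e ≠ 0 := by rintro rfl; exact h1 (by rw [← e1]; simp)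
      have e5 := (hquad s).2 hs
      refine ⟨s, _, e, rfl, e1, ?_, ?_⟩
      · rw [div_pow, e1, div_eq_iff h1]
        rw [hκ, hc] at e5
        linear_combination e5
      · rw [div_mul_cancel₀ _ he0, hβ, hα]; ring
  rw [hfib, Set.ncard_coe_finset, Finset.card_image_of_injective _ hΦ, Finset.card_product,
    Finset.card_pair hs, Finset.card_pair (fun h => hd0 (self_eq_neg.1 h))]

theorem graphClass_center (hV : H.V = {0, 1, 2, 3})
    (hE : H.E = {{1, 2}, {0, 3}, {1, 3}, {2, 3}}) (hH : H.Tight) :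
    graphClass hH = (2, 0, 0) := by
  classical
  obtain ⟨μ, P, hμ, hP⟩ := exists_indepOn_isCurve hH
  obtain ⟨l, 𝒪, hl', h𝒪, hl⟩ := exists_place hμ
  have hw := hμ.sq_ne_one hH
  have hmem : ∀ e ∈ H.E, μ e ∈ acl (μ '' H.E) := fun e he => subset_acl _ ⟨e, he, rfl⟩
  have hw' := hmem {1, 2} (by simp [hE])
  have ha := hmem {1, 3} (by simp [hE])
  have hb := hmem {2, 3} (by simp [hE])
  have hm := hmem {0, 3} (by simp [hE])
  have ha1 : μ {1, 3} ^ 2 ≠ 1 := AlgebraicIndependent.sq_ne_one hμ ⟨_, by simp [hE]⟩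
  have hb1 : μ {2, 3} ^ 2 ≠ 1 := AlgebraicIndependent.sq_ne_one hμ ⟨_, by simp [hE]⟩
  have step : ∀ {w a b m s t : ℂ}, w ∈ acl (μ '' H.E) → a ∈ acl (μ '' H.E) → b ∈ acl (μ '' H.E) →
      m ∈ acl (μ '' H.E) → w ^ 2 ≠ 1 → b ^ 2 ≠ 1 →
      (1 - w ^ 2 - a ^ 2 - b ^ 2 + 2 * w * a * b) * (s ^ 2 + t ^ 2 - 2 * w * s * t) +
        ((1 - w ^ 2) * m - s * (a - w * b) - t * (b - w * a)) ^ 2 =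
        (1 - w ^ 2) * (1 - w ^ 2 - a ^ 2 - b ^ 2 + 2 * w * a * b) → t ∈ 𝒪 → s ∈ 𝒪 := by
    intro w a b m s t hw ha hb hm hw1 hb1 h ht
    have h1 : (1 : ℂ) ∈ acl (μ '' H.E) := one_mem _
    have h2 : (2 : ℂ) ∈ acl (μ '' H.E) := ofNat_mem _ 2
    have hD : 1 - w ^ 2 ∈ acl (μ '' H.E) := sub_mem h1 (pow_mem hw 2)
    have hδ : 1 - w ^ 2 - a ^ 2 - b ^ 2 + 2 * w * a * b ∈ acl (μ '' H.E) :=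
      add_mem (sub_mem (sub_mem hD (pow_mem ha 2)) (pow_mem hb 2))
        (mul_mem (mul_mem (mul_mem h2 hw) ha) hb)
    have hr : (1 - w ^ 2) * m - t * (b - w * a) ∈ 𝒪 :=
      sub_mem (h𝒪 _ (mul_mem hD hm)) (mul_mem ht (h𝒪 _ (sub_mem hb (mul_mem hw ha))))
    refine ValuationSubring.mem_of_quadratic (k := (1 - w ^ 2) * (1 - b ^ 2))
      (b := 2 * w * (1 - w ^ 2 - a ^ 2 - b ^ 2 + 2 * w * a * b) * t +
        2 * (a - w * b) * ((1 - w ^ 2) * m - t * (b - w * a)))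
      (c := (1 - w ^ 2) * (1 - w ^ 2 - a ^ 2 - b ^ 2 + 2 * w * a * b) -
        (1 - w ^ 2 - a ^ 2 - b ^ 2 + 2 * w * a * b) * t ^ 2 -
          ((1 - w ^ 2) * m - t * (b - w * a)) ^ 2) ?_ ?_ ?_ ?_ ?_
    · exact mul_ne_zero (fun h => hw1 (by linear_combination -h))
        fun h => hb1 (by linear_combination -h)
    · exact h𝒪 _ (inv_mem (mul_mem hD (sub_mem h1 (pow_mem hb 2))))
    · exact add_mem (mul_mem (h𝒪 _ (mul_mem (mul_mem h2 hw) hδ)) ht)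
        (mul_mem (h𝒪 _ (mul_mem h2 (sub_mem ha (mul_mem hw hb)))) hr)
    · exact sub_mem (sub_mem (h𝒪 _ (mul_mem hD hδ)) (mul_mem (h𝒪 _ hδ) (pow_mem ht 2)))
        (pow_mem hr 2)
    · linear_combination h
  have hst : ∀ z ∈ (gramFiber_finite hH hμ hl').toFinset, ¬ (l - z 0 1 ∈ 𝒪) ∧ ¬ (z 0 1 ∈ 𝒪) := by
    intro z hz
    obtain ⟨s, d₀, d, rfl, e1, e2, e3⟩ :=
      (mem_gramFiber_center_iff hV hE hw).1 ((Set.Finite.mem_toFinset _).1 hz)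
    have e4 := congrArg (· ^ 2) e3
    simp only [mul_pow] at e4
    rw [e1, e2] at e4
    have k1 := step (s := s) (t := l - s) hw' ha hb hm hw hb1 (by linear_combination -e4)
    have k2 := step (s := l - s) (t := s) hw' hb ha hm hw ha1 (by linear_combination -e4)
    have ht : gramPlacement (μ {1, 2}) ![s, l - s, d₀] ![μ {1, 3}, μ {2, 3}, d] 0 1 = l - s := rfl
    rw [ht, sub_sub_cancel]
    exact ⟨fun h => hl (by simpa using add_mem (k2 h) h), fun h => hl (by simpa using add_mem h (k1 h))⟩
  rw [← hP.curveClass_eq_graphClass hH hμ, hP.curveClass_eq hH hμ h𝒪 hl hl',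
    Finset.filter_false_of_mem fun z hz => (hst z hz).1,
    Finset.filter_false_of_mem fun z hz => (hst z hz).2,
    ← Set.ncard_eq_toFinset_card _ (gramFiber_finite hH hμ hl'), card_gramFiber_center hV hE hw hμ hl']
  norm_num

end Center

end

/-- **Main theorem.** There is an assignment of a triple (the `S²`-class) to every
calligraph, with value `(1,1,0)` on `L`, `(1,0,1)` on `R`, `(2,0,0)` on `C`, such
that for every minimally rigid graph with a calligraphic split, the number of
congruence classes of spherical realizations with generic edge lengths is the
quadratic-form product of the classes of the two parts. -/
theorem sphere_count_by_calligraphic_split :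
    ∃ cl : {H : GeoGraph // Calligraph H} → ℤ × ℤ × ℤ,
      (∀ H : {H : GeoGraph // Calligraph H},
        H.1.V = ({0, 1, 2} : Finset ℕ) →
        H.1.E = ({{1, 2}, {0, 1}} : Finset (Finset ℕ)) → cl H = (1, 1, 0)) ∧
      (∀ H : {H : GeoGraph // Calligraph H},
        H.1.V = ({0, 1, 2} : Finset ℕ) →
        H.1.E = ({{1, 2}, {0, 2}} : Finset (Finset ℕ)) → cl H = (1, 0, 1)) ∧
      (∀ H : {H : GeoGraph // Calligraph H},
        H.1.V = ({0, 1, 2, 3} : Finset ℕ) →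
        H.1.E = ({{1, 2}, {0, 3}, {1, 3}, {2, 3}} : Finset (Finset ℕ)) → cl H = (2, 0, 0)) ∧
      (∀ (G : GeoGraph) (G₁ G₂ : {H : GeoGraph // Calligraph H}) (lam : Finset ℕ → ℝ),
        Laman G → IsSplit G G₁.1 G₂.1 → Generic G lam →
        Finite (SphereClasses G lam) ∧
        (Nat.card (SphereClasses G lam) : ℤ) =
          2 * ((cl G₁).1 * (cl G₂).1 - (cl G₁).2.1 * (cl G₂).2.1
                - (cl G₁).2.2 * (cl G₂).2.2)) := by
  refine ⟨fun H => graphClass H.2.tight, fun H hV hE => graphClass_left hV hE _,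
    fun H hV hE => graphClass_right hV hE _, fun H hV hE => graphClass_center hV hE _,
    fun G G₁ G₂ lam _ hs hgen => ?_⟩
  have hμ := hgen.indepOn_sphereGram
  obtain ⟨hfin, hN⟩ := hs.ncard_eq_graphClass G₁.2.tight G₂.2.tight hμ
  have he := hs.mem_edges G₁.2.tight
  obtain ⟨φ⟩ := sphereClasses_equiv he (AlgebraicIndependent.sq_ne_one hμ ⟨_, he⟩)
  have := hfin.to_subtype
  exact ⟨Finite.of_equiv _ φ.symm, by rw [Nat.card_congr φ, Nat.card_coe_set_eq]; exact hN⟩
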